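/- Let D₁, D₂ be semilocal Prüfer domains, and suppose there is an order isomorphism ν : hiSpec(D₁) → hiSpec(D₂) such that: (1) for every P ∈ hiSpec(D₁) that is not a minimal element of hiSpec(D₁) \ {(0)}, there is an order isomorphism ν_P : FStar(Z(P)) → FStar(Z(ν(P))); and (2) for every M ∈ Max(D₁), the maximal ideal M(D₁)_M of (D₁)_M is principal if and only if ν(M)(D₂)_{ν(M)} is principal. Then there is an order isomorphism between Star(D₁) and Star(D₂). -/

import Mathlib

/- Common background: Prüfer domains, semistar and (fractional) star operations,
standard decomposition, skeleton, supports, `hiSpec`, the rings `Z(P)`,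
and the invariants `ω` and `ε`, following Spirito,
"Semistar operations on semilocal Prüfer domains". -/

set_option linter.unusedSectionVars false
set_option maxHeartbeats 1000000

open Pointwise

noncomputable section

namespace Paper

variable (D : Type*) [CommRing D] [IsDomain D]
variable (K : Type*) [Field K] [Algebra D K] [IsFractionRing D K]

/-- The localization of `D` at a prime ideal `P`, viewed as an overring of `D`
inside its quotient field `K`. -/
def locAt (P : Ideal D) (hP : P.IsPrime) : Subalgebra D K :=
  Localization.subalgebra K (@Ideal.primeCompl D _ P hP)
    (fun _ hx => mem_nonZeroDivisors_of_ne_zero fun h => hx (h ▸ P.zero_mem))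

/-- A Prüfer domain: every localization at a prime ideal is a valuation domain
(any two elements are comparable w.r.t. divisibility). -/
def IsPrufer : Prop :=
  ∀ (P : Ideal D) (hP : P.IsPrime), ∀ x y : locAt D K P hP, ∃ z, x * z = y ∨ y * z = x

/-- A semilocal ring: finitely many maximal ideals. -/
def IsSemilocal : Prop := {I : Ideal D | I.IsMaximal}.Finite

/-- Two ideals are dependent if some nonzero prime ideal is contained in both. -/
def Dependent (M N : Ideal D) : Prop :=
  ∃ P : Ideal D, P.IsPrime ∧ P ≠ ⊥ ∧ P ≤ M ∧ P ≤ N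

/-- The member of the standard decomposition corresponding to the dependence class
of the maximal ideal `M`: the intersection of the localizations of `D` at the
maximal ideals dependent on `M`. -/
def TOf (M : Ideal D) : Subalgebra D K :=
  sInf {A | ∃ (N : Ideal D) (hN : N.IsMaximal), Dependent D M N ∧ A = locAt D K N hN.isPrime}

/-- The standard decomposition of `D`. -/
def stdDecomp : Set (Subalgebra D K) :=
  {T | ∃ M : Ideal D, M.IsMaximal ∧ T = TOf D K M}

/-- The skeleton of `Over(D)`: all intersections of subsets of the standard
decomposition (including the empty intersection `K` and the total one `D`). -/
def SkOver : Set (Subalgebra D K) :=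
  {A | ∃ S ⊆ stdDecomp D K, A = sInf S}

/-- `I` is a fractional ideal of the overring `A` of `D`: it is an `A`-submodule
of `K` and `dI ⊆ A` for some nonzero `d ∈ K`. -/
def IsFracOf (A : Subalgebra D K) (I : Submodule D K) : Prop :=
  (∀ a ∈ A, ∀ x ∈ I, a * x ∈ I) ∧ ∃ d : K, d ≠ 0 ∧ ∀ x ∈ I, d * x ∈ A

end Paper

namespace Paper

/-- A semistar operation on a domain `R` with quotient field `K`: an extensive,
order-preserving, idempotent self-map of the set of `R`-submodules of `K` such
that `(xI)^⋆ = x·I^⋆` for every nonzero `x ∈ K`. -/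
structure Semistar (R : Type*) [CommRing R] (K : Type*) [Field K] [Algebra R K] where
  toFun : Submodule R K → Submodule R K
  le_star' : ∀ I, I ≤ toFun I
  mono' : ∀ ⦃I J⦄, I ≤ J → toFun I ≤ toFun J
  idem' : ∀ I, toFun (toFun I) = toFun I
  smul' : ∀ (x : K), x ≠ 0 → ∀ I,
    toFun (Submodule.span R {x} * I) = Submodule.span R {x} * toFun I

namespace Semistar

variable {R : Type*} [CommRing R] {K : Type*} [Field K] [Algebra R K]

theorem ext' {s t : Semistar R K} (h : s.toFun = t.toFun) : s = t := by
  cases s; cases t; cases h; rfl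

instance : PartialOrder (Semistar R K) where
  le s t := ∀ I, s.toFun I ≤ t.toFun I
  le_refl _ _ := le_rfl
  le_trans _ _ _ hab hbc I := (hab I).trans (hbc I)
  le_antisymm _ _ h h' := ext' (funext fun I => le_antisymm (h I) (h' I))

end Semistar

/-- The identity semistar operation `d`. -/
def dOp (R : Type*) [CommRing R] (K : Type*) [Field K] [Algebra R K] : Semistar R K where
  toFun I := I
  le_star' _ := le_rfl
  mono' _ _ h := h
  idem' _ := rfl
  smul' _ _ _ := rfl

end Paper

namespace Paper

variable (D : Type*) [CommRing D] [IsDomain D]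
variable (K : Type*) [Field K] [Algebra D K] [IsFractionRing D K]

/-- A fractional star operation on an overring `A` of `D` (inside `K`): a
semistar-like closure operation defined on the fractional ideals of `A`.
In particular `FracStar D K ⊥` is the set of fractional star operations on `D`. -/
structure FracStar (A : Subalgebra D K) where
  toFun : {I : Submodule D K // IsFracOf D K A I} → {I : Submodule D K // IsFracOf D K A I}
  le_star' : ∀ I, I.1 ≤ (toFun I).1
  mono' : ∀ I J, I.1 ≤ J.1 → (toFun I).1 ≤ (toFun J).1
  idem' : ∀ I, toFun (toFun I) = toFun I
  smul' : ∀ (x : K), x ≠ 0 → ∀ I J, J.1 = Submodule.span D {x} * I.1 →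
    (toFun J).1 = Submodule.span D {x} * (toFun I).1

namespace FracStar

variable {D K} {A : Subalgebra D K}

theorem ext' {s t : FracStar D K A} (h : s.toFun = t.toFun) : s = t := by
  cases s; cases t; cases h; rfl

instance : PartialOrder (FracStar D K A) where
  le s t := ∀ I, (s.toFun I).1 ≤ (t.toFun I).1
  le_refl _ _ := le_rfl
  le_trans _ _ _ hab hbc I := (hab I).trans (hbc I)
  le_antisymm _ _ h h' := ext' (funext fun I => Subtype.ext (le_antisymm (h I) (h' I)))

end FracStar

/-- A fractional star operation on the overring `A` is a *star operation* if it
closes `A` itself. -/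
def FracStar.IsStarOp {A : Subalgebra D K} (f : FracStar D K A) : Prop :=
  ∀ h : IsFracOf D K A (Subalgebra.toSubmodule A),
    (f.toFun ⟨Subalgebra.toSubmodule A, h⟩).1 = Subalgebra.toSubmodule A

/-- The support of a semistar operation on `D`: the elements `A` of the skeleton
such that `A^⋆` is a fractional ideal of `A`. -/
def supp (s : Semistar D K) : Set (Subalgebra D K) :=
  {A | A ∈ SkOver D K ∧ IsFracOf D K A (s.toFun (Subalgebra.toSubmodule A))}

/-- The image of an ideal of `D` inside `K`. -/
def idealToK (P : Ideal D) : Submodule D K := Submodule.map (Algebra.linearMap D K) P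

end Paper

namespace Paper

/-- An abstract fractional star operation on a commutative ring `A`, acting on
the fractional ideals of `A` inside its fraction ring. -/
structure AFracStar (A : Type*) [CommRing A] where
  toFun : FractionalIdeal (nonZeroDivisors A) (FractionRing A) →
    FractionalIdeal (nonZeroDivisors A) (FractionRing A)
  le_star' : ∀ I, I ≤ toFun I
  mono' : ∀ ⦃I J⦄, I ≤ J → toFun I ≤ toFun J
  idem' : ∀ I, toFun (toFun I) = toFun I
  smul' : ∀ (x : FractionRing A), x ≠ 0 → ∀ I,
    toFun (FractionalIdeal.spanSingleton (nonZeroDivisors A) x * I) =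
      FractionalIdeal.spanSingleton (nonZeroDivisors A) x * toFun I

namespace AFracStar

variable {A : Type*} [CommRing A]

theorem ext' {s t : AFracStar A} (h : s.toFun = t.toFun) : s = t := by
  cases s; cases t; cases h; rfl

instance : PartialOrder (AFracStar A) where
  le s t := ∀ I, s.toFun I ≤ t.toFun I
  le_refl _ _ := le_rfl
  le_trans _ _ _ hab hbc I := (hab I).trans (hbc I)
  le_antisymm _ _ h h' := ext' (funext fun I => le_antisymm (h I) (h' I))

end AFracStar

/-- Abstract star operations on `A`: fractional star operations closing `A`. -/
def AStar (A : Type*) [CommRing A] : Type _ := {s : AFracStar A // s.toFun 1 = 1}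

instance (A : Type*) [CommRing A] : PartialOrder (AStar A) :=
  inferInstanceAs (PartialOrder {s : AFracStar A // s.toFun 1 = 1})

end Paper

namespace Paper

variable (D : Type*) [CommRing D] [IsDomain D]

/-- `P` is a branching point of `Spec(D)`: the infimum (among the primes) of a
family of pairwise incomparable primes not containing `P`. -/
def IsBranchPoint (P : Ideal D) : Prop :=
  ∃ S : Set (Ideal D), (∀ Q ∈ S, Q.IsPrime) ∧
    (S.Pairwise fun Q₁ Q₂ => ¬Q₁ ≤ Q₂ ∧ ¬Q₂ ≤ Q₁) ∧ P ∉ S ∧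
    (∀ Q ∈ S, P ≤ Q) ∧ ∀ P' : Ideal D, P'.IsPrime → (∀ Q ∈ S, P' ≤ Q) → P' ≤ P

/-- The homeomorphically irreducible tree underlying `Spec(D)`: the zero ideal,
the maximal ideals and the branching points, ordered by inclusion. -/
def hiSpec : Set (Ideal D) :=
  {P | P.IsPrime ∧ (P = ⊥ ∨ P.IsMaximal ∨ IsBranchPoint D P)}

/-- `Q` is the element of `hiSpec D` directly below `P`. -/
def DirectlyBelow (Q P : Ideal D) : Prop :=
  Q ∈ hiSpec D ∧ P ∈ hiSpec D ∧ Q < P ∧ ∀ R ∈ hiSpec D, Q < R → ¬R < P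

/-- The localization of `D` at the prime ideal `P`, as an abstract ring. -/
abbrev locRing (P : Ideal D) (hP : P.IsPrime) : Type _ :=
  Localization (@Ideal.primeCompl D _ P hP)

/-- The valuation ring `Z(P) = D_P / Q·D_P`. -/
abbrev Zring (P Q : Ideal D) (hP : P.IsPrime) : Type _ :=
  locRing D P hP ⧸ Ideal.map (algebraMap D (locRing D P hP)) Q

/-- `ω(P) = |FStar(Z(P))|`, where `Q` is the element of `hiSpec D` directly
below `P`. -/
def omegaAt (P Q : Ideal D) (hP : P.IsPrime) : ℕ :=
  Nat.card (AFracStar (Zring D P Q hP))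

open Classical in
/-- `ε(P) = |Star(D_P)| ∈ {1,2}` for a (nonzero) prime `P`. -/
def epsilonOf (A : Ideal D) : ℕ :=
  if h : A.IsPrime then Nat.card (AStar (locRing D A h)) else 0

end Paper

namespace Paper

theorem mem_hiSpec_prime {D : Type*} [CommRing D] [IsDomain D] {P : Ideal D}
    (h : P ∈ hiSpec D) : P.IsPrime := h.1

theorem maximal_mem_hiSpec {D : Type*} [CommRing D] [IsDomain D] {M : Ideal D}
    (h : M.IsMaximal) : M ∈ hiSpec D := ⟨h.isPrime, Or.inr (Or.inl h)⟩

end Paper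

namespace Paper

/-- Closure operators on a poset commuting with a family of automorphisms. -/
structure EquivClosure {G Y : Type*} [PartialOrder Y] (ρ : G → Y ≃o Y) where
  toFun : Y → Y
  le_closure' : ∀ y, y ≤ toFun y
  mono' : ∀ ⦃y z⦄, y ≤ z → toFun y ≤ toFun z
  idem' : ∀ y, toFun (toFun y) = toFun y
  comm' : ∀ g y, toFun (ρ g y) = ρ g (toFun y)

namespace EquivClosure

section Basic

variable {G Y : Type*} [PartialOrder Y] {ρ : G → Y ≃o Y}

instance : FunLike (EquivClosure ρ) Y Y where
  coe := toFun
  coe_injective := by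
    intro c d h
    cases c; cases d; cases h; rfl

@[ext] theorem ext {c d : EquivClosure ρ} (h : ∀ y, c y = d y) : c = d := DFunLike.ext _ _ h

@[simp] theorem coe_mk (f : Y → Y) (h₁ h₂ h₃ h₄) (y : Y) :
    (⟨f, h₁, h₂, h₃, h₄⟩ : EquivClosure ρ) y = f y := rfl

theorem le_closure (c : EquivClosure ρ) (y : Y) : y ≤ c y := c.le_closure' y
theorem mono (c : EquivClosure ρ) {y z : Y} (h : y ≤ z) : c y ≤ c z := c.mono' h
@[simp] theorem idem (c : EquivClosure ρ) (y : Y) : c (c y) = c y := c.idem' y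
theorem comm (c : EquivClosure ρ) (g : G) (y : Y) : c (ρ g y) = ρ g (c y) := c.comm' g y

theorem closure_le (c : EquivClosure ρ) {y z : Y} (h : y ≤ z) (hz : c z = z) : c y ≤ z :=
  (c.mono h).trans hz.le

instance : PartialOrder (EquivClosure ρ) where
  le c d := ∀ y, c y ≤ d y
  le_refl _ _ := le_rfl
  le_trans _ _ _ hab hbc y := (hab y).trans (hbc y)
  le_antisymm _ _ h h' := ext fun y => le_antisymm (h y) (h' y)

instance : OrderBot (EquivClosure ρ) where
  bot := ⟨fun y => y, fun _ => le_rfl, fun _ _ h => h, fun _ => rfl, fun _ _ => rfl⟩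
  bot_le c y := c.le_closure y

theorem eq_bot_iff' {c : EquivClosure ρ} : c = ⊥ ↔ ∀ y, c y = y :=
  ⟨fun h y => by rw [h]; rfl, fun h => ext h⟩

instance [OrderTop Y] : OrderTop (EquivClosure ρ) where
  top := ⟨fun _ => ⊤, fun _ => le_top, fun _ _ _ => le_rfl, fun _ => rfl, fun g _ => by simp⟩
  le_top _ _ := le_top

@[simp] theorem top_apply [OrderTop Y] (y : Y) : (⊤ : EquivClosure ρ) y = ⊤ := rfl

@[simp] theorem apply_top [OrderTop Y] (c : EquivClosure ρ) : c ⊤ = ⊤ :=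
  top_le_iff.1 (c.le_closure ⊤)

theorem eq_top_iff' [OrderTop Y] {c : EquivClosure ρ} : c = ⊤ ↔ ∀ y, c y = ⊤ :=
  ⟨fun h y => by rw [h]; rfl, fun h => ext h⟩

end Basic

section Transport

variable {G Y G' Y' : Type*} [PartialOrder Y] [PartialOrder Y'] {ρ : G → Y ≃o Y}
  {ρ' : G' → Y' ≃o Y'}

/-- Conjugation of an equivariant closure by an order isomorphism. -/
def conj (e : Y ≃o Y') (h : ∀ g', ∃ g, ∀ y, e (ρ g y) = ρ' g' (e y)) (c : EquivClosure ρ) :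
    EquivClosure ρ' where
  toFun y := e (c (e.symm y))
  le_closure' y := by
    have := c.le_closure (e.symm y)
    rwa [← e.le_iff_le, e.apply_symm_apply] at this
  mono' y z hyz := e.monotone (c.mono (e.symm.monotone hyz))
  idem' y := by simp
  comm' g' y := by
    obtain ⟨g, hg⟩ := h g'
    have : e.symm (ρ' g' y) = ρ g (e.symm y) := by
      rw [OrderIso.symm_apply_eq, hg, e.apply_symm_apply]
    rw [this, c.comm, hg]

@[simp] theorem conj_apply (e : Y ≃o Y') (h : ∀ g', ∃ g, ∀ y, e (ρ g y) = ρ' g' (e y))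
    (c : EquivClosure ρ) (y : Y') : conj e h c y = e (c (e.symm y)) := rfl

/-- An equivariant order isomorphism induces one between the closures. -/
def congr (e : Y ≃o Y') (h : ∀ g, ∃ g', ∀ y, e (ρ g y) = ρ' g' (e y))
    (h' : ∀ g', ∃ g, ∀ y, e (ρ g y) = ρ' g' (e y)) : EquivClosure ρ ≃o EquivClosure ρ' where
  toFun := conj e h'
  invFun := conj e.symm fun g => by
    obtain ⟨g', hg⟩ := h g
    exact ⟨g', fun y => by rw [OrderIso.symm_apply_eq, hg, e.apply_symm_apply]⟩
  left_inv c := by ext y; simp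
  right_inv c := by ext y; simp
  map_rel_iff' {c d} := by
    constructor
    · intro H y
      simpa using H (e y)
    · intro H y
      exact e.monotone (H _)

end Transport

section Restrict

variable {G Y : Type*} [PartialOrder Y] {ρ : G → Y ≃o Y}

open Classical in
/-- If every equivariant closure fixes the least element, it may be discarded. -/
def neBotIso [OrderBot Y] (hbot : ∀ c : EquivClosure ρ, c ⊥ = ⊥)
    (ρ' : G → {y : Y // y ≠ ⊥} ≃o {y : Y // y ≠ ⊥}) (h : ∀ g y, (ρ' g y : Y) = ρ g y) :
    EquivClosure ρ ≃o EquivClosure ρ' where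
  toFun c :=
    { toFun := fun y => ⟨c y, ne_bot_of_le_ne_bot y.2 (c.le_closure y)⟩
      le_closure' := fun y => c.le_closure y
      mono' := fun y z hyz => c.mono hyz
      idem' := fun y => Subtype.ext (by simp)
      comm' := fun g y => Subtype.ext (by simp [h, c.comm]) }
  invFun c :=
    { toFun := fun y => if hy : y = ⊥ then ⊥ else c ⟨y, hy⟩
      le_closure' := fun y => by
        split_ifs with hy
        · exact hy.le
        · exact c.le_closure ⟨y, hy⟩
      mono' := fun y z hyz => by
        split_ifs with hy hz hz
        · exact le_rfl
        · exact bot_le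
        · exact absurd (le_bot_iff.1 (hz ▸ hyz)) hy
        · exact c.mono (y := ⟨y, hy⟩) (z := ⟨z, hz⟩) hyz
      idem' := fun y => by
        by_cases hy : y = ⊥
        · simp [hy]
        · simp [hy, (c ⟨y, hy⟩).2]
      comm' := fun g y => by
        by_cases hy : y = ⊥
        · simp [hy]
        · have hy' : ρ g y ≠ ⊥ := by simpa using hy
          have : (⟨ρ g y, hy'⟩ : {y : Y // y ≠ ⊥}) = ρ' g ⟨y, hy⟩ := Subtype.ext (h g ⟨y, hy⟩).symm
          simp only [hy, hy', dite_false, this, c.comm, h] }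
  left_inv c := by
    ext y
    by_cases hy : y = ⊥
    · subst hy
      simp [hbot]
    · simp [hy]
  right_inv c := by
    ext y
    simp [y.2]
  map_rel_iff' {c d} := by
    constructor
    · intro H y
      by_cases hy : y = ⊥
      · subst hy
        simp [hbot]
      · exact H ⟨y, hy⟩
    · intro H y
      exact H y.1

theorem eq_top_of_apply_eq_top [OrderTop Y]
    (htr : ∀ y z : Y, y ≠ ⊤ → z ≠ ⊤ → ∃ g, y ≤ ρ g z) {c : EquivClosure ρ} {y : Y} (hy : y ≠ ⊤)
    (hc : c y = ⊤) : c = ⊤ := by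
  rw [eq_top_iff']
  intro z
  by_cases hz : z = ⊤
  · simp [hz]
  · obtain ⟨g, hg⟩ := htr y z hy hz
    have := c.mono hg
    rw [hc, c.comm, top_le_iff] at this
    simpa using this

theorem apply_ne_top [OrderTop Y]
    (htr : ∀ y z : Y, y ≠ ⊤ → z ≠ ⊤ → ∃ g, y ≤ ρ g z) {c : EquivClosure ρ} (hc : c ≠ ⊤) {y : Y}
    (hy : y ≠ ⊤) : c y ≠ ⊤ := fun h => hc (eq_top_of_apply_eq_top htr hy h)

open Classical in
/-- Under a transitivity assumption, the closures different from `⊤` are those of the poset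
without its greatest element. -/
def neTopIso [OrderTop Y] (htr : ∀ y z : Y, y ≠ ⊤ → z ≠ ⊤ → ∃ g, y ≤ ρ g z)
    (hne : ∃ y : Y, y ≠ ⊤)
    (ρ' : G → {y : Y // y ≠ ⊤} ≃o {y : Y // y ≠ ⊤}) (h : ∀ g y, (ρ' g y : Y) = ρ g y) :
    {c : EquivClosure ρ // c ≠ ⊤} ≃o EquivClosure ρ' where
  toFun c :=
    { toFun := fun y => ⟨c.1 y, apply_ne_top htr c.2 y.2⟩
      le_closure' := fun y => c.1.le_closure y
      mono' := fun y z hyz => c.1.mono hyz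
      idem' := fun y => Subtype.ext (by simp)
      comm' := fun g y => Subtype.ext (by simp [h, c.1.comm]) }
  invFun c :=
    ⟨{toFun := fun y => if hy : y = ⊤ then ⊤ else c ⟨y, hy⟩
      le_closure' := fun y => by
        split_ifs with hy
        · exact hy.le
        · exact c.le_closure ⟨y, hy⟩
      mono' := fun y z hyz => by
        split_ifs with hy hz hz
        · exact le_rfl
        · exact absurd (top_le_iff.1 (hy ▸ hyz)) hz
        · exact le_top
        · exact c.mono (y := ⟨y, hy⟩) (z := ⟨z, hz⟩) hyz
      idem' := fun y => by
        by_cases hy : y = ⊤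
        · simp [hy]
        · simp [hy, (c ⟨y, hy⟩).2]
      comm' := fun g y => by
        by_cases hy : y = ⊤
        · simp [hy]
        · have hy' : ρ g y ≠ ⊤ := by simpa using hy
          have : (⟨ρ g y, hy'⟩ : {y : Y // y ≠ ⊤}) = ρ' g ⟨y, hy⟩ := Subtype.ext (h g ⟨y, hy⟩).symm
          simp only [hy, hy', dite_false, this, c.comm, h] }, by
      obtain ⟨y, hy⟩ := hne
      intro H
      have := eq_top_iff'.1 H y
      simp only [coe_mk, dif_neg hy] at this
      exact (c ⟨y, hy⟩).2 this⟩
  left_inv c := by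
    ext y
    by_cases hy : y = ⊤
    · subst hy
      simp
    · simp [hy]
  right_inv c := by
    ext y
    simp [y.2]
  map_rel_iff' {c d} := by
    constructor
    · intro H y
      by_cases hy : y = ⊤
      · subst hy
        simp
      · exact H ⟨y, hy⟩
    · intro H y
      exact H y.1

end Restrict

end EquivClosure

open Classical in
/-- Extend an order isomorphism between complements of the greatest elements. -/
def orderIsoOfNeTop {A B : Type*} [PartialOrder A] [PartialOrder B] [OrderTop A] [OrderTop B]
    (e : {a : A // a ≠ ⊤} ≃o {b : B // b ≠ ⊤}) : A ≃o B :=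
  WithTop.subtypeOrderIso.symm.trans ((OrderIso.withTopCongr e).trans WithTop.subtypeOrderIso)

end Paper

namespace Paper

/-- A poset `X` with operators `σ` is decomposed as (a part of) the product of the posets `Y i`
with operators `ρ i`; the part is cut out by the allowed supports `{i | u i ≠ ⊤}`. -/
structure ProductData {ι : Type*} (𝒮 : Set (Set ι)) {G X : Type*} {Y : ι → Type*}
    [PartialOrder X] [∀ i, PartialOrder (Y i)] [∀ i, OrderTop (Y i)]
    (σ : G → X ≃o X) (ρ : ∀ i, G → Y i ≃o Y i) where
  iso : X ≃o {u : ∀ i, Y i // {i | u i ≠ ⊤} ∈ 𝒮}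
  map_smul : ∀ g x i, (iso (σ g x)).1 i = ρ i g ((iso x).1 i)
  mark : ∀ i, Y i
  mark_ne_top : ∀ i, mark i ≠ ⊤
  transitive : ∀ i (y z : Y i), y ≠ ⊤ → z ≠ ⊤ → ∃ g, y ≤ ρ i g z
  independent : ∀ i (u v : ∀ j, Y j), ∃ g, (∀ y, ρ i g y = y) ∧
    ∀ j, j ≠ i → u j ≠ ⊤ → v j ≠ ⊤ → u j ≤ ρ j g (v j)

/-- The combinatorial description of the equivariant closures on a product. -/
structure ClosureFamily {ι : Type*} (𝒮 : Set (Set ι)) (E : ι → Type*)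
    [∀ i, PartialOrder (E i)] [∀ i, OrderTop (E i)] where
  toFun : Set ι → ∀ i, E i
  eq_top : ∀ S i, i ∉ S ∨ S ∉ 𝒮 → toFun S i = ⊤
  anti : ∀ S T, S ∈ 𝒮 → T ∈ 𝒮 → T ⊆ S → toFun S ≤ toFun T
  supp_mem : ∀ S, S ∈ 𝒮 → {i | toFun S i ≠ ⊤} ∈ 𝒮
  supp_apply : ∀ S, S ∈ 𝒮 → toFun {i | toFun S i ≠ ⊤} = toFun S

namespace ClosureFamily

variable {ι : Type*} {𝒮 : Set (Set ι)} {E E' : ι → Type*}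
    [∀ i, PartialOrder (E i)] [∀ i, OrderTop (E i)]
    [∀ i, PartialOrder (E' i)] [∀ i, OrderTop (E' i)]

theorem ext {F F' : ClosureFamily 𝒮 E} (h : F.toFun = F'.toFun) : F = F' := by
  cases F; cases F'; cases h; rfl

instance : PartialOrder (ClosureFamily 𝒮 E) where
  le F F' := ∀ S, F.toFun S ≤ F'.toFun S
  le_refl _ _ := le_rfl
  le_trans _ _ _ hab hbc S := (hab S).trans (hbc S)
  le_antisymm _ _ h h' := ext (funext fun S => le_antisymm (h S) (h' S))

/-- Apply order isomorphisms componentwise. -/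
def map (φ : ∀ i, E i ≃o E' i) (F : ClosureFamily 𝒮 E) : ClosureFamily 𝒮 E' where
  toFun S i := φ i (F.toFun S i)
  eq_top S i h := by rw [F.eq_top S i h, (φ i).map_top]
  anti S T hS hT h i := (φ i).monotone (F.anti S T hS hT h i)
  supp_mem S hS := by simpa using F.supp_mem S hS
  supp_apply S hS := by
    ext i
    simp [F.supp_apply S hS]

/-- Componentwise order isomorphisms induce one between families of closures. -/
def congr (φ : ∀ i, E i ≃o E' i) : ClosureFamily 𝒮 E ≃o ClosureFamily 𝒮 E' where
  toFun := map φ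
  invFun := map fun i => (φ i).symm
  left_inv F := ext <| by funext S i; simp [map]
  right_inv F := ext <| by funext S i; simp [map]
  map_rel_iff' {F F'} := by
    constructor
    · intro H S i
      exact (φ i).le_iff_le.1 (H S i)
    · intro H S i
      exact (φ i).monotone (H S i)

@[simp] theorem congr_toFun (φ : ∀ i, E i ≃o E' i) (F : ClosureFamily 𝒮 E) (S : Set ι) (i : ι) :
    (congr φ F).toFun S i = φ i (F.toFun S i) := rfl

open Classical in
/-- For the single support `univ`, a family with non-top components is a plain tuple. -/
def ofTuple (f : ∀ i, E i) (hf : ∀ i, f i ≠ ⊤) : ClosureFamily {(Set.univ : Set ι)} E where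
  toFun S i := if S = Set.univ then f i else ⊤
  eq_top S i h := by
    rcases h with h | h
    · rw [if_neg]
      rintro rfl
      exact h trivial
    · exact if_neg h
  anti S T hS hT _ := by
    rw [Set.mem_singleton_iff.1 hS, Set.mem_singleton_iff.1 hT]
  supp_mem S hS := by
    rw [Set.mem_singleton_iff.1 hS]
    simpa [Set.eq_univ_iff_forall] using hf
  supp_apply S hS := by
    rw [Set.mem_singleton_iff.1 hS]
    have : {i | f i ≠ ⊤} = Set.univ := Set.eq_univ_iff_forall.2 hf
    simp [this]

end ClosureFamily

namespace ProductData

variable {ι : Type*} {𝒮 : Set (Set ι)} {G X : Type*} {Y : ι → Type*}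
    [PartialOrder X] [∀ i, PartialOrder (Y i)] [∀ i, OrderTop (Y i)]
    {σ : G → X ≃o X} {ρ : ∀ i, G → Y i ≃o Y i} (d : ProductData 𝒮 σ ρ)

/-- The support of an element. -/
def supp (x : X) : Set ι := {i | (d.iso x).1 i ≠ ⊤}

theorem supp_mem (x : X) : d.supp x ∈ 𝒮 := (d.iso x).2

theorem mem_supp {x : X} {i : ι} : i ∈ d.supp x ↔ (d.iso x).1 i ≠ ⊤ := Iff.rfl

theorem supp_anti {x y : X} (h : x ≤ y) : d.supp y ⊆ d.supp x := by
  intro i hi hx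
  have := (d.iso.monotone h) i
  rw [hx, top_le_iff] at this
  exact hi this

theorem supp_smul (g : G) (x : X) : d.supp (σ g x) = d.supp x := by
  ext i
  simp [mem_supp, d.map_smul]

theorem le_iff {x y : X} : x ≤ y ↔ ∀ i, (d.iso x).1 i ≤ (d.iso y).1 i := by
  rw [← d.iso.le_iff_le]
  rfl

open Classical in
/-- The tuple with support `S` that is `y` at `i`. -/
def tuple (S : Set ι) (i : ι) (y : Y i) (j : ι) : Y j :=
  if h : j = i then h ▸ y else if j ∈ S then d.mark j else ⊤

@[simp] theorem tuple_self (S : Set ι) (i : ι) (y : Y i) : d.tuple S i y i = y := by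
  simp [tuple]

theorem tuple_ne_top {S : Set ι} {i : ι} (hi : i ∈ S) {y : Y i} (hy : y ≠ ⊤) :
    {j | d.tuple S i y j ≠ ⊤} = S := by
  ext j
  by_cases h : j = i
  · subst h
    simp [hy, hi]
  · by_cases hj : j ∈ S <;> simp [tuple, h, hj, d.mark_ne_top]

/-- The element with support `S` that is `y` at `i`. -/
def elt {S : Set ι} (hS : S ∈ 𝒮) {i : ι} (hi : i ∈ S) (y : Y i) (hy : y ≠ ⊤) : X :=
  d.iso.symm ⟨d.tuple S i y, by rwa [d.tuple_ne_top hi hy]⟩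

theorem iso_elt {S : Set ι} (hS : S ∈ 𝒮) {i : ι} (hi : i ∈ S) (y : Y i) (hy : y ≠ ⊤) (j : ι) :
    (d.iso (d.elt hS hi y hy)).1 j = d.tuple S i y j := by
  simp [elt]

theorem supp_elt {S : Set ι} (hS : S ∈ 𝒮) {i : ι} (hi : i ∈ S) (y : Y i) (hy : y ≠ ⊤) :
    d.supp (d.elt hS hi y hy) = S := by
  unfold supp
  simp only [iso_elt]
  exact d.tuple_ne_top hi hy

theorem component_mono (c : EquivClosure σ) {x y : X} (hs : d.supp y ⊆ d.supp x) {i : ι}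
    (h : (d.iso x).1 i ≤ (d.iso y).1 i) : (d.iso (c x)).1 i ≤ (d.iso (c y)).1 i := by
  obtain ⟨g, hg, hgj⟩ := d.independent i (d.iso x).1 (d.iso y).1
  have : x ≤ σ g y := by
    rw [d.le_iff]
    intro j
    rw [d.map_smul]
    by_cases hj : j = i
    · subst hj
      rwa [hg]
    · by_cases hy : (d.iso y).1 j = ⊤
      · simp [hy]
      · exact hgj j hj (hs hy) hy
  have := d.le_iff.1 (c.mono this) i
  rwa [c.comm, d.map_smul, hg] at this

theorem component_eq (c : EquivClosure σ) {x y : X} (hs : d.supp x = d.supp y) {i : ι}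
    (h : (d.iso x).1 i = (d.iso y).1 i) : (d.iso (c x)).1 i = (d.iso (c y)).1 i :=
  le_antisymm (d.component_mono c hs.ge h.le) (d.component_mono c hs.le h.ge)

open Classical in
/-- The component at `i` of a closure on elements of support `S`. -/
def comp (c : EquivClosure σ) (S : Set ι) (i : ι) : EquivClosure (ρ i) :=
  if h : S ∈ 𝒮 ∧ i ∈ S then
  { toFun := fun y => if hy : y = ⊤ then ⊤ else (d.iso (c (d.elt h.1 h.2 y hy))).1 i
    le_closure' := fun y => by
      split_ifs with hy
      · exact le_top
      · have := d.le_iff.1 (c.le_closure (d.elt h.1 h.2 y hy)) i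
        simpa [d.iso_elt] using this
    mono' := fun y z hyz => by
      split_ifs with hy hz hz
      · exact le_rfl
      · exact absurd (top_le_iff.1 (hy ▸ hyz)) hz
      · exact le_top
      · refine d.component_mono c ?_ ?_
        · rw [d.supp_elt, d.supp_elt]
        · simpa [d.iso_elt] using hyz
    idem' := fun y => by
      by_cases hy : y = ⊤
      · simp [hy]
      · simp only [hy, dite_false]
        split_ifs with hz
        · exact hz.symm
        · set x := d.elt h.1 h.2 y hy with hx
          refine le_antisymm ?_ ?_
          · have h1 : d.supp (c x) ⊆ d.supp (d.elt h.1 h.2 _ hz) := by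
              rw [d.supp_elt]
              refine (d.supp_anti (c.le_closure x)).trans ?_
              rw [hx, d.supp_elt]
            have := d.component_mono c h1 (i := i) (by simp [d.iso_elt])
            rwa [c.idem] at this
          · have := d.le_iff.1 (c.le_closure (d.elt h.1 h.2 _ hz)) i
            simpa [d.iso_elt] using this
    comm' := fun g y => by
      by_cases hy : y = ⊤
      · simp [hy]
      · have hy' : ρ i g y ≠ ⊤ := by simpa using hy
        simp only [hy, hy', dite_false]
        rw [← d.map_smul, ← c.comm]
        refine d.component_eq c ?_ ?_
        · rw [d.supp_smul, d.supp_elt, d.supp_elt]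
        · simp [d.map_smul, d.iso_elt] }
  else ⊤

theorem comp_apply (c : EquivClosure σ) (x : X) (i : ι) :
    (d.iso (c x)).1 i = d.comp c (d.supp x) i ((d.iso x).1 i) := by
  by_cases hi : (d.iso x).1 i = ⊤
  · rw [hi, EquivClosure.apply_top, ← top_le_iff, ← hi]
    exact d.le_iff.1 (c.le_closure x) i
  · have h : d.supp x ∈ 𝒮 ∧ i ∈ d.supp x := ⟨d.supp_mem x, hi⟩
    simp only [comp, dif_pos h, EquivClosure.coe_mk, dif_neg hi]
    refine d.component_eq c ?_ ?_
    · rw [d.supp_elt]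
    · simp [d.iso_elt]

theorem comp_apply_elt (c : EquivClosure σ) {S : Set ι} (hS : S ∈ 𝒮) {i : ι} (hi : i ∈ S)
    (y : Y i) (hy : y ≠ ⊤) : d.comp c S i y = (d.iso (c (d.elt hS hi y hy))).1 i := by
  rw [d.comp_apply, d.supp_elt, d.iso_elt, d.tuple_self]

theorem comp_eq_top (c : EquivClosure σ) {S : Set ι} {i : ι} (h : i ∉ S ∨ S ∉ 𝒮) :
    d.comp c S i = ⊤ := by
  rw [comp, dif_neg]
  tauto

theorem comp_mono {c c' : EquivClosure σ} (h : c ≤ c') (S : Set ι) (i : ι) :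
    d.comp c S i ≤ d.comp c' S i := by
  by_cases hS : S ∈ 𝒮 ∧ i ∈ S
  · intro y
    by_cases hy : y = ⊤
    · simp [hy]
    · rw [d.comp_apply_elt c hS.1 hS.2 y hy, d.comp_apply_elt c' hS.1 hS.2 y hy]
      exact d.le_iff.1 (h _) i
  · rw [d.comp_eq_top c' (by tauto)]
    exact le_top

theorem comp_anti (c : EquivClosure σ) {S T : Set ι} (hS : S ∈ 𝒮) (hT : T ∈ 𝒮) (h : T ⊆ S)
    (i : ι) : d.comp c S i ≤ d.comp c T i := by
  by_cases hi : i ∈ T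
  · intro y
    by_cases hy : y = ⊤
    · simp [hy]
    · rw [d.comp_apply_elt c hS (h hi) y hy, d.comp_apply_elt c hT hi y hy]
      refine d.component_mono c ?_ ?_
      · rwa [d.supp_elt, d.supp_elt]
      · simp [d.iso_elt]
  · rw [d.comp_eq_top c (Or.inl hi)]
    exact le_top

theorem supp_closure (c : EquivClosure σ) (x : X) :
    d.supp (c x) = {i | d.comp c (d.supp x) i ≠ ⊤} := by
  ext i
  rw [d.mem_supp, d.comp_apply]
  change _ ↔ d.comp c (d.supp x) i ≠ ⊤
  constructor
  · rintro h H
    rw [H] at h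
    exact h rfl
  · intro h
    refine EquivClosure.apply_ne_top (d.transitive i) h ?_
    intro hi
    exact h (d.comp_eq_top c (Or.inl fun h' => h' hi))

theorem comp_supp (c : EquivClosure σ) (x : X) :
    d.comp c {i | d.comp c (d.supp x) i ≠ ⊤} = d.comp c (d.supp x) := by
  rw [← d.supp_closure]
  funext i
  by_cases hi : i ∈ d.supp (c x)
  · have hs := d.supp_anti (c.le_closure x)
    refine le_antisymm ?_ (d.comp_anti c (d.supp_mem _) (d.supp_mem _) hs i)
    intro y
    by_cases hy : y = ⊤
    · simp [hy]
    · have hi' := hs hi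
      set z := d.elt (d.supp_mem x) hi' y hy with hz
      have hsz : d.supp z = d.supp x := d.supp_elt _ _ _ _
      have h1 := d.comp_apply c (c z) i
      have h2 := d.comp_apply c z i
      have h3 : (d.iso z).1 i = y := by simp [hz, d.iso_elt]
      have h4 : d.supp (c z) = d.supp (c x) := by rw [d.supp_closure, d.supp_closure, hsz]
      rw [h3, hsz] at h2
      rw [c.idem, h2, h4] at h1
      rw [h1]
      exact EquivClosure.mono _ (EquivClosure.le_closure _ _)
  · rw [d.comp_eq_top c (Or.inl hi)]
    rw [d.supp_closure] at hi
    simpa [eq_comm] using hi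

theorem exists_supp_eq {S : Set ι} (hS : S ∈ 𝒮) : ∃ x, d.supp x = S := by
  classical
  have : {i | (fun i => if i ∈ S then d.mark i else ⊤ : ∀ i, Y i) i ≠ ⊤} = S := by
    ext i
    by_cases hi : i ∈ S <;> simp [hi, d.mark_ne_top]
  refine ⟨d.iso.symm ⟨fun i => if i ∈ S then d.mark i else ⊤, by rwa [this]⟩, ?_⟩
  simpa [supp] using this

/-- The family of components of a closure. -/
def family (c : EquivClosure σ) : ClosureFamily 𝒮 fun i => EquivClosure (ρ i) where
  toFun := d.comp c
  eq_top S i h := d.comp_eq_top c h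
  anti S T hS hT h i := d.comp_anti c hS hT h i
  supp_mem S hS := by
    obtain ⟨x, rfl⟩ := d.exists_supp_eq hS
    rw [← d.supp_closure]
    exact d.supp_mem _
  supp_apply S hS := by
    obtain ⟨x, rfl⟩ := d.exists_supp_eq hS
    exact d.comp_supp c x

theorem supp_family (F : ClosureFamily 𝒮 fun i => EquivClosure (ρ i)) (x : X) :
    {i | F.toFun (d.supp x) i ((d.iso x).1 i) ≠ ⊤} = {i | F.toFun (d.supp x) i ≠ ⊤} := by
  ext i
  constructor
  · intro h H
    simp [H] at h
  · intro h
    refine EquivClosure.apply_ne_top (d.transitive i) h ?_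
    intro hi
    exact h (F.eq_top _ _ (Or.inl fun h' => h' hi))

/-- The closure with a prescribed family of components, as a function. -/
def glueFun (F : ClosureFamily 𝒮 fun i => EquivClosure (ρ i)) (x : X) : X :=
  d.iso.symm ⟨fun i => F.toFun (d.supp x) i ((d.iso x).1 i), by
    rw [d.supp_family]
    exact F.supp_mem _ (d.supp_mem x)⟩

theorem iso_glueFun (F : ClosureFamily 𝒮 fun i => EquivClosure (ρ i)) (x : X) (i : ι) :
    (d.iso (d.glueFun F x)).1 i = F.toFun (d.supp x) i ((d.iso x).1 i) := by
  simp [glueFun]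

theorem supp_glueFun (F : ClosureFamily 𝒮 fun i => EquivClosure (ρ i)) (x : X) :
    d.supp (d.glueFun F x) = {i | F.toFun (d.supp x) i ≠ ⊤} := by
  rw [← d.supp_family]
  unfold supp
  simp only [iso_glueFun]
  rfl

/-- The closure with a prescribed family of components. -/
def glue (F : ClosureFamily 𝒮 fun i => EquivClosure (ρ i)) : EquivClosure σ where
  toFun := d.glueFun F
  le_closure' x := by
    rw [d.le_iff]
    intro i
    rw [d.iso_glueFun]
    exact EquivClosure.le_closure _ _
  mono' x y h := by
    rw [d.le_iff]
    intro i
    rw [d.iso_glueFun, d.iso_glueFun]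
    exact (EquivClosure.mono _ (d.le_iff.1 h i)).trans
      (F.anti _ _ (d.supp_mem x) (d.supp_mem y) (d.supp_anti h) i _)
  idem' x := by
    apply d.iso.injective
    ext i
    rw [d.iso_glueFun, d.supp_glueFun, F.supp_apply _ (d.supp_mem x), d.iso_glueFun,
      EquivClosure.idem]
  comm' g x := by
    apply d.iso.injective
    ext i
    rw [d.iso_glueFun, d.supp_smul, d.map_smul, d.map_smul, d.iso_glueFun, EquivClosure.comm]

theorem iso_glue (F : ClosureFamily 𝒮 fun i => EquivClosure (ρ i)) (x : X) (i : ι) :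
    (d.iso (d.glue F x)).1 i = F.toFun (d.supp x) i ((d.iso x).1 i) := d.iso_glueFun F x i

/-- Equivariant closures on a product correspond to families of closures of the factors. -/
def familyIso : EquivClosure σ ≃o ClosureFamily 𝒮 fun i => EquivClosure (ρ i) where
  toFun := d.family
  invFun := d.glue
  left_inv c := by
    ext x
    apply d.iso.injective
    ext i
    rw [d.iso_glue, d.comp_apply]
    rfl
  right_inv F := by
    apply ClosureFamily.ext
    funext S i
    change d.comp (d.glue F) S i = F.toFun S i
    by_cases hS : S ∈ 𝒮 ∧ i ∈ S
    · ext y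
      by_cases hy : y = ⊤
      · simp [hy]
      · rw [d.comp_apply_elt _ hS.1 hS.2 y hy, d.iso_glue, d.supp_elt, d.iso_elt, d.tuple_self]
    · rw [d.comp_eq_top _ (by tauto), F.eq_top _ _ (by tauto)]
  map_rel_iff' {c c'} := by
    constructor
    · intro H x
      rw [d.le_iff]
      intro i
      rw [d.comp_apply, d.comp_apply]
      exact H (d.supp x) i _
    · intro H S i
      exact d.comp_mono H S i

theorem apply_eq_iff (c : EquivClosure σ) {t : X} (ht : (d.iso t).1 = d.mark) :
    c t = t ↔ ∀ i, (d.familyIso c).toFun Set.univ i (d.mark i) = d.mark i := by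
  have hs : d.supp t = Set.univ := by
    ext i
    simp [d.mem_supp, ht, d.mark_ne_top]
  have key : ∀ i, (d.iso (c t)).1 i = (d.familyIso c).toFun Set.univ i (d.mark i) := by
    intro i
    rw [d.comp_apply, hs, ht]
    rfl
  constructor
  · intro h i
    rw [← key, h, ht]
  · intro h
    apply d.iso.injective
    ext i
    rw [key, h, ht]

/-- Isomorphisms of the closures of the factors induce one for the product. -/
theorem exists_congr {G' X' : Type*} {Y' : ι → Type*}
    [PartialOrder X'] [∀ i, PartialOrder (Y' i)] [∀ i, OrderTop (Y' i)]
    {σ' : G' → X' ≃o X'} {ρ' : ∀ i, G' → Y' i ≃o Y' i} (d' : ProductData 𝒮 σ' ρ')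
    {t : X} {t' : X'} (ht : (d.iso t).1 = d.mark) (ht' : (d'.iso t').1 = d'.mark)
    (h : ∀ i, ∃ φ : EquivClosure (ρ i) ≃o EquivClosure (ρ' i),
      ∀ c, c (d.mark i) = d.mark i ↔ φ c (d'.mark i) = d'.mark i) :
    ∃ φ : EquivClosure σ ≃o EquivClosure σ', ∀ c, c t = t ↔ φ c t' = t' := by
  choose φ hφ using h
  refine ⟨d.familyIso.trans ((ClosureFamily.congr φ).trans d'.familyIso.symm), fun c => ?_⟩
  rw [d.apply_eq_iff c ht, d'.apply_eq_iff _ ht']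
  simp [hφ]

/-- If only full supports occur, closures fixing the marked element are tuples of closures
fixing the marked elements. -/
def markedIso (d : ProductData {(Set.univ : Set ι)} σ ρ) {t : X} (ht : (d.iso t).1 = d.mark) :
    {c : EquivClosure σ // c t = t} ≃o
      ∀ i, {c : EquivClosure (ρ i) // c (d.mark i) = d.mark i} where
  toFun c i := ⟨_, (d.apply_eq_iff c.1 ht).1 c.2 i⟩
  invFun f := ⟨d.familyIso.symm (ClosureFamily.ofTuple (fun i => (f i).1) fun i h =>
      d.mark_ne_top i (by rw [← (f i).2, h]; rfl)), by
    rw [d.apply_eq_iff _ ht]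
    intro i
    simpa [ClosureFamily.ofTuple] using (f i).2⟩
  left_inv c := by
    apply Subtype.ext
    rw [OrderIso.symm_apply_eq]
    apply ClosureFamily.ext
    funext S i
    by_cases hS : S = Set.univ
    · subst hS
      simp [ClosureFamily.ofTuple]
    · rw [ClosureFamily.eq_top _ _ _ (Or.inr (show S ∉ {Set.univ} from hS)),
        ClosureFamily.eq_top _ _ _ (Or.inr (show S ∉ {Set.univ} from hS))]
  right_inv f := by
    funext i
    apply Subtype.ext
    simp [ClosureFamily.ofTuple]
  map_rel_iff' {c c'} := by
    constructor
    · intro H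
      change c.1 ≤ c'.1
      rw [← d.familyIso.le_iff_le]
      intro S i
      by_cases hS : S = Set.univ
      · subst hS
        exact H i
      · rw [ClosureFamily.eq_top _ _ _ (Or.inr (show S ∉ {Set.univ} from hS)),
        ClosureFamily.eq_top _ _ _ (Or.inr (show S ∉ {Set.univ} from hS))]
    · intro H i
      exact (d.familyIso.le_iff_le.2 H) Set.univ i

end ProductData

end Paper

namespace Paper

section Basics

variable {D : Type*} [CommRing D] [IsDomain D]
variable (K : Type*) [Field K] [Algebra D K] [IsFractionRing D K]

/-- The localization at `P` as a submodule of `K`. -/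
def locSub (P : PrimeSpectrum D) : Submodule D K where
  carrier := {x | ∃ a s : D, s ∉ P.asIdeal ∧ algebraMap D K s * x = algebraMap D K a}
  zero_mem' := ⟨0, 1, P.2.one_notMem, by simp⟩
  add_mem' := by
    rintro x y ⟨a, s, hs, hx⟩ ⟨b, t, ht, hy⟩
    refine ⟨t * a + s * b, s * t, fun h => (P.2.mem_or_mem h).elim hs ht, ?_⟩
    simp only [map_add, map_mul, ← hx, ← hy]
    ring
  smul_mem' := by
    rintro c x ⟨a, s, hs, hx⟩
    refine ⟨c * a, s, hs, ?_⟩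
    rw [Algebra.smul_def, map_mul, ← hx]
    ring

/-- The maximal ideal of the localization at `P` as a submodule of `K`. -/
def maxSub (P : PrimeSpectrum D) : Submodule D K where
  carrier := {x | ∃ a ∈ P.asIdeal, ∃ s ∉ P.asIdeal, algebraMap D K s * x = algebraMap D K a}
  zero_mem' := ⟨0, zero_mem _, 1, P.2.one_notMem, by simp⟩
  add_mem' := by
    rintro x y ⟨a, ha, s, hs, hx⟩ ⟨b, hb, t, ht, hy⟩
    refine ⟨t * a + s * b, add_mem (Ideal.mul_mem_left _ _ ha) (Ideal.mul_mem_left _ _ hb),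
      s * t, fun h => (P.2.mem_or_mem h).elim hs ht, ?_⟩
    simp only [map_add, map_mul, ← hx, ← hy]
    ring
  smul_mem' := by
    rintro c x ⟨a, ha, s, hs, hx⟩
    refine ⟨c * a, Ideal.mul_mem_left _ _ ha, s, hs, ?_⟩
    rw [Algebra.smul_def, map_mul, ← hx]
    ring

variable {K}

theorem maxSub_le_locSub (P : PrimeSpectrum D) : maxSub K P ≤ locSub K P := by
  rintro x ⟨a, -, s, hs, hx⟩
  exact ⟨a, s, hs, hx⟩

theorem algebraMap_mem_locSub (P : PrimeSpectrum D) (a : D) : algebraMap D K a ∈ locSub K P :=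
  ⟨a, 1, P.2.one_notMem, by simp⟩

theorem one_mem_locSub (P : PrimeSpectrum D) : (1 : K) ∈ locSub K P := by
  simpa using algebraMap_mem_locSub (K := K) P 1

theorem algebraMap_mem_maxSub {P : PrimeSpectrum D} {a : D} :
    algebraMap D K a ∈ maxSub K P ↔ a ∈ P.asIdeal := by
  constructor
  · rintro ⟨b, hb, s, hs, h⟩
    rw [← map_mul] at h
    rw [← IsFractionRing.injective D K h] at hb
    exact (P.2.mem_or_mem hb).resolve_left hs
  · intro h
    exact ⟨a, h, 1, P.2.one_notMem, by simp⟩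

theorem one_notMem_maxSub (P : PrimeSpectrum D) : (1 : K) ∉ maxSub K P := by
  rw [← map_one (algebraMap D K), algebraMap_mem_maxSub]
  exact P.2.one_notMem

theorem mul_mem_locSub {P : PrimeSpectrum D} {x y : K} (hx : x ∈ locSub K P)
    (hy : y ∈ locSub K P) : x * y ∈ locSub K P := by
  obtain ⟨a, s, hs, hx⟩ := hx
  obtain ⟨b, t, ht, hy⟩ := hy
  refine ⟨a * b, s * t, fun h => (P.2.mem_or_mem h).elim hs ht, ?_⟩
  simp only [map_mul, ← hx, ← hy]
  ring

theorem mul_mem_maxSub {P : PrimeSpectrum D} {x y : K} (hx : x ∈ locSub K P)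
    (hy : y ∈ maxSub K P) : x * y ∈ maxSub K P := by
  obtain ⟨a, s, hs, hx⟩ := hx
  obtain ⟨b, hb, t, ht, hy⟩ := hy
  refine ⟨a * b, Ideal.mul_mem_left _ _ hb, s * t, fun h => (P.2.mem_or_mem h).elim hs ht, ?_⟩
  simp only [map_mul, ← hx, ← hy]
  ring

theorem inv_mem_locSub {P : PrimeSpectrum D} {x : K} (hx : x ∈ locSub K P)
    (hx' : x ∉ maxSub K P) : x⁻¹ ∈ locSub K P := by
  obtain ⟨a, s, hs, hx⟩ := hx
  have ha : a ∉ P.asIdeal := fun ha => hx' ⟨a, ha, s, hs, hx⟩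
  have hx0 : x ≠ 0 := by
    rintro rfl
    exact hx' (zero_mem _)
  refine ⟨s, a, ha, ?_⟩
  rw [← hx]
  field_simp

theorem inv_notMem_locSub {P : PrimeSpectrum D} {x : K} (hx : x ∈ maxSub K P) (hx0 : x ≠ 0) :
    x⁻¹ ∉ locSub K P := by
  intro h
  have := mul_mem_maxSub h hx
  rw [inv_mul_cancel₀ hx0] at this
  exact one_notMem_maxSub P this

theorem ne_zero_of_notMem_maxSub {P : PrimeSpectrum D} {x : K} (hx' : x ∉ maxSub K P) : x ≠ 0 := by
  rintro rfl
  exact hx' (zero_mem _)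

theorem inv_notMem_maxSub {P : PrimeSpectrum D} {x : K} (hx : x ∈ locSub K P)
    (hx' : x ∉ maxSub K P) : x⁻¹ ∉ maxSub K P := by
  intro h
  have := mul_mem_maxSub hx h
  rw [mul_inv_cancel₀ (ne_zero_of_notMem_maxSub hx')] at this
  exact one_notMem_maxSub P this

theorem mul_notMem_maxSub {P : PrimeSpectrum D} {x y : K} (hx : x ∈ locSub K P)
    (hx' : x ∉ maxSub K P) (hy : y ∉ maxSub K P) : x * y ∉ maxSub K P := by
  intro h
  have := mul_mem_maxSub (inv_mem_locSub hx hx') h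
  rw [inv_mul_cancel_left₀ (ne_zero_of_notMem_maxSub hx')] at this
  exact hy this

theorem maxSub_lt_locSub (P : PrimeSpectrum D) : maxSub K P < locSub K P :=
  lt_of_le_of_ne (maxSub_le_locSub P) fun h => one_notMem_maxSub (K := K) P (h ▸ one_mem_locSub P)

theorem locSub_anti {P Q : PrimeSpectrum D} (h : Q ≤ P) : locSub K P ≤ locSub K Q := by
  rintro x ⟨a, s, hs, hx⟩
  exact ⟨a, s, fun hs' => hs (h hs'), hx⟩

theorem IsPrufer.mem_or_inv_mem (hp : IsPrufer D K) (P : PrimeSpectrum D) (x : K) :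
    x ∈ locSub K P ∨ x⁻¹ ∈ locSub K P := by
  have aux : ∀ z : locAt D K P.asIdeal P.2, (z : K) ∈ locSub K P := by
    intro z
    obtain ⟨a, s, hs, hz⟩ := z.2
    have hs' : algebraMap D K s ≠ 0 := by
      intro h0
      rw [map_eq_zero_iff _ (IsFractionRing.injective D K)] at h0
      exact hs (h0 ▸ zero_mem _)
    refine ⟨a, s, hs, ?_⟩
    rw [hz, IsFractionRing.mk'_eq_div]
    field_simp
  obtain ⟨a, b, hb, rfl⟩ := IsFractionRing.div_surjective (A := D) x
  have hb0 : algebraMap D K b ≠ 0 := by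
    simpa using nonZeroDivisors.ne_zero hb
  obtain ⟨z, hz | hz⟩ := hp P.asIdeal P.2 (algebraMap D _ b) (algebraMap D _ a)
  · left
    have : algebraMap D K b * z = algebraMap D K a := congrArg Subtype.val hz
    rw [← this, mul_div_cancel_left₀ _ hb0]
    exact aux z
  · right
    have : algebraMap D K a * z = algebraMap D K b := congrArg Subtype.val hz
    rw [inv_div, ← this, mul_div_cancel_left₀]
    · exact aux z
    · intro h0
      rw [h0, zero_mul] at this
      exact hb0 this.symm

theorem IsPrufer.inv_mem_maxSub (hp : IsPrufer D K) {P : PrimeSpectrum D} {x : K}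
    (hx : x ∉ locSub K P) : x⁻¹ ∈ maxSub K P := by
  by_contra h
  have := inv_mem_locSub ((hp.mem_or_inv_mem P x).resolve_left hx) h
  rw [inv_inv] at this
  exact hx this

theorem IsPrufer.maxSub_mono (hp : IsPrufer D K) {P Q : PrimeSpectrum D} (h : Q ≤ P) :
    maxSub K Q ≤ maxSub K P := by
  intro x hx
  by_contra hx'
  have hx0 := ne_zero_of_notMem_maxSub hx'
  apply inv_notMem_locSub hx hx0
  apply locSub_anti h
  by_cases h1 : x ∈ locSub K P
  · exact inv_mem_locSub h1 hx'
  · exact maxSub_le_locSub _ (hp.inv_mem_maxSub h1)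

theorem IsPrufer.le_total (hp : IsPrufer D K) {N₁ N₂ M : PrimeSpectrum D} (h₁ : N₁ ≤ M)
    (h₂ : N₂ ≤ M) : N₁ ≤ N₂ ∨ N₂ ≤ N₁ := by
  have aux : ∀ (N N' : PrimeSpectrum D) (a b : D), N' ≤ M → a ∉ N'.asIdeal → b ∈ N'.asIdeal →
      algebraMap D K a / algebraMap D K b ∈ locSub K M → b = 0 := by
    rintro N N' a b hN ha hb ⟨c, s, hs, h⟩
    by_contra hb0
    have hb0' : algebraMap D K b ≠ 0 := by simpa using hb0
    rw [← mul_div_assoc, div_eq_iff hb0', ← map_mul, ← map_mul] at h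
    have := IsFractionRing.injective D K h
    have h' : s * a ∈ N'.asIdeal := this ▸ Ideal.mul_mem_left _ _ hb
    exact (N'.2.mem_or_mem h').elim (fun h => hs (hN h)) ha
  by_contra H
  rw [not_or] at H
  obtain ⟨a, ha1, ha2⟩ := SetLike.not_le_iff_exists.1 (show ¬ N₁.asIdeal ≤ N₂.asIdeal from H.1)
  obtain ⟨b, hb2, hb1⟩ := SetLike.not_le_iff_exists.1 (show ¬ N₂.asIdeal ≤ N₁.asIdeal from H.2)
  rcases hp.mem_or_inv_mem M (algebraMap D K a / algebraMap D K b) with h | h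
  · have := aux N₁ N₂ a b h₂ ha2 hb2 h
    exact hb1 (this ▸ zero_mem _)
  · rw [inv_div] at h
    have := aux N₂ N₁ b a h₁ hb1 ha1 h
    exact ha2 (this ▸ zero_mem _)

/-- Elements outside all maximal ideals containing `P`. -/
def away (P : PrimeSpectrum D) : Set D :=
  {s | ∀ M : Ideal D, M.IsMaximal → P.asIdeal ≤ M → s ∉ M}

theorem away_mul {P : PrimeSpectrum D} {s t : D} (hs : s ∈ away P) (ht : t ∈ away P) :
    s * t ∈ away P := fun M hM hP h =>
  (hM.isPrime.mem_or_mem h).elim (hs M hM hP) (ht M hM hP)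

theorem one_mem_away (P : PrimeSpectrum D) : (1 : D) ∈ away P :=
  fun _ hM _ => hM.isPrime.one_notMem

theorem away_mono {P Q : PrimeSpectrum D} (h : Q ≤ P) : away Q ⊆ away P :=
  fun _ hs M hM hP => hs M hM (le_trans h hP)

theorem notMem_of_mem_away {P : PrimeSpectrum D} {s : D} (hs : s ∈ away P) : s ∉ P.asIdeal := by
  obtain ⟨M, hM, hP⟩ := Ideal.exists_le_maximal _ P.2.ne_top
  exact fun h => hs M hM hP (hP h)

theorem IsSemilocal.exists_mem_away (hsl : IsSemilocal D) {P : PrimeSpectrum D} {J : Ideal D}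
    (h : ∀ M : Ideal D, M.IsMaximal → P.asIdeal ≤ M → ¬ J ≤ M) : ∃ s ∈ J, s ∈ away P := by
  by_contra! H
  have hfin : {M : Ideal D | M.IsMaximal ∧ P.asIdeal ≤ M}.Finite :=
    hsl.subset fun M hM => hM.1
  have hsub : (J : Set D) ⊆ ⋃ M ∈ (↑hfin.toFinset : Set (Ideal D)), (M : Set D) := by
    intro s hs
    have : ¬ ∀ M : Ideal D, M.IsMaximal → P.asIdeal ≤ M → s ∉ M := H s hs
    push Not at this
    obtain ⟨M, hM, hP, hsM⟩ := this
    simp only [Set.mem_iUnion]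
    exact ⟨M, by simpa using ⟨hM, hP⟩, hsM⟩
  rw [Ideal.subset_union_prime ⊤ ⊤] at hsub
  · obtain ⟨M, hM, hJ⟩ := hsub
    have hM' : M.IsMaximal ∧ P.asIdeal ≤ M := by simpa using hM
    exact h M hM'.1 hM'.2 hJ
  · intro M hM _ _
    have hM' : M.IsMaximal ∧ P.asIdeal ≤ M := by simpa using hM
    exact hM'.1.isPrime

/-- The ideal of elements multiplying `x` into `I`. -/
def colonIdeal (I : Submodule D K) (x : K) : Ideal D := I.comap (LinearMap.toSpanSingleton D K x)

theorem mem_colonIdeal {I : Submodule D K} {x : K} {a : D} :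
    a ∈ colonIdeal I x ↔ algebraMap D K a * x ∈ I := by
  simp [colonIdeal, Algebra.smul_def]

theorem mul_mem_of_mem {I : Submodule D K} {x : K} (a : D) (hx : x ∈ I) :
    algebraMap D K a * x ∈ I := by
  rw [← Algebra.smul_def]
  exact I.smul_mem a hx

/-- Elements of `maxSub K P` lie in the semilocalization at `P`. -/
theorem IsPrufer.exists_away_of_mem_maxSub (hp : IsPrufer D K) (hsl : IsSemilocal D)
    {P : PrimeSpectrum D} {x : K} (hx : x ∈ maxSub K P) :
    ∃ s ∈ away P, ∃ a : D, algebraMap D K s * x = algebraMap D K a := by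
  obtain ⟨s, hs, hs'⟩ := hsl.exists_mem_away (P := P) (J := colonIdeal (1 : Submodule D K) x) (by
    intro M hM hP hJ
    obtain ⟨a, s, hs, h⟩ := maxSub_le_locSub _ (hp.maxSub_mono (Q := P) (P := ⟨M, hM.isPrime⟩) hP hx)
    refine hs (hJ (mem_colonIdeal.2 ?_))
    rw [h]
    exact Submodule.mem_one.2 ⟨a, rfl⟩)
  obtain ⟨a, ha⟩ := Submodule.mem_one.1 (mem_colonIdeal.1 hs)
  exact ⟨s, hs', a, ha.symm⟩

theorem IsPrufer.maxSub_mul_mem (hp : IsPrufer D K) (hsl : IsSemilocal D)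
    {P : PrimeSpectrum D} {I : Submodule D K}
    (hI : ∀ s ∈ away P, ∀ x, algebraMap D K s * x ∈ I → x ∈ I) {x y : K} (hx : x ∈ maxSub K P)
    (hy : y ∈ I) : x * y ∈ I := by
  obtain ⟨s, hs, a, ha⟩ := hp.exists_away_of_mem_maxSub hsl hx
  apply hI s hs
  rw [← mul_assoc, ha]
  exact mul_mem_of_mem a hy

theorem locSub_mul_mem {P : PrimeSpectrum D} {I : Submodule D K}
    (hI : ∀ s ∉ P.asIdeal, ∀ x, algebraMap D K s * x ∈ I → x ∈ I) {x y : K} (hx : x ∈ locSub K P)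
    (hy : y ∈ I) : x * y ∈ I := by
  obtain ⟨a, s, hs, ha⟩ := hx
  apply hI s hs
  rw [← mul_assoc, ha]
  exact mul_mem_of_mem a hy

theorem locSub_saturated {P : PrimeSpectrum D} {s : D} (hs : s ∉ P.asIdeal) {x : K}
    (h : algebraMap D K s * x ∈ locSub K P) : x ∈ locSub K P := by
  obtain ⟨a, t, ht, h⟩ := h
  refine ⟨a, t * s, fun h => (P.2.mem_or_mem h).elim ht hs, ?_⟩
  rw [map_mul, mul_assoc, h]

theorem maxSub_saturated {P : PrimeSpectrum D} {s : D} (hs : s ∉ P.asIdeal) {x : K}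
    (h : algebraMap D K s * x ∈ maxSub K P) : x ∈ maxSub K P := by
  obtain ⟨a, ha, t, ht, h⟩ := h
  refine ⟨a, ha, t * s, fun h => (P.2.mem_or_mem h).elim ht hs, ?_⟩
  rw [map_mul, mul_assoc, h]

theorem algebraMap_ne_zero_of_notMem {P : PrimeSpectrum D} {s : D} (hs : s ∉ P.asIdeal) :
    algebraMap D K s ≠ 0 := by
  intro h
  rw [map_eq_zero_iff _ (IsFractionRing.injective D K)] at h
  exact hs (h ▸ zero_mem _)

end Basics

end Paper

namespace Paper

section Modules

variable {D : Type*} [CommRing D] [IsDomain D]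
variable {K : Type*} [Field K] [Algebra D K] [IsFractionRing D K]

/-- The submodule `xI` (for `x ≠ 0`). -/
def scale (x : K) (I : Submodule D K) : Submodule D K := I.comap (LinearMap.mulLeft D x⁻¹)

theorem mem_scale {x y : K} {I : Submodule D K} : y ∈ scale x I ↔ x⁻¹ * y ∈ I := Iff.rfl

theorem mul_mem_scale {x y : K} (hx : x ≠ 0) {I : Submodule D K} : x * y ∈ scale x I ↔ y ∈ I := by
  rw [mem_scale, inv_mul_cancel_left₀ hx]

theorem scale_mono {x : K} {I J : Submodule D K} (h : I ≤ J) : scale x I ≤ scale x J :=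
  Submodule.comap_mono h

theorem scale_scale (x y : K) (I : Submodule D K) : scale x (scale y I) = scale (x * y) I := by
  ext z
  simp only [mem_scale, mul_inv, mul_assoc]
  rw [mul_left_comm]

theorem scale_one (I : Submodule D K) : scale 1 I = I := by
  ext z
  simp [mem_scale]

theorem scale_inf (x : K) (I J : Submodule D K) : scale x (I ⊓ J) = scale x I ⊓ scale x J := rfl

theorem scale_locSub {P : PrimeSpectrum D} {x : K} (hx : x ∈ locSub K P) (hx' : x ∉ maxSub K P) :
    scale x (locSub K P) = locSub K P := by
  ext y
  rw [mem_scale]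
  refine ⟨fun h => ?_, fun h => mul_mem_locSub (inv_mem_locSub hx hx') h⟩
  simpa [ne_zero_of_notMem_maxSub hx'] using mul_mem_locSub hx h

theorem scale_maxSub {P : PrimeSpectrum D} {x : K} (hx : x ∈ locSub K P) (hx' : x ∉ maxSub K P) :
    scale x (maxSub K P) = maxSub K P := by
  ext y
  rw [mem_scale]
  refine ⟨fun h => ?_, fun h => mul_mem_maxSub (inv_mem_locSub hx hx') h⟩
  simpa [ne_zero_of_notMem_maxSub hx'] using mul_mem_maxSub hx h

/-- The `D`-modules strictly above `QD_Q` and inside `D_Q` that are saturated with respect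
to `S`. -/
structure IsMod (Q : PrimeSpectrum D) (S : Set D) (I : Submodule D K) : Prop where
  lt : maxSub K Q < I
  le : I ≤ locSub K Q
  sat : ∀ s ∈ S, s ∉ Q.asIdeal → ∀ x, algebraMap D K s * x ∈ I → x ∈ I

theorem IsMod.scale_unit {Q : PrimeSpectrum D} {S : Set D} {I : Submodule D K} (h : IsMod Q S I)
    {x : K} (hx : x ∈ locSub K Q) (hx' : x ∉ maxSub K Q) : IsMod Q S (scale x I) where
  lt := by
    refine lt_of_le_of_ne ?_ ?_
    · rw [← scale_maxSub hx hx']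
      exact scale_mono h.lt.le
    · intro H
      obtain ⟨y, hy, hy'⟩ := SetLike.exists_of_lt h.lt
      rw [← mul_mem_scale (ne_zero_of_notMem_maxSub hx'), ← H] at hy
      rw [← mul_mem_scale (ne_zero_of_notMem_maxSub hx'), scale_maxSub hx hx'] at hy'
      exact hy' hy
  le := by
    rw [← scale_locSub hx hx']
    exact scale_mono h.le
  sat s hs hs' y hy := by
    rw [mem_scale, mul_left_comm] at hy
    exact h.sat s hs hs' _ hy

theorem isMod_locSub (Q : PrimeSpectrum D) (S : Set D) : IsMod Q S (locSub K Q) :=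
  ⟨maxSub_lt_locSub Q, le_rfl, fun _ _ hs _ => locSub_saturated hs⟩

variable (K) in
/-- The poset of modules satisfying `IsMod`. -/
abbrev Mod (Q : PrimeSpectrum D) (S : Set D) : Type _ := {I : Submodule D K // IsMod Q S I}

instance (Q : PrimeSpectrum D) (S : Set D) : OrderTop (Mod K Q S) where
  top := ⟨locSub K Q, isMod_locSub Q S⟩
  le_top I := I.2.le

variable (K) in
/-- The elements of `D_Q` outside its maximal ideal. -/
abbrev LocUnit (Q : PrimeSpectrum D) : Type _ := {x : K // x ∈ locSub K Q ∧ x ∉ maxSub K Q}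

namespace LocUnit

variable {Q : PrimeSpectrum D}

theorem ne_zero (g : LocUnit K Q) : g.1 ≠ 0 := ne_zero_of_notMem_maxSub g.2.2

/-- The inverse of a unit. -/
protected def inv (g : LocUnit K Q) : LocUnit K Q :=
  ⟨g.1⁻¹, inv_mem_locSub g.2.1 g.2.2, inv_notMem_maxSub g.2.1 g.2.2⟩

/-- The product of two units. -/
protected def mul (g h : LocUnit K Q) : LocUnit K Q :=
  ⟨g.1 * h.1, mul_mem_locSub g.2.1 h.2.1, mul_notMem_maxSub g.2.1 g.2.2 h.2.2⟩

/-- An element of `D` outside `Q`. -/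
def of {s : D} (hs : s ∉ Q.asIdeal) : LocUnit K Q :=
  ⟨algebraMap D K s, algebraMap_mem_locSub Q s, fun h => hs (algebraMap_mem_maxSub.1 h)⟩

end LocUnit

variable (K) in
/-- The action of the units of `D_Q` on modules. -/
def act (Q : PrimeSpectrum D) (S : Set D) (g : LocUnit K Q) : Mod K Q S ≃o Mod K Q S where
  toFun I := ⟨scale g.1 I.1, I.2.scale_unit g.2.1 g.2.2⟩
  invFun I := ⟨scale g.1⁻¹ I.1, I.2.scale_unit g.inv.2.1 g.inv.2.2⟩
  left_inv I := Subtype.ext (by simp [scale_scale, g.ne_zero, scale_one])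
  right_inv I := Subtype.ext (by simp [scale_scale, g.ne_zero, scale_one])
  map_rel_iff' {I J} := by
    refine ⟨fun h => ?_, fun h => scale_mono h⟩
    have h' : scale g.1⁻¹ (scale g.1 I.1) ≤ scale g.1⁻¹ (scale g.1 J.1) := scale_mono h
    rw [scale_scale, scale_scale, inv_mul_cancel₀ g.ne_zero, scale_one, scale_one] at h'
    exact h'

@[simp] theorem coe_act (Q : PrimeSpectrum D) (S : Set D) (g : LocUnit K Q) (I : Mod K Q S) :
    (act K Q S g I : Submodule D K) = scale g.1 I.1 := rfl

/-- The intersection of `D_Q` with the members of a family above `I`. -/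
def mooreSub {Q : PrimeSpectrum D} {S : Set D} (𝓕 : Set (Mod K Q S)) (I : Mod K Q S) :
    Submodule D K := locSub K Q ⊓ ⨅ F ∈ {F | F ∈ 𝓕 ∧ I ≤ F}, F.1

theorem mem_mooreSub {Q : PrimeSpectrum D} {S : Set D} {𝓕 : Set (Mod K Q S)} {I : Mod K Q S}
    {x : K} : x ∈ mooreSub 𝓕 I ↔ x ∈ locSub K Q ∧ ∀ F ∈ 𝓕, I ≤ F → x ∈ F.1 := by
  simp [mooreSub]

theorem le_mooreSub {Q : PrimeSpectrum D} {S : Set D} (𝓕 : Set (Mod K Q S)) (I : Mod K Q S) :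
    I.1 ≤ mooreSub 𝓕 I := fun _ hx => mem_mooreSub.2 ⟨I.2.le hx, fun _ _ h => h hx⟩

theorem isMod_mooreSub {Q : PrimeSpectrum D} {S : Set D} (𝓕 : Set (Mod K Q S)) (I : Mod K Q S) :
    IsMod Q S (mooreSub 𝓕 I) where
  lt := lt_of_lt_of_le I.2.lt (le_mooreSub 𝓕 I)
  le := inf_le_left
  sat s hs hs' x hx := by
    rw [mem_mooreSub] at hx ⊢
    exact ⟨locSub_saturated hs' hx.1, fun F hF h => F.2.sat s hs hs' x (hx.2 F hF h)⟩

/-- The equivariant closure whose closed elements are generated by a stable family. -/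
def moore {Q : PrimeSpectrum D} {S : Set D} (𝓕 : Set (Mod K Q S))
    (h𝓕 : ∀ g, ∀ F ∈ 𝓕, act K Q S g F ∈ 𝓕) : EquivClosure (act K Q S) where
  toFun I := ⟨mooreSub 𝓕 I, isMod_mooreSub 𝓕 I⟩
  le_closure' I := le_mooreSub 𝓕 I
  mono' I J h x hx := by
    rw [mem_mooreSub] at hx ⊢
    exact ⟨hx.1, fun F hF hJ => hx.2 F hF (h.trans hJ)⟩
  idem' I := by
    refine le_antisymm (fun x hx => ?_) (le_mooreSub 𝓕 ⟨mooreSub 𝓕 I, isMod_mooreSub 𝓕 I⟩)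
    rw [mem_mooreSub] at hx ⊢
    exact ⟨hx.1, fun F hF hJ => hx.2 F hF fun y hy => (mem_mooreSub.1 hy).2 F hF hJ⟩
  comm' g I := by
    ext y
    rw [coe_act, mem_scale, mem_mooreSub, mem_mooreSub]
    refine and_congr ?_ ⟨fun H F hF hI => ?_, fun H F hF hI => ?_⟩
    · rw [← mem_scale, scale_locSub g.2.1 g.2.2]
    · exact H (act K Q S g F) (h𝓕 g F hF) ((act K Q S g).monotone hI)
    · have h1 := H (act K Q S g.inv F) (h𝓕 _ F hF) (by
        have h2 : act K Q S g.inv (act K Q S g I) ≤ act K Q S g.inv F :=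
          (act K Q S g.inv).monotone hI
        refine le_trans (le_of_eq (Subtype.ext ?_)) h2
        simp [LocUnit.inv, scale_scale, g.ne_zero, scale_one])
      rw [coe_act, mem_scale] at h1
      simpa [LocUnit.inv, g.ne_zero] using h1

theorem mem_moore {Q : PrimeSpectrum D} {S : Set D} {𝓕 : Set (Mod K Q S)}
    {h𝓕 : ∀ g, ∀ F ∈ 𝓕, act K Q S g F ∈ 𝓕} {I : Mod K Q S} {x : K} :
    x ∈ (moore 𝓕 h𝓕 I).1 ↔ x ∈ locSub K Q ∧ ∀ F ∈ 𝓕, I ≤ F → x ∈ F.1 := mem_mooreSub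

theorem moore_le {Q : PrimeSpectrum D} {S : Set D} {𝓕 : Set (Mod K Q S)}
    {h𝓕 : ∀ g, ∀ F ∈ 𝓕, act K Q S g F ∈ 𝓕} {I F : Mod K Q S} (hF : F ∈ 𝓕) (h : I ≤ F) :
    moore 𝓕 h𝓕 I ≤ F := fun _ hx => (mem_moore.1 hx).2 F hF h

theorem le_moore {Q : PrimeSpectrum D} {S : Set D} {𝓕 : Set (Mod K Q S)}
    {h𝓕 : ∀ g, ∀ F ∈ 𝓕, act K Q S g F ∈ 𝓕} {I J : Mod K Q S} (h : ∀ F ∈ 𝓕, I ≤ F → J ≤ F) :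
    J ≤ moore 𝓕 h𝓕 I := fun _ hx => mem_moore.2 ⟨J.2.le hx, fun F hF hI => h F hF hI hx⟩

end Modules

end Paper

namespace Paper

section Gluing

variable {D : Type*} [CommRing D] [IsDomain D]
variable {K : Type*} [Field K] [Algebra D K] [IsFractionRing D K]

theorem scale_eq_self {s : D} {I : Submodule D K} (hs0 : algebraMap D K s ≠ 0)
    (hI : ∀ x, algebraMap D K s * x ∈ I → x ∈ I) : scale (algebraMap D K s) I = I := by
  ext x
  rw [mem_scale]
  constructor
  · intro h
    have := mul_mem_of_mem s h
    rwa [mul_inv_cancel_left₀ hs0] at this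
  · intro h
    apply hI
    rwa [mul_inv_cancel_left₀ hs0]

theorem saturated_of_scale_eq_self {s : D} {I : Submodule D K} (hs0 : algebraMap D K s ≠ 0)
    (hI : scale (algebraMap D K s) I = I) {x : K} (hx : algebraMap D K s * x ∈ I) : x ∈ I := by
  rwa [← hI, mul_mem_scale hs0] at hx

theorem IsMod.exists_mem {Q : PrimeSpectrum D} {S : Set D} {I : Submodule D K} (h : IsMod Q S I) :
    ∃ y ∈ I, y ∈ locSub K Q ∧ y ∉ maxSub K Q := by
  obtain ⟨y, hy, hy'⟩ := SetLike.exists_of_lt h.lt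
  exact ⟨y, hy, h.le hy, hy'⟩

section

variable (hp : IsPrufer D K) (hsl : IsSemilocal D)
include hp hsl

/-- Modules between `PD_P` and `D_P` are saturated with respect to `away P`. -/
theorem IsMod.sat_away {P : PrimeSpectrum D} {S : Set D} {I : Submodule D K} (h : IsMod P S I) :
    ∀ s ∈ away P, ∀ x, algebraMap D K s * x ∈ I → x ∈ I := by
  intro s hs x hx
  have htop : colonIdeal I x = ⊤ := by
    by_contra hne
    obtain ⟨M, hM, hJM⟩ := Ideal.exists_le_maximal _ hne
    have hPM : P.asIdeal ≤ M := by
      intro a ha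
      apply hJM
      rw [mem_colonIdeal, mul_comm]
      apply h.lt.le
      exact mul_mem_maxSub (locSub_saturated (notMem_of_mem_away hs) (h.le hx))
        (algebraMap_mem_maxSub.2 ha)
    exact hs M hM hPM (hJM (mem_colonIdeal.2 hx))
  have h1 : (1 : D) ∈ colonIdeal I x := htop ▸ Submodule.mem_top
  simpa [mem_colonIdeal] using h1

variable {P Q : PrimeSpectrum D} (hQP : Q < P)
include hQP

theorem IsMod.of_lt {S : Set D} {I : Submodule D K} (h : IsMod P S I) : IsMod Q (away P) I where
  lt := lt_of_le_of_lt (hp.maxSub_mono hQP.le) h.lt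
  le := h.le.trans (locSub_anti hQP.le)
  sat s hs _ := h.sat_away hp hsl s hs

omit hsl in
theorem isMod_locSub_of_lt (S : Set D) (hS : S ⊆ (P.asIdeal : Set D)ᶜ) :
    IsMod Q S (locSub K P) where
  lt := lt_of_le_of_lt (hp.maxSub_mono hQP.le) (maxSub_lt_locSub P)
  le := locSub_anti hQP.le
  sat _ hs _ _ hx := locSub_saturated (hS hs) hx

omit hp hsl hQP in
theorem away_subset_compl : away P ⊆ (P.asIdeal : Set D)ᶜ := fun _ hs => notMem_of_mem_away hs

omit hp hsl hQP in
theorem IsMod.mono_set {S T : Set D} (h : S ⊆ T) {I : Submodule D K} (hI : IsMod Q T I) :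
    IsMod Q S I := ⟨hI.lt, hI.le, fun s hs => hI.sat s (h hs)⟩

theorem IsMod.sat_away_of_lt {I : Submodule D K} (h : IsMod Q (away P) I) :
    ∀ s ∈ away P, ∀ x, algebraMap D K s * x ∈ I → x ∈ I := fun s hs =>
  h.sat s hs fun h' => notMem_of_mem_away hs (hQP.le h')

theorem IsMod.comparable {I : Submodule D K} (h : IsMod Q (away P) I) :
    locSub K P ≤ I ∨ I ≤ locSub K P := by
  by_contra! H
  obtain ⟨y, hy, hy'⟩ := SetLike.not_le_iff_exists.1 H.2
  have hinv := hp.inv_mem_maxSub hy'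
  have hy0 : y ≠ 0 := fun h0 => hy' (h0 ▸ zero_mem _)
  apply H.1
  intro z hz
  have := hp.maxSub_mul_mem hsl (h.sat_away_of_lt hp hsl hQP) (mul_mem_maxSub hz hinv) hy
  rwa [mul_assoc, inv_mul_cancel₀ hy0, mul_one] at this

/-- A module that is not a `D_P`-module is a multiple of one between `PD_P` and `D_P`. -/
theorem IsMod.exists_scale {I : Submodule D K} (h : IsMod Q (away P) I)
    (hI : ¬ IsMod Q (P.asIdeal : Set D)ᶜ I) :
    ∃ (g : LocUnit K Q) (E : Submodule D K), IsMod P ∅ E ∧ E < locSub K P ∧ I = scale g.1 E := by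
  have : ∃ s ∉ P.asIdeal, ∃ x, algebraMap D K s * x ∈ I ∧ x ∉ I := by
    by_contra! H
    exact hI ⟨h.lt, h.le, fun s hs _ => H s hs⟩
  obtain ⟨s, hs, x, hx, hxI⟩ := this
  have hs0 : algebraMap D K s ≠ 0 := algebraMap_ne_zero_of_notMem hs
  have hsI := h.sat_away_of_lt hp hsl hQP
  have hxQ : x ∉ maxSub K Q := fun h' => hxI (h.lt.le h')
  have hsQ : s ∉ Q.asIdeal := fun h' => hs (hQP.le h')
  have hxl : x ∈ locSub K Q := locSub_saturated hsQ (h.le hx)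
  have hx0 := ne_zero_of_notMem_maxSub hxQ
  refine ⟨⟨x, hxl, hxQ⟩, scale x⁻¹ I, ?_, ?_, ?_⟩
  · have hle : ∀ y ∈ maxSub K P, y ∈ scale x⁻¹ I := by
      intro y hy
      rw [mem_scale, inv_inv]
      have hys : y * (algebraMap D K s)⁻¹ ∈ maxSub K P := by
        apply maxSub_saturated hs
        rwa [mul_comm, inv_mul_cancel_right₀ hs0]
      have := hp.maxSub_mul_mem hsl hsI hys hx
      convert this using 1
      field_simp
    refine ⟨lt_of_le_of_ne hle ?_, ?_, by simp⟩
    · intro H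
      have : algebraMap D K s ∈ maxSub K P := by
        rw [H, mem_scale, inv_inv, mul_comm]
        exact hx
      exact hs (algebraMap_mem_maxSub.1 this)
    · intro y hy
      rw [mem_scale, inv_inv] at hy
      by_contra hy'
      have hy0 : y ≠ 0 := fun h0 => hy' (h0 ▸ zero_mem _)
      have := hp.maxSub_mul_mem hsl hsI (hp.inv_mem_maxSub hy') hy
      rw [mul_comm, mul_assoc, mul_inv_cancel₀ hy0, mul_one] at this
      exact hxI this
  · refine lt_of_le_of_ne ?_ ?_
    · intro y hy
      rw [mem_scale, inv_inv] at hy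
      by_contra hy'
      have hy0 : y ≠ 0 := fun h0 => hy' (h0 ▸ zero_mem _)
      have := hp.maxSub_mul_mem hsl hsI (hp.inv_mem_maxSub hy') hy
      rw [mul_comm, mul_assoc, mul_inv_cancel₀ hy0, mul_one] at this
      exact hxI this
    · intro H
      have h1 := one_mem_locSub (K := K) P
      rw [← H, mem_scale, inv_inv, mul_one] at h1
      exact hxI h1
  · rw [scale_scale, mul_inv_cancel₀ hx0, scale_one]

/-- Modules between `PD_P` and `D_P`, seen over the smaller prime `Q`. -/
def Mod.ofUpper (E : Mod K P ∅) : Mod K Q (away P) := ⟨E.1, E.2.of_lt hp hsl hQP⟩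

omit hp hsl hQP in
/-- `D_P`-modules seen as modules over the semilocalization at `P`. -/
def Mod.ofLower (J : Mod K Q (P.asIdeal : Set D)ᶜ) : Mod K Q (away P) :=
  ⟨J.1, J.2.mono_set away_subset_compl⟩

omit hsl in
/-- Units of `D_P` are units of `D_Q` for `Q < P`. -/
def LocUnit.ofUpper (g : LocUnit K P) : LocUnit K Q :=
  ⟨g.1, locSub_anti hQP.le g.2.1, fun h => g.2.2 (hp.maxSub_mono hQP.le h)⟩

theorem Mod.cases (I : Mod K Q (away P)) : (∃ J : Mod K Q (P.asIdeal : Set D)ᶜ, I = .ofLower J) ∨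
    ∃ (g : LocUnit K Q) (E : Mod K P ∅), E ≠ ⊤ ∧ I = act K Q _ g (.ofUpper hp hsl hQP E) := by
  by_cases h : IsMod Q (P.asIdeal : Set D)ᶜ I.1
  · exact Or.inl ⟨⟨I.1, h⟩, rfl⟩
  · obtain ⟨g, E, hE, hE', hI⟩ := I.2.exists_scale hp hsl hQP h
    exact Or.inr ⟨g, ⟨E, hE⟩, fun h => hE'.ne (congrArg Subtype.val h), Subtype.ext hI⟩

variable (c : EquivClosure (act K Q (away P)))

theorem isMod_inf_locSub (E : Mod K P ∅) :
    IsMod P ∅ ((c (.ofUpper hp hsl hQP E)).1 ⊓ locSub K P) where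
  lt := lt_of_lt_of_le E.2.lt (le_inf (c.le_closure (.ofUpper hp hsl hQP E)) E.2.le)
  le := inf_le_right
  sat := by simp

/-- The restriction of a closure to the modules between `PD_P` and `D_P`. -/
def upperPart : EquivClosure (act K P ∅) where
  toFun E := ⟨_, isMod_inf_locSub hp hsl hQP c E⟩
  le_closure' E := le_inf (c.le_closure (.ofUpper hp hsl hQP E)) E.2.le
  mono' E F h := by
    have := c.mono (y := .ofUpper hp hsl hQP E) (z := .ofUpper hp hsl hQP F) h
    exact inf_le_inf_right (locSub K P) (Subtype.coe_le_coe.2 this)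
  idem' E := by
    apply Subtype.ext
    refine le_antisymm (le_inf (inf_le_left.trans ?_) inf_le_right)
      (le_inf (c.le_closure (.ofUpper hp hsl hQP ⟨_, isMod_inf_locSub hp hsl hQP c E⟩))
        inf_le_right)
    exact c.closure_le (y := .ofUpper hp hsl hQP ⟨_, isMod_inf_locSub hp hsl hQP c E⟩)
      (z := c (.ofUpper hp hsl hQP E)) (fun _ hx => hx.1) (c.idem _)
  comm' g E := by
    apply Subtype.ext
    change (c (act K Q (away P) (g.ofUpper hp hQP) (.ofUpper hp hsl hQP E))).1 ⊓ _ =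
      scale g.1 (_ ⊓ _)
    rw [c.comm, scale_inf, scale_locSub g.2.1 g.2.2]
    rfl

theorem coe_upperPart (E : Mod K P ∅) :
    (upperPart hp hsl hQP c E).1 = (c (.ofUpper hp hsl hQP E)).1 ⊓ locSub K P := rfl

omit hp hsl in
theorem isMod_apply_ofLower (J : Mod K Q (P.asIdeal : Set D)ᶜ) :
    IsMod Q (P.asIdeal : Set D)ᶜ (c (.ofLower J)).1 where
  lt := (c (.ofLower J)).2.lt
  le := (c (.ofLower J)).2.le
  sat s hs hsQ x hx := by
    have hs0 := algebraMap_ne_zero_of_notMem (K := K) hsQ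
    refine saturated_of_scale_eq_self hs0 ?_ hx
    have h := c.comm (LocUnit.of hsQ) (.ofLower J)
    have h' : act K Q (away P) (LocUnit.of hsQ) (.ofLower J) = .ofLower J :=
      Subtype.ext (scale_eq_self hs0 (J.2.sat s hs hsQ))
    rw [h'] at h
    exact (congrArg Subtype.val h).symm

/-- The restriction of a closure to the `D_P`-modules. -/
def lowerPart : EquivClosure (act K Q (P.asIdeal : Set D)ᶜ) where
  toFun J := ⟨_, isMod_apply_ofLower hQP c J⟩
  le_closure' J := c.le_closure (.ofLower J)
  mono' I J h := c.mono (y := .ofLower I) (z := .ofLower J) h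
  idem' J := by
    have := congrArg Subtype.val (c.idem (.ofLower J))
    exact Subtype.ext this
  comm' g J := by
    have := congrArg Subtype.val (c.comm g (.ofLower J))
    exact Subtype.ext this

theorem upperPart_eq_top_or : upperPart hp hsl hQP c = ⊤ ∨ lowerPart hQP c = ⊥ := by
  rw [or_iff_not_imp_left, EquivClosure.eq_top_iff', EquivClosure.eq_bot_iff']
  intro H J
  push Not at H
  obtain ⟨E, hE⟩ := H
  have hlt : (upperPart hp hsl hQP c E).1 < locSub K P :=
    lt_of_le_of_ne (upperPart hp hsl hQP c E).2.le fun h => hE (Subtype.ext h)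
  rw [coe_upperPart] at hlt
  have hle : (c (.ofUpper hp hsl hQP E)).1 ≤ locSub K P := by
    rcases (c (.ofUpper hp hsl hQP E)).2.comparable hp hsl hQP with h | h
    · exact absurd (le_inf h le_rfl) (not_le_of_gt hlt)
    · exact h
  rw [inf_eq_left.2 hle] at hlt
  obtain ⟨t, ht, ht'⟩ := SetLike.exists_of_lt hlt
  have hc : IsMod P ∅ (c (.ofUpper hp hsl hQP E)).1 := by
    have := isMod_inf_locSub hp hsl hQP c E
    rwa [inf_eq_left.2 hle] at this
  have htm : t ∉ maxSub K P := fun h => ht' (hc.lt.le h)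
  have ht0 := ne_zero_of_notMem_maxSub htm
  refine le_antisymm (fun z hz => ?_) ((lowerPart hQP c).le_closure J)
  by_contra hzJ
  have hJsat : ∀ s ∉ P.asIdeal, ∀ x, algebraMap D K s * x ∈ J.1 → x ∈ J.1 := fun s hs =>
    J.2.sat s hs fun h => hs (hQP.le h)
  have hzQ : z ∈ locSub K Q := (lowerPart hQP c J).2.le hz
  have hzQ' : z ∉ maxSub K Q := fun h => hzJ (J.2.lt.le h)
  let g : LocUnit K Q := LocUnit.mul ⟨z, hzQ, hzQ'⟩
    (LocUnit.inv (LocUnit.ofUpper hp hQP ⟨t, ht, htm⟩))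
  have hg : g.1 = z * t⁻¹ := rfl
  have h1 : Mod.ofLower J ≤ act K Q (away P) g (c (.ofUpper hp hsl hQP E)) := by
    intro j hj
    rw [coe_act, mem_scale, hg]
    apply hc.lt.le
    have hz0 := ne_zero_of_notMem_maxSub hzQ'
    have : z⁻¹ * j ∈ maxSub K P := by
      by_contra h
      apply hzJ
      have h2 : (z⁻¹ * j)⁻¹ ∈ locSub K P := by
        by_cases h3 : z⁻¹ * j ∈ locSub K P
        · exact inv_mem_locSub h3 h
        · exact maxSub_le_locSub _ (hp.inv_mem_maxSub h3)
      have h4 := locSub_mul_mem hJsat h2 hj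
      have hj0 : j ≠ 0 := by
        rintro rfl
        simp at h
      convert h4 using 1
      field_simp
    have := mul_mem_maxSub ht this
    convert this using 1
    field_simp
  have h2 := c.closure_le h1 (by rw [c.comm, c.idem])
  have h3 := h2 hz
  rw [coe_act, mem_scale, hg] at h3
  apply ht'
  convert h3 using 1
  have hz0 := ne_zero_of_notMem_maxSub hzQ'
  field_simp

theorem le_of_upperPart_le_of_lowerPart_le {c c' : EquivClosure (act K Q (away P))}
    (ha : upperPart hp hsl hQP c ≤ upperPart hp hsl hQP c') (hb : lowerPart hQP c ≤ lowerPart hQP c') :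
    c ≤ c' := by
  intro I
  rcases Mod.cases hp hsl hQP I with ⟨J, rfl⟩ | ⟨g, E, -, rfl⟩
  · exact hb J
  · rw [c.comm, c'.comm]
    apply (act K Q (away P) g).monotone
    have haE : (c (.ofUpper hp hsl hQP E)).1 ⊓ locSub K P ≤
      (c' (.ofUpper hp hsl hQP E)).1 ⊓ locSub K P := ha E
    rcases (c (.ofUpper hp hsl hQP E)).2.comparable hp hsl hQP with h | h
    · let L : Mod K Q (P.asIdeal : Set D)ᶜ := ⟨locSub K P, isMod_locSub_of_lt hp hQP _ le_rfl⟩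
      have h1 : c (.ofUpper hp hsl hQP E) ≤ c (.ofLower L) :=
        c.mono (y := .ofUpper hp hsl hQP E) (z := .ofLower L) E.2.le
      have h2 : c (.ofLower L) ≤ c' (.ofLower L) := hb L
      refine h1.trans (h2.trans (c'.closure_le (y := .ofLower L) ?_ (c'.idem _)))
      rw [inf_eq_right.2 h] at haE
      exact haE.trans inf_le_left
    · rw [inf_eq_left.2 h] at haE
      exact haE.trans inf_le_left

/-- The closed modules of the glued closure. -/
def glueFamily (a : EquivClosure (act K P ∅)) (b : EquivClosure (act K Q (P.asIdeal : Set D)ᶜ)) :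
    Set (Mod K Q (away P)) :=
  {I | (∃ (g : LocUnit K Q) (E : Mod K P ∅), a E = E ∧ E ≠ ⊤ ∧
    I = act K Q _ g (.ofUpper hp hsl hQP E)) ∨
    ∃ J, b J = J ∧ I = .ofLower J}

theorem act_mem_glueFamily (a : EquivClosure (act K P ∅))
    (b : EquivClosure (act K Q (P.asIdeal : Set D)ᶜ)) (g : LocUnit K Q) :
    ∀ F ∈ glueFamily hp hsl hQP a b, act K Q _ g F ∈ glueFamily hp hsl hQP a b := by
  rintro _ (⟨g', E, hE, hE', rfl⟩ | ⟨J, hJ, rfl⟩)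
  · exact Or.inl ⟨g.mul g', E, hE, hE', Subtype.ext (scale_scale _ _ _)⟩
  · exact Or.inr ⟨act K Q _ g J, by rw [b.comm, hJ], rfl⟩

/-- Glue a closure on the modules between `PD_P` and `D_P` with a closure on `D_P`-modules. -/
def glue (a : EquivClosure (act K P ∅)) (b : EquivClosure (act K Q (P.asIdeal : Set D)ᶜ)) :
    EquivClosure (act K Q (away P)) :=
  moore (glueFamily hp hsl hQP a b) (act_mem_glueFamily hp hsl hQP a b)

theorem lowerPart_glue {a : EquivClosure (act K P ∅)}
    {b : EquivClosure (act K Q (P.asIdeal : Set D)ᶜ)} (hab : a = ⊤ ∨ b = ⊥) :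
    lowerPart hQP (glue hp hsl hQP a b) = b := by
  refine EquivClosure.ext fun J => le_antisymm ?_ ?_
  · exact moore_le (h𝓕 := act_mem_glueFamily hp hsl hQP a b) (I := .ofLower J) (F := .ofLower (b J)) (Or.inr ⟨_, b.idem J, rfl⟩)
      (b.le_closure J)
  · refine le_moore (h𝓕 := act_mem_glueFamily hp hsl hQP a b) (I := .ofLower J) (J := .ofLower (b J)) ?_
    rintro _ (⟨g', E, hE, hE', rfl⟩ | ⟨J', hJ, rfl⟩) hle
    · rcases hab with rfl | rfl
      · exact absurd hE.symm hE'
      · exact hle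
    · exact b.closure_le (y := J) (z := J') hle hJ

theorem upperPart_glue {a : EquivClosure (act K P ∅)}
    {b : EquivClosure (act K Q (P.asIdeal : Set D)ᶜ)} :
    upperPart hp hsl hQP (glue hp hsl hQP a b) = a := by
  refine EquivClosure.ext fun E => le_antisymm ?_ ?_
  · by_cases hE : a E = ⊤
    · rw [hE]
      exact le_top
    · refine le_trans (b := (glue hp hsl hQP a b (.ofUpper hp hsl hQP E)).1)
        (fun _ hx => hx.1) ?_
      refine moore_le (h𝓕 := act_mem_glueFamily hp hsl hQP a b) (I := .ofUpper hp hsl hQP E) (F := .ofUpper hp hsl hQP (a E)) (Or.inl ⟨⟨1,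
        one_mem_locSub _, one_notMem_maxSub _⟩, _, a.idem E, hE, ?_⟩) (a.le_closure E)
      exact Subtype.ext (scale_one _).symm
  · refine le_inf ?_ (a E).2.le
    refine le_moore (h𝓕 := act_mem_glueFamily hp hsl hQP a b) (I := .ofUpper hp hsl hQP E) (J := .ofUpper hp hsl hQP (a E)) ?_
    rintro _ (⟨g, E', hE, hE', rfl⟩ | ⟨J', hJ, rfl⟩) hle
    · rcases (act K Q _ g (.ofUpper hp hsl hQP E')).2.comparable hp hsl hQP with h | h
      · exact (a E).2.le.trans h
      · have hgP : g.1 ∈ locSub K P := by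
          obtain ⟨e, he, he', he''⟩ := E'.2.exists_mem
          have h1 : g.1 * e ∈ locSub K P := h ((mul_mem_scale g.ne_zero).2 he)
          have h2 := mul_mem_locSub (inv_mem_locSub he' he'') h1
          rwa [mul_left_comm, inv_mul_cancel₀ (ne_zero_of_notMem_maxSub he''), mul_one] at h2
        have hgP' : g.1 ∉ maxSub K P := by
          intro hg
          obtain ⟨e, he, he', he''⟩ := E.2.exists_mem
          have h1 : g.1⁻¹ * e ∈ E'.1 := hle he
          have h2 := mul_mem_maxSub (E'.2.le h1) hg
          rw [mul_comm, mul_inv_cancel_left₀ g.ne_zero] at h2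
          exact he'' h2
        have := a.closure_le (y := E) (z := act K P ∅ ⟨g.1, hgP, hgP'⟩ E') hle
          (by rw [a.comm, hE])
        exact this
    · refine (a E).2.le.trans ?_
      obtain ⟨e, he, he', he''⟩ := E.2.exists_mem
      intro z hz
      have := locSub_mul_mem (P := P) (I := J'.1)
        (fun s hs => J'.2.sat s hs fun h => hs (hQP.le h))
        (mul_mem_locSub hz (inv_mem_locSub he' he'')) (hle he)
      rwa [mul_assoc, inv_mul_cancel₀ (ne_zero_of_notMem_maxSub he''), mul_one] at this

/-- A closure over `Q` is glued from its upper and its lower part. -/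
def glueIso : EquivClosure (act K Q (away P)) ≃o
    {p : EquivClosure (act K P ∅) × EquivClosure (act K Q (P.asIdeal : Set D)ᶜ) //
      p.1 = ⊤ ∨ p.2 = ⊥} where
  toFun c := ⟨(upperPart hp hsl hQP c, lowerPart hQP c), upperPart_eq_top_or hp hsl hQP c⟩
  invFun p := glue hp hsl hQP p.1.1 p.1.2
  left_inv c := by
    have h1 := upperPart_glue hp hsl hQP (a := upperPart hp hsl hQP c) (b := lowerPart hQP c)
    have h2 := lowerPart_glue hp hsl hQP (upperPart_eq_top_or hp hsl hQP c)
    exact le_antisymm (le_of_upperPart_le_of_lowerPart_le hp hsl hQP h1.le h2.le)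
      (le_of_upperPart_le_of_lowerPart_le hp hsl hQP h1.ge h2.ge)
  right_inv p := Subtype.ext (Prod.ext (upperPart_glue hp hsl hQP) (lowerPart_glue hp hsl hQP p.2))
  map_rel_iff' {c c'} := by
    refine ⟨fun h => le_of_upperPart_le_of_lowerPart_le hp hsl hQP h.1 h.2, fun h => ⟨fun E => ?_,
      fun J => h (.ofLower J)⟩⟩
    exact inf_le_inf_right (locSub K P) (Subtype.coe_le_coe.2 (h (.ofUpper hp hsl hQP E)))

end

/-- Isomorphisms of the two parts glue. -/
theorem exists_glue_congr {D' : Type*} [CommRing D'] [IsDomain D']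
    {K' : Type*} [Field K'] [Algebra D' K'] [IsFractionRing D' K']
    (hp : IsPrufer D K) (hsl : IsSemilocal D) (hp' : IsPrufer D' K') (hsl' : IsSemilocal D')
    {P Q : PrimeSpectrum D} (hQP : Q < P) {P' Q' : PrimeSpectrum D'} (hQP' : Q' < P')
    (φ : EquivClosure (act K P ∅) ≃o EquivClosure (act K' P' ∅))
    (ψ : EquivClosure (act K Q (P.asIdeal : Set D)ᶜ) ≃o
      EquivClosure (act K' Q' (P'.asIdeal : Set D')ᶜ)) :
    ∃ θ : EquivClosure (act K Q (away P)) ≃o EquivClosure (act K' Q' (away P')), ∀ c,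
      upperPart hp' hsl' hQP' (θ c) = φ (upperPart hp hsl hQP c) ∧
      lowerPart hQP' (θ c) = ψ (lowerPart hQP c) := by
  let χ : {p : EquivClosure (act K P ∅) × EquivClosure (act K Q (P.asIdeal : Set D)ᶜ) //
      p.1 = ⊤ ∨ p.2 = ⊥} ≃o {p : EquivClosure (act K' P' ∅) ×
        EquivClosure (act K' Q' (P'.asIdeal : Set D')ᶜ) // p.1 = ⊤ ∨ p.2 = ⊥} :=
    { toEquiv := Equiv.subtypeEquiv (Equiv.prodCongr φ.toEquiv ψ.toEquiv) (by
        rintro ⟨a, b⟩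
        simp)
      map_rel_iff' := by
        rintro ⟨⟨a, b⟩, h⟩ ⟨⟨a', b'⟩, h'⟩
        change (φ a ≤ φ a' ∧ ψ b ≤ ψ b') ↔ (a ≤ a' ∧ b ≤ b')
        simp }
  refine ⟨(glueIso hp hsl hQP).trans (χ.trans (glueIso hp' hsl' hQP').symm), fun c => ?_⟩
  have h : glueIso hp' hsl' hQP' (((glueIso hp hsl hQP).trans
      (χ.trans (glueIso hp' hsl' hQP').symm)) c) = χ (glueIso hp hsl hQP c) := by simp
  have h' := congrArg Subtype.val h
  exact ⟨congrArg Prod.fst h', congrArg Prod.snd h'⟩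

end Gluing

end Paper

namespace Paper

open Classical in
/-- Two two-element chains are isomorphic. -/
theorem nonempty_orderIso_of_two {A B : Type*} [PartialOrder A] [PartialOrder B] {a₀ a₁ : A}
    {b₀ b₁ : B} (ha : a₀ < a₁) (hA : ∀ a, a = a₀ ∨ a = a₁) (hb : b₀ < b₁)
    (hB : ∀ b, b = b₀ ∨ b = b₁) : Nonempty (A ≃o B) :=
  ⟨{toFun := fun a => if a = a₀ then b₀ else b₁
    invFun := fun b => if b = b₀ then a₀ else a₁
    left_inv := fun a => by rcases hA a with rfl | rfl <;> simp [ha.ne', hb.ne']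
    right_inv := fun b => by rcases hB b with rfl | rfl <;> simp [ha.ne', hb.ne']
    map_rel_iff' := by
      intro a a'
      rcases hA a with rfl | rfl <;> rcases hA a' with rfl | rfl <;>
        simp [ha.ne', hb.le, ha.le, ha.not_ge, hb.not_ge] }⟩

section StarPart

variable {D : Type*} [CommRing D] [IsDomain D]
variable {K : Type*} [Field K] [Algebra D K] [IsFractionRing D K]

variable (hp : IsPrufer D K) {P Q : PrimeSpectrum D} (hQP : Q < P)

/-- The localization `D_P` as a `D_P`-module over `Q`. -/
def Mod.loc : Mod K Q (P.asIdeal : Set D)ᶜ := ⟨locSub K P, isMod_locSub_of_lt hp hQP _ le_rfl⟩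

include hp hQP

theorem maxSub_lt_of_lt : maxSub K Q < maxSub K P := by
  refine lt_of_le_of_ne (hp.maxSub_mono hQP.le) fun h => not_le_of_gt hQP ?_
  intro a ha
  have := (algebraMap_mem_maxSub (K := K)).2 ha
  rwa [← h, algebraMap_mem_maxSub] at this

omit hp hQP in
theorem Mod.locSub_mul_mem_lower (hQP : Q ≤ P) (J : Mod K Q (P.asIdeal : Set D)ᶜ) {x y : K}
    (hx : x ∈ locSub K P) (hy : y ∈ J.1) : x * y ∈ J.1 :=
  locSub_mul_mem (fun s hs => J.2.sat s hs fun h => hs (hQP h)) hx hy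

theorem Mod.inv_mul_mem_maxSub (J : Mod K Q (P.asIdeal : Set D)ᶜ) {z j : K} (hz : z ∉ J.1)
    (hj : j ∈ J.1) : z⁻¹ * j ∈ maxSub K P := by
  by_contra h
  apply hz
  have h2 : (z⁻¹ * j)⁻¹ ∈ locSub K P := by
    by_cases h3 : z⁻¹ * j ∈ locSub K P
    · exact inv_mem_locSub h3 h
    · exact maxSub_le_locSub _ (hp.inv_mem_maxSub h3)
  have h4 := J.locSub_mul_mem_lower hQP.le h2 hj
  have hj0 : j ≠ 0 := by
    rintro rfl
    simp at h
  convert h4 using 1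
  field_simp

variable {b : EquivClosure (act K Q (P.asIdeal : Set D)ᶜ)}

theorem apply_loc_eq_iff_of_principal (h : ∃ x, maxSub K P = scale x (locSub K P)) :
    b (Mod.loc hp hQP) = Mod.loc hp hQP ↔ b = ⊥ := by
  refine ⟨fun hb => ?_, fun hb => by rw [hb]; rfl⟩
  rw [EquivClosure.eq_bot_iff']
  intro J
  refine le_antisymm (fun z hz => ?_) (b.le_closure J)
  by_contra hzJ
  obtain ⟨x, hx⟩ := h
  have hx0 : x ≠ 0 := by
    rintro rfl
    apply one_notMem_maxSub (K := K) P
    rw [hx, mem_scale]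
    simp
  have hxP : x ∈ maxSub K P := by
    rw [hx, mem_scale, inv_mul_cancel₀ hx0]
    exact one_mem_locSub P
  have hxQ : x ∈ locSub K Q := locSub_anti hQP.le (maxSub_le_locSub P hxP)
  have hxQ' : x ∉ maxSub K Q := by
    intro h
    refine (maxSub_lt_of_lt hp hQP).not_ge ?_
    rw [hx]
    intro y hy
    have := mul_mem_maxSub (locSub_anti hQP.le (mem_scale.1 hy)) h
    rwa [mul_comm, mul_inv_cancel_left₀ hx0] at this
  have hzQ : z ∈ locSub K Q := (b J).2.le hz
  have hzQ' : z ∉ maxSub K Q := fun h => hzJ (J.2.lt.le h)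
  let g : LocUnit K Q := LocUnit.mul ⟨z, hzQ, hzQ'⟩ ⟨x, hxQ, hxQ'⟩
  have h1 : J ≤ act K Q _ g (Mod.loc hp hQP) := by
    intro j hj
    have := J.inv_mul_mem_maxSub hp hQP hzJ hj
    rw [hx, mem_scale] at this
    rw [coe_act, mem_scale]
    change (z * x)⁻¹ * j ∈ locSub K P
    rwa [mul_inv_rev, mul_assoc]
  have h2 := b.closure_le h1 (by rw [b.comm, hb]) hz
  rw [coe_act, mem_scale] at h2
  change (z * x)⁻¹ * z ∈ locSub K P at h2
  rw [mul_inv_rev, mul_assoc, inv_mul_cancel₀ (ne_zero_of_notMem_maxSub hzQ'), mul_one] at h2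
  exact inv_notMem_locSub hxP hx0 h2

/-- The `v`-operation: the largest closure fixing `D_P`. -/
def vClosure : EquivClosure (act K Q (P.asIdeal : Set D)ᶜ) :=
  moore {F | ∃ g, F = act K Q _ g (Mod.loc hp hQP)} (by
    rintro g _ ⟨g', rfl⟩
    exact ⟨g.mul g', Subtype.ext (scale_scale _ _ _)⟩)

theorem apply_loc_eq_iff_le_vClosure :
    b (Mod.loc hp hQP) = Mod.loc hp hQP ↔ b ≤ vClosure hp hQP := by
  constructor
  · intro hb J
    refine le_moore ?_
    rintro _ ⟨g, rfl⟩ hJ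
    exact b.closure_le hJ (by rw [b.comm, hb])
  · intro hb
    refine le_antisymm ((hb _).trans (moore_le ⟨⟨1, one_mem_locSub _, one_notMem_maxSub _⟩, ?_⟩
      le_rfl)) (b.le_closure _)
    exact Subtype.ext (scale_one _).symm

theorem eq_scale_maxSub_of_mem_vClosure {J : Mod K Q (P.asIdeal : Set D)ᶜ} {z : K}
    (hz : z ∈ (vClosure hp hQP J).1) (hzJ : z ∉ J.1) : J.1 = scale z (maxSub K P) := by
  refine le_antisymm (fun j hj => J.inv_mul_mem_maxSub hp hQP hzJ hj) fun w hw => ?_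
  by_contra hwJ
  rw [mem_scale] at hw
  have hz0 : z ≠ 0 := by
    rintro rfl
    exact hzJ (zero_mem _)
  have hw0 : w ≠ 0 := by
    rintro rfl
    exact hwJ (zero_mem _)
  have hzQ : z ∈ locSub K Q := (vClosure hp hQP J).2.le hz
  have hwQ : w ∈ locSub K Q := by
    have := mul_mem_locSub hzQ (locSub_anti hQP.le (maxSub_le_locSub P hw))
    rwa [mul_inv_cancel_left₀ hz0] at this
  have hwQ' : w ∉ maxSub K Q := fun h => hwJ (J.2.lt.le h)
  have h1 := (mem_moore.1 hz).2 (act K Q _ ⟨w, hwQ, hwQ'⟩ (Mod.loc hp hQP)) ⟨_, rfl⟩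
    fun j hj => maxSub_le_locSub P (J.inv_mul_mem_maxSub hp hQP hwJ hj)
  rw [coe_act, mem_scale] at h1
  have := inv_notMem_locSub hw (mul_ne_zero (inv_ne_zero hz0) hw0)
  rw [mul_inv_rev, inv_inv] at this
  exact this h1

/-- The maximal ideal of `D_P` as a `D_P`-module over `Q`. -/
def Mod.max : Mod K Q (P.asIdeal : Set D)ᶜ :=
  ⟨maxSub K P, maxSub_lt_of_lt hp hQP, (maxSub_le_locSub P).trans (locSub_anti hQP.le),
    fun _ hs _ _ => maxSub_saturated hs⟩

theorem vClosure_le_of_one_mem (h : (1 : K) ∈ (b (Mod.max hp hQP)).1) : vClosure hp hQP ≤ b := by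
  intro J z hz
  by_cases hzJ : z ∈ J.1
  · exact b.le_closure J hzJ
  · have hJ := eq_scale_maxSub_of_mem_vClosure hp hQP hz hzJ
    have hzQ : z ∈ locSub K Q := (vClosure hp hQP J).2.le hz
    have hzQ' : z ∉ maxSub K Q := fun h => hzJ (J.2.lt.le h)
    have hJ' : J = act K Q _ ⟨z, hzQ, hzQ'⟩ (Mod.max hp hQP) := Subtype.ext hJ
    rw [hJ', b.comm, coe_act, mem_scale, inv_mul_cancel₀ (ne_zero_of_notMem_maxSub hzQ')]
    exact h

theorem eq_bot_or_vClosure_le (hb : b ≤ vClosure hp hQP) : b = ⊥ ∨ vClosure hp hQP ≤ b := by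
  rw [or_iff_not_imp_left, EquivClosure.eq_bot_iff']
  intro H
  push Not at H
  obtain ⟨J, hJ⟩ := H
  obtain ⟨z, hz, hzJ⟩ := SetLike.exists_of_lt
    (show J.1 < (b J).1 from lt_of_le_of_ne (b.le_closure J) fun h => hJ (Subtype.ext h.symm))
  have hJm := eq_scale_maxSub_of_mem_vClosure hp hQP (hb J hz) hzJ
  have hzQ : z ∈ locSub K Q := (b J).2.le hz
  have hzQ' : z ∉ maxSub K Q := fun h => hzJ (J.2.lt.le h)
  have hJ' : J = act K Q _ ⟨z, hzQ, hzQ'⟩ (Mod.max hp hQP) := Subtype.ext hJm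
  apply vClosure_le_of_one_mem hp hQP
  have h1 : z ∈ (b J).1 := hz
  rwa [hJ', b.comm, coe_act, mem_scale, inv_mul_cancel₀ (ne_zero_of_notMem_maxSub hzQ')] at h1

theorem bot_lt_vClosure (h : ¬ ∃ x, maxSub K P = scale x (locSub K P)) :
    ⊥ < vClosure hp hQP := by
  rw [bot_lt_iff_ne_bot]
  intro H
  have h1 : (1 : K) ∈ (vClosure hp hQP (Mod.max hp hQP)).1 := by
    refine mem_moore.2 ⟨one_mem_locSub _, ?_⟩
    rintro _ ⟨g, rfl⟩ hle
    rw [coe_act, mem_scale, mul_one]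
    by_contra hg
    have hg' := hp.inv_mem_maxSub hg
    rw [inv_inv] at hg'
    refine h ⟨g.1, le_antisymm hle fun y hy => ?_⟩
    have := mul_mem_maxSub (mem_scale.1 hy) hg'
    rwa [mul_comm, mul_inv_cancel_left₀ g.ne_zero] at this
  rw [H] at h1
  exact one_notMem_maxSub P h1

theorem apply_loc_eq_iff_of_not_principal (h : ¬ ∃ x, maxSub K P = scale x (locSub K P)) :
    b (Mod.loc hp hQP) = Mod.loc hp hQP ↔ ∀ b' < b, b' = ⊥ := by
  rw [apply_loc_eq_iff_le_vClosure]
  constructor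
  · intro hb b' hb'
    rcases eq_bot_or_vClosure_le hp hQP (hb'.le.trans hb) with h' | h'
    · exact h'
    · exact absurd (hb'.trans_le hb) h'.not_gt
  · intro hb
    by_contra hbv
    have hbO : b (Mod.loc hp hQP) ≠ Mod.loc hp hQP := fun h' =>
      hbv ((apply_loc_eq_iff_le_vClosure hp hQP).1 h')
    obtain ⟨z, hz, hzO⟩ := SetLike.exists_of_lt
      (show (Mod.loc hp hQP).1 < (b (Mod.loc hp hQP)).1 from
        lt_of_le_of_ne (b.le_closure (Mod.loc hp hQP)) fun h => hbO (Subtype.ext h.symm))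
    have hzQ : z ∈ locSub K Q := (b (Mod.loc hp hQP)).2.le hz
    have hzQ' : z ∉ maxSub K Q := fun h => hzO ((Mod.loc hp hQP).2.lt.le h)
    have hz0 := ne_zero_of_notMem_maxSub hzQ'
    have hle : vClosure hp hQP ≤ b := by
      apply vClosure_le_of_one_mem hp hQP
      have h1 : act K Q _ (LocUnit.inv ⟨z, hzQ, hzQ'⟩) (Mod.loc hp hQP) ≤ Mod.max hp hQP := by
        intro y hy
        have h2 : z⁻¹⁻¹ * y ∈ locSub K P := hy
        have := mul_mem_maxSub h2 (hp.inv_mem_maxSub (P := P) hzO)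
        rwa [inv_inv, mul_comm, inv_mul_cancel_left₀ hz0] at this
      apply b.mono h1
      rw [b.comm, coe_act, mem_scale]
      change z⁻¹⁻¹ * 1 ∈ (b (Mod.loc hp hQP)).1
      simpa using hz
    rcases hle.eq_or_lt with h' | h'
    · exact hbv h'.ge
    · exact (bot_lt_vClosure hp hQP h).ne' (hb _ h')

end StarPart

section StarTransfer

variable {D : Type*} [CommRing D] [IsDomain D]
variable {K : Type*} [Field K] [Algebra D K] [IsFractionRing D K]
variable {D' : Type*} [CommRing D'] [IsDomain D']
variable {K' : Type*} [Field K'] [Algebra D' K'] [IsFractionRing D' K']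
variable (hp : IsPrufer D K) {P Q : PrimeSpectrum D} (hQP : Q < P)
variable (hp' : IsPrufer D' K') {P' Q' : PrimeSpectrum D'} (hQP' : Q' < P')
  (h : (∃ x, maxSub K P = scale x (locSub K P)) ↔ ∃ x, maxSub K' P' = scale x (locSub K' P'))
include h

theorem apply_loc_eq_iff_of_orderIso (ψ : EquivClosure (act K Q (P.asIdeal : Set D)ᶜ) ≃o
      EquivClosure (act K' Q' (P'.asIdeal : Set D')ᶜ)) (b) :
    b (Mod.loc hp hQP) = Mod.loc hp hQP ↔ ψ b (Mod.loc hp' hQP') = Mod.loc hp' hQP' := by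
  by_cases h1 : ∃ x, maxSub K P = scale x (locSub K P)
  · rw [apply_loc_eq_iff_of_principal hp hQP h1,
      apply_loc_eq_iff_of_principal hp' hQP' (h.1 h1), map_eq_bot_iff]
  · rw [apply_loc_eq_iff_of_not_principal hp hQP h1,
      apply_loc_eq_iff_of_not_principal hp' hQP' (fun h2 => h1 (h.2 h2))]
    constructor
    · intro H b' hb'
      have := H (ψ.symm b') (by rwa [← ψ.lt_iff_lt, ψ.apply_symm_apply])
      rwa [map_eq_bot_iff] at this
    · intro H b' hb'
      have := H (ψ b') (ψ.lt_iff_lt.2 hb')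
      rwa [map_eq_bot_iff] at this

theorem nonempty_fixing_loc_orderIso :
    Nonempty ({b : EquivClosure (act K Q (P.asIdeal : Set D)ᶜ) //
        b (Mod.loc hp hQP) = Mod.loc hp hQP} ≃o
      {b : EquivClosure (act K' Q' (P'.asIdeal : Set D')ᶜ) //
        b (Mod.loc hp' hQP') = Mod.loc hp' hQP'}) := by
  by_cases h1 : ∃ x, maxSub K P = scale x (locSub K P)
  · have e : ∀ b : EquivClosure (act K Q (P.asIdeal : Set D)ᶜ),
        b (Mod.loc hp hQP) = Mod.loc hp hQP ↔ b = ⊥ := fun b =>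
      apply_loc_eq_iff_of_principal hp hQP h1
    have e' : ∀ b : EquivClosure (act K' Q' (P'.asIdeal : Set D')ᶜ),
        b (Mod.loc hp' hQP') = Mod.loc hp' hQP' ↔ b = ⊥ := fun b =>
      apply_loc_eq_iff_of_principal hp' hQP' (h.1 h1)
    have : Unique {b : EquivClosure (act K Q (P.asIdeal : Set D)ᶜ) //
        b (Mod.loc hp hQP) = Mod.loc hp hQP} :=
      ⟨⟨⟨⊥, rfl⟩⟩, fun b => Subtype.ext ((e _).1 b.2)⟩
    have : Unique {b : EquivClosure (act K' Q' (P'.asIdeal : Set D')ᶜ) //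
        b (Mod.loc hp' hQP') = Mod.loc hp' hQP'} :=
      ⟨⟨⟨⊥, rfl⟩⟩, fun b => Subtype.ext ((e' _).1 b.2)⟩
    exact ⟨OrderIso.ofUnique _ _⟩
  · have h2 := fun h2 => h1 (h.2 h2)
    have key : ∀ {b : EquivClosure (act K Q (P.asIdeal : Set D)ᶜ)},
        b (Mod.loc hp hQP) = Mod.loc hp hQP → b = ⊥ ∨ b = vClosure hp hQP := by
      intro b hb
      rw [apply_loc_eq_iff_le_vClosure] at hb
      exact (eq_bot_or_vClosure_le hp hQP hb).imp_right fun h' => le_antisymm hb h'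
    have key' : ∀ {b : EquivClosure (act K' Q' (P'.asIdeal : Set D')ᶜ)},
        b (Mod.loc hp' hQP') = Mod.loc hp' hQP' → b = ⊥ ∨ b = vClosure hp' hQP' := by
      intro b hb
      rw [apply_loc_eq_iff_le_vClosure] at hb
      exact (eq_bot_or_vClosure_le hp' hQP' hb).imp_right fun h' => le_antisymm hb h'
    exact nonempty_orderIso_of_two (a₀ := ⟨⊥, rfl⟩)
      (a₁ := ⟨vClosure hp hQP, (apply_loc_eq_iff_le_vClosure hp hQP).2 le_rfl⟩)
      (b₀ := ⟨⊥, rfl⟩)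
      (b₁ := ⟨vClosure hp' hQP', (apply_loc_eq_iff_le_vClosure hp' hQP').2 le_rfl⟩)
      (bot_lt_vClosure hp hQP h1) (fun b => (key b.2).imp Subtype.ext Subtype.ext)
      (bot_lt_vClosure hp' hQP' h2) (fun b => (key' b.2).imp Subtype.ext Subtype.ext)

end StarTransfer

section LocRing

variable {D : Type*} [CommRing D] [IsDomain D]
variable (K : Type*) [Field K] [Algebra D K] [IsFractionRing D K]

/-- The embedding of the localization at `P` into the quotient field. -/
def locHom (P : PrimeSpectrum D) : locRing D P.asIdeal P.2 →+* K :=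
  IsLocalization.lift (M := P.asIdeal.primeCompl) (g := algebraMap D K)
    fun s => (algebraMap_ne_zero_of_notMem s.2).isUnit

variable {K}

theorem locHom_algebraMap (P : PrimeSpectrum D) (a : D) :
    locHom K P (algebraMap D _ a) = algebraMap D K a := IsLocalization.lift_eq _ a

theorem mem_map_iff_locHom_mem_maxSub {P Q : PrimeSpectrum D} (hQP : Q ≤ P)
    (r : locRing D P.asIdeal P.2) :
    r ∈ Ideal.map (algebraMap D (locRing D P.asIdeal P.2)) Q.asIdeal ↔
      locHom K P r ∈ maxSub K Q := by
  constructor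
  · intro h
    obtain ⟨⟨a, s⟩, h⟩ := (IsLocalization.mem_map_algebraMap_iff P.asIdeal.primeCompl _).1 h
    refine ⟨a, a.2, s, fun h' => s.2 (hQP h'), ?_⟩
    have := congrArg (locHom K P) h
    rw [map_mul, locHom_algebraMap, locHom_algebraMap] at this
    rw [← this, mul_comm]
  · intro h
    obtain ⟨⟨a, s⟩, hr⟩ := IsLocalization.surj P.asIdeal.primeCompl r
    have h1 := congrArg (locHom K P) hr
    rw [map_mul, locHom_algebraMap, locHom_algebraMap] at h1
    have ha : a ∈ Q.asIdeal := by
      rw [← algebraMap_mem_maxSub (K := K), ← h1, mul_comm]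
      exact mul_mem_of_mem _ h
    exact (IsLocalization.mem_map_algebraMap_iff P.asIdeal.primeCompl _).2 ⟨(⟨a, ha⟩, s), hr⟩

theorem locHom_injective (P : PrimeSpectrum D) : Function.Injective (locHom K P) := by
  rw [injective_iff_map_eq_zero]
  intro r h
  obtain ⟨⟨a, s⟩, hr⟩ := IsLocalization.surj P.asIdeal.primeCompl r
  have h1 := congrArg (locHom K P) hr
  rw [map_mul, locHom_algebraMap, locHom_algebraMap, h, zero_mul, eq_comm,
    map_eq_zero_iff _ (IsFractionRing.injective D K)] at h1
  have h2 : r * algebraMap D _ (s : D) = 0 := by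
    rw [hr, h1, map_zero]
  exact ((IsLocalization.map_units _ s).mul_left_eq_zero).1 h2

theorem mem_locSub_iff_exists_locHom {P : PrimeSpectrum D} {x : K} :
    x ∈ locSub K P ↔ ∃ r, locHom K P r = x := by
  constructor
  · rintro ⟨a, s, hs, h⟩
    refine ⟨IsLocalization.mk' _ a (⟨s, hs⟩ : P.asIdeal.primeCompl), ?_⟩
    apply mul_left_cancel₀ (algebraMap_ne_zero_of_notMem (K := K) hs)
    rw [h, ← locHom_algebraMap P, ← map_mul, ← locHom_algebraMap P]
    congr 1
    exact IsLocalization.mk'_spec' _ a (⟨s, hs⟩ : P.asIdeal.primeCompl)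
  · rintro ⟨r, rfl⟩
    obtain ⟨⟨a, s⟩, hr⟩ := IsLocalization.surj P.asIdeal.primeCompl r
    refine ⟨a, s, s.2, ?_⟩
    have h1 := congrArg (locHom K P) hr
    rw [map_mul, locHom_algebraMap, locHom_algebraMap] at h1
    rw [← h1, mul_comm]

theorem isPrincipal_map_iff {P : PrimeSpectrum D} (hP : P.asIdeal ≠ ⊥) :
    (Ideal.map (algebraMap D (locRing D P.asIdeal P.2)) P.asIdeal).IsPrincipal ↔
      ∃ x, maxSub K P = scale x (locSub K P) := by
  obtain ⟨p, hpP, hp0⟩ := Submodule.exists_mem_ne_zero_of_ne_bot hP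
  constructor
  · rintro ⟨r, hr⟩
    have hr0 : r ≠ 0 := by
      rintro rfl
      have := Ideal.mem_map_of_mem (algebraMap D (locRing D P.asIdeal P.2)) hpP
      rw [hr] at this
      have h1 : algebraMap D (locRing D P.asIdeal P.2) p = 0 := by simpa using this
      have h2 := congrArg (locHom K P) h1
      rw [locHom_algebraMap, map_zero, map_eq_zero_iff _ (IsFractionRing.injective D K)] at h2
      exact hp0 h2
    have hr0' : locHom K P r ≠ 0 := by
      rwa [Ne, map_eq_zero_iff _ (locHom_injective P)]
    have hrm : locHom K P r ∈ maxSub K P := by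
      rw [← mem_map_iff_locHom_mem_maxSub le_rfl, hr]
      exact Submodule.mem_span_singleton_self r
    refine ⟨locHom K P r, le_antisymm (fun y hy => ?_) fun y hy => ?_⟩
    · obtain ⟨t, rfl⟩ := mem_locSub_iff_exists_locHom.1 (maxSub_le_locSub P hy)
      rw [← mem_map_iff_locHom_mem_maxSub le_rfl, hr, Submodule.mem_span_singleton] at hy
      obtain ⟨u, rfl⟩ := hy
      rw [mem_scale, smul_eq_mul, map_mul, mul_comm, mul_inv_cancel_right₀ hr0']
      exact mem_locSub_iff_exists_locHom.2 ⟨u, rfl⟩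
    · have := mul_mem_maxSub (mem_scale.1 hy) hrm
      rwa [mul_comm, mul_inv_cancel_left₀ hr0'] at this
  · rintro ⟨x, hx⟩
    have hx0 : x ≠ 0 := by
      rintro rfl
      apply one_notMem_maxSub (K := K) P
      rw [hx, mem_scale]
      simp
    have hxP : x ∈ maxSub K P := by
      rw [hx, mem_scale, inv_mul_cancel₀ hx0]
      exact one_mem_locSub P
    obtain ⟨r, rfl⟩ := mem_locSub_iff_exists_locHom.1 (maxSub_le_locSub P hxP)
    refine ⟨r, le_antisymm (fun t ht => ?_) ?_⟩
    · rw [mem_map_iff_locHom_mem_maxSub (K := K) le_rfl, hx, mem_scale,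
        mem_locSub_iff_exists_locHom] at ht
      obtain ⟨u, hu⟩ := ht
      refine Submodule.mem_span_singleton.2 ⟨u, locHom_injective (K := K) P ?_⟩
      rw [smul_eq_mul, map_mul, hu, mul_comm, mul_inv_cancel_left₀ hx0]
    · refine (Submodule.span_singleton_le_iff_mem _ _).2 ?_
      rwa [mem_map_iff_locHom_mem_maxSub (K := K) le_rfl]

end LocRing

end Paper

namespace Paper

/-- Restrict an order isomorphism to corresponding subtypes. -/
def subtypeOrderIso {A B : Type*} [PartialOrder A] [PartialOrder B] (e : A ≃o B) {p : A → Prop}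
    {q : B → Prop} (h : ∀ a, p a ↔ q (e a)) : {a // p a} ≃o {b // q b} where
  toEquiv := e.toEquiv.subtypeEquiv h
  map_rel_iff' := e.le_iff_le

section Semi

variable {D : Type*} [CommRing D] [IsDomain D]
variable (K : Type*) [Field K] [Algebra D K] [IsFractionRing D K]

/-- The semilocalization of `D` at the maximal ideals containing `P`. -/
def semi (P : PrimeSpectrum D) : Submodule D K where
  carrier := {x | ∃ s ∈ away P, ∃ a, algebraMap D K s * x = algebraMap D K a}
  zero_mem' := ⟨1, one_mem_away P, 0, by simp⟩
  add_mem' := by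
    rintro x y ⟨s, hs, a, hx⟩ ⟨t, ht, b, hy⟩
    refine ⟨s * t, away_mul hs ht, t * a + s * b, ?_⟩
    simp only [map_add, map_mul, ← hx, ← hy]
    ring
  smul_mem' := by
    rintro c x ⟨s, hs, a, hx⟩
    refine ⟨s, hs, c * a, ?_⟩
    rw [Algebra.smul_def, map_mul, ← hx]
    ring

variable {K}

theorem algebraMap_mem_semi (P : PrimeSpectrum D) (a : D) : algebraMap D K a ∈ semi K P :=
  ⟨1, one_mem_away P, a, by simp⟩

theorem one_mem_semi (P : PrimeSpectrum D) : (1 : K) ∈ semi K P := by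
  simpa using algebraMap_mem_semi (K := K) P 1

theorem semi_saturated {P : PrimeSpectrum D} {s : D} (hs : s ∈ away P) {x : K}
    (hx : algebraMap D K s * x ∈ semi K P) : x ∈ semi K P := by
  obtain ⟨t, ht, a, h⟩ := hx
  exact ⟨t * s, away_mul ht hs, a, by rw [map_mul, mul_assoc, h]⟩

theorem semi_le_locSub (P : PrimeSpectrum D) : semi K P ≤ locSub K P := by
  rintro x ⟨s, hs, a, h⟩
  exact ⟨a, s, notMem_of_mem_away hs, h⟩

theorem mem_away_iff_of_isMaximal {P : PrimeSpectrum D} (hP : P.asIdeal.IsMaximal) {s : D} :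
    s ∈ away P ↔ s ∉ P.asIdeal :=
  ⟨notMem_of_mem_away, fun hs M hM hPM h => hs (by rwa [hP.eq_of_le hM.ne_top hPM])⟩

theorem semi_eq_locSub_iff {P : PrimeSpectrum D} :
    semi K P = locSub K P ↔ P.asIdeal.IsMaximal := by
  constructor
  · intro h
    obtain ⟨M, hM, hPM⟩ := Ideal.exists_le_maximal _ P.2.ne_top
    by_contra hP
    obtain ⟨p, hpM, hpP⟩ := SetLike.exists_of_lt
      (lt_of_le_of_ne hPM fun h => hP (h ▸ hM))
    have hp0 := algebraMap_ne_zero_of_notMem (K := K) hpP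
    have h1 : (algebraMap D K p)⁻¹ ∈ locSub K P := ⟨1, p, hpP, by simp [hp0]⟩
    rw [← h] at h1
    obtain ⟨s, hs, a, h2⟩ := h1
    rw [← div_eq_mul_inv, div_eq_iff hp0, ← map_mul] at h2
    have h3 := IsFractionRing.injective D K h2
    exact hs M hM hPM (h3 ▸ Ideal.mul_mem_left _ _ hpM)
  · intro hP
    refine le_antisymm (semi_le_locSub P) ?_
    rintro x ⟨a, s, hs, h⟩
    exact ⟨s, (mem_away_iff_of_isMaximal hP).2 hs, a, h⟩

variable (hp : IsPrufer D K) (hsl : IsSemilocal D)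
include hp hsl

theorem isMod_semi (P : PrimeSpectrum D) : IsMod P ∅ (semi K P) where
  lt := lt_of_le_of_ne (fun _ hx => hp.exists_away_of_mem_maxSub hsl hx)
    fun h => one_notMem_maxSub (K := K) P (h ▸ one_mem_semi P)
  le := semi_le_locSub P
  sat := by simp

/-- The semilocalization at `P` as a module between `PD_P` and `D_P`. -/
def Mod.semi (P : PrimeSpectrum D) : Mod K P ∅ := ⟨Paper.semi K P, isMod_semi hp hsl P⟩

theorem Mod.semi_eq_top_iff {P : PrimeSpectrum D} :
    Mod.semi (K := K) hp hsl P = ⊤ ↔ P.asIdeal.IsMaximal := by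
  rw [← semi_eq_locSub_iff (K := K)]
  exact Subtype.ext_iff

theorem Mod.eq_top_of_isMaximal {P : PrimeSpectrum D} (hP : P.asIdeal.IsMaximal) (E : Mod K P ∅) :
    E = ⊤ := by
  refine top_le_iff.1 fun z hz => ?_
  obtain ⟨e, he, he', he''⟩ := E.2.exists_mem
  have := locSub_mul_mem (P := P) (fun s hs => E.2.sat_away hp hsl s
    ((mem_away_iff_of_isMaximal hP).2 hs)) (mul_mem_locSub hz (inv_mem_locSub he' he'')) he
  rwa [mul_assoc, inv_mul_cancel₀ (ne_zero_of_notMem_maxSub he''), mul_one] at this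

variable {P Q : PrimeSpectrum D} (hQP : Q < P)

theorem apply_semi_eq_iff_of_isMaximal (hP : P.asIdeal.IsMaximal)
    (c : EquivClosure (act K Q (away P))) :
    c (.ofUpper hp hsl hQP (Mod.semi hp hsl P)) = .ofUpper hp hsl hQP (Mod.semi hp hsl P) ↔
      lowerPart hQP c (Mod.loc hp hQP) = Mod.loc hp hQP := by
  have : Mod.ofUpper hp hsl hQP (Mod.semi hp hsl P) = .ofLower (Mod.loc hp hQP) :=
    Subtype.ext (semi_eq_locSub_iff.2 hP)
  rw [this, Subtype.ext_iff, Subtype.ext_iff]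
  rfl

theorem apply_semi_eq_iff_of_not_isMaximal (hP : ¬ P.asIdeal.IsMaximal)
    (c : EquivClosure (act K Q (away P))) :
    c (.ofUpper hp hsl hQP (Mod.semi hp hsl P)) = .ofUpper hp hsl hQP (Mod.semi hp hsl P) ↔
      upperPart hp hsl hQP c (Mod.semi hp hsl P) = Mod.semi hp hsl P := by
  rw [Subtype.ext_iff, Subtype.ext_iff, coe_upperPart]
  constructor
  · intro h
    rw [h]
    exact inf_eq_left.2 (semi_le_locSub P)
  · intro h
    rcases (c (.ofUpper hp hsl hQP (Mod.semi hp hsl P))).2.comparable hp hsl hQP with h' | h'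
    · rw [inf_eq_right.2 h'] at h
      exact absurd (semi_eq_locSub_iff.1 h.symm) hP
    · rw [inf_eq_left.2 h'] at h
      exact h

/-- Over a nonmaximal `P`, closures fixing the semilocalization are determined by their upper
part. -/
def fixingUpperIso (hP : ¬ P.asIdeal.IsMaximal) :
    {c : EquivClosure (act K Q (away P)) //
      c (.ofUpper hp hsl hQP (Mod.semi hp hsl P)) = .ofUpper hp hsl hQP (Mod.semi hp hsl P)} ≃o
    {a : EquivClosure (act K P ∅) // a (Mod.semi hp hsl P) = Mod.semi hp hsl P} :=
  have key : ∀ c : EquivClosure (act K Q (away P)),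
      c (.ofUpper hp hsl hQP (Mod.semi hp hsl P)) = .ofUpper hp hsl hQP (Mod.semi hp hsl P) →
        lowerPart hQP c = ⊥ := by
    intro c hc
    refine (upperPart_eq_top_or hp hsl hQP c).resolve_left fun h => ?_
    rw [apply_semi_eq_iff_of_not_isMaximal hp hsl hQP hP, h, EquivClosure.top_apply] at hc
    exact hP ((Mod.semi_eq_top_iff hp hsl).1 hc.symm)
  { toFun := fun c => ⟨upperPart hp hsl hQP c.1,
      (apply_semi_eq_iff_of_not_isMaximal hp hsl hQP hP c.1).1 c.2⟩
    invFun := fun a => ⟨glue hp hsl hQP a.1 ⊥, by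
      rw [apply_semi_eq_iff_of_not_isMaximal hp hsl hQP hP, upperPart_glue]
      exact a.2⟩
    left_inv := fun c => by
      apply Subtype.ext
      apply (glueIso hp hsl hQP).injective
      apply Subtype.ext
      exact Prod.ext (upperPart_glue hp hsl hQP)
        ((lowerPart_glue hp hsl hQP (Or.inr rfl)).trans (key c.1 c.2).symm)
    right_inv := fun a => Subtype.ext (upperPart_glue hp hsl hQP)
    map_rel_iff' := by
      intro c c'
      refine ⟨fun h => ?_, fun h => ((glueIso hp hsl hQP).monotone
        (show c.1 ≤ c'.1 from h)).1⟩
      refine le_of_upperPart_le_of_lowerPart_le hp hsl hQP h ?_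
      rw [key c.1 c.2]
      exact bot_le }

/-- Over a maximal `P`, closures fixing the semilocalization are determined by their lower
part. -/
def fixingLowerIso (hP : P.asIdeal.IsMaximal) :
    {c : EquivClosure (act K Q (away P)) //
      c (.ofUpper hp hsl hQP (Mod.semi hp hsl P)) = .ofUpper hp hsl hQP (Mod.semi hp hsl P)} ≃o
    {b : EquivClosure (act K Q (P.asIdeal : Set D)ᶜ) //
      b (Mod.loc hp hQP) = Mod.loc hp hQP} :=
  have key : ∀ a : EquivClosure (act K P ∅), a = ⊤ := fun a =>
    EquivClosure.eq_top_iff'.2 fun E => Mod.eq_top_of_isMaximal hp hsl hP _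
  { toFun := fun c => ⟨lowerPart hQP c.1, (apply_semi_eq_iff_of_isMaximal hp hsl hQP hP c.1).1 c.2⟩
    invFun := fun b => ⟨glue hp hsl hQP ⊤ b.1, by
      rw [apply_semi_eq_iff_of_isMaximal hp hsl hQP hP, lowerPart_glue hp hsl hQP (Or.inl rfl)]
      exact b.2⟩
    left_inv := fun c => by
      apply Subtype.ext
      apply (glueIso hp hsl hQP).injective
      apply Subtype.ext
      exact Prod.ext ((upperPart_glue hp hsl hQP).trans (key _).symm)
        (lowerPart_glue hp hsl hQP (Or.inl rfl))
    right_inv := fun b => Subtype.ext (lowerPart_glue hp hsl hQP (Or.inl rfl))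
    map_rel_iff' := by
      intro c c'
      refine ⟨fun h => ?_, fun h => ((glueIso hp hsl hQP).monotone
        (show c.1 ≤ c'.1 from h)).2⟩
      refine le_of_upperPart_le_of_lowerPart_le hp hsl hQP ?_ h
      rw [key (upperPart hp hsl hQP c'.1)]
      exact le_top }

end Semi

section SemiTransfer

variable {D : Type*} [CommRing D] [IsDomain D]
variable {K : Type*} [Field K] [Algebra D K] [IsFractionRing D K]
variable {D' : Type*} [CommRing D'] [IsDomain D']
variable {K' : Type*} [Field K'] [Algebra D' K'] [IsFractionRing D' K']
variable (hp : IsPrufer D K) (hsl : IsSemilocal D) {P Q : PrimeSpectrum D} (hQP : Q < P)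
variable (hp' : IsPrufer D' K') (hsl' : IsSemilocal D') {P' Q' : PrimeSpectrum D'} (hQP' : Q' < P')
  (hmax : P.asIdeal.IsMaximal ↔ P'.asIdeal.IsMaximal)
  (hprinc : P.asIdeal.IsMaximal → ((∃ x, maxSub K P = scale x (locSub K P)) ↔
    ∃ x, maxSub K' P' = scale x (locSub K' P')))
  (φ : EquivClosure (act K P ∅) ≃o EquivClosure (act K' P' ∅))
  (hφ : ∀ a, a (Mod.semi hp hsl P) = Mod.semi hp hsl P ↔
    φ a (Mod.semi hp' hsl' P') = Mod.semi hp' hsl' P')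
include hmax hprinc hφ

theorem exists_congr_preserving_semi
    (ψ : EquivClosure (act K Q (P.asIdeal : Set D)ᶜ) ≃o
      EquivClosure (act K' Q' (P'.asIdeal : Set D')ᶜ)) :
    ∃ θ : EquivClosure (act K Q (away P)) ≃o EquivClosure (act K' Q' (away P')), ∀ c,
      c (.ofUpper hp hsl hQP (Mod.semi hp hsl P)) = .ofUpper hp hsl hQP (Mod.semi hp hsl P) ↔
      θ c (.ofUpper hp' hsl' hQP' (Mod.semi hp' hsl' P')) =
        .ofUpper hp' hsl' hQP' (Mod.semi hp' hsl' P') := by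
  obtain ⟨θ, hθ⟩ := exists_glue_congr hp hsl hp' hsl' hQP hQP' φ ψ
  refine ⟨θ, fun c => ?_⟩
  by_cases hP : P.asIdeal.IsMaximal
  · rw [apply_semi_eq_iff_of_isMaximal hp hsl hQP hP,
      apply_semi_eq_iff_of_isMaximal hp' hsl' hQP' (hmax.1 hP), (hθ c).2]
    exact apply_loc_eq_iff_of_orderIso hp hQP hp' hQP' (hprinc hP) ψ _
  · rw [apply_semi_eq_iff_of_not_isMaximal hp hsl hQP hP,
      apply_semi_eq_iff_of_not_isMaximal hp' hsl' hQP' (fun h => hP (hmax.2 h)), (hθ c).1]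
    exact hφ _

theorem nonempty_fixing_semi_orderIso :
    Nonempty ({c : EquivClosure (act K Q (away P)) //
      c (.ofUpper hp hsl hQP (Mod.semi hp hsl P)) = .ofUpper hp hsl hQP (Mod.semi hp hsl P)} ≃o
    {c : EquivClosure (act K' Q' (away P')) //
      c (.ofUpper hp' hsl' hQP' (Mod.semi hp' hsl' P')) =
        .ofUpper hp' hsl' hQP' (Mod.semi hp' hsl' P')}) := by
  by_cases hP : P.asIdeal.IsMaximal
  · obtain ⟨e⟩ := nonempty_fixing_loc_orderIso hp hQP hp' hQP' (hprinc hP)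
    exact ⟨(fixingLowerIso hp hsl hQP hP).trans
      (e.trans (fixingLowerIso hp' hsl' hQP' (hmax.1 hP)).symm)⟩
  · exact ⟨(fixingUpperIso hp hsl hQP hP).trans ((subtypeOrderIso φ hφ).trans
      (fixingUpperIso hp' hsl' hQP' fun h => hP (hmax.2 h)).symm)⟩

end SemiTransfer

end Paper

namespace Paper

section Residue

variable {D : Type*} [CommRing D] [IsDomain D] {P Q : PrimeSpectrum D} (hQP : Q < P)

include hQP in
theorem isPrime_map_of_lt :
    (Ideal.map (algebraMap D (locRing D P.asIdeal P.2)) Q.asIdeal).IsPrime :=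
  IsLocalization.isPrime_of_isPrime_disjoint P.asIdeal.primeCompl _ _ Q.2
    (Set.disjoint_left.2 fun _ hx hx' => hx (hQP.le hx'))

include hQP in
theorem isDomain_Zring : IsDomain (Zring D P.asIdeal Q.asIdeal P.2) :=
  have := isPrime_map_of_lt hQP
  Ideal.Quotient.isDomain _

variable (L : Type*) [Field L] [Algebra (Zring D P.asIdeal Q.asIdeal P.2) L]
  [IsFractionRing (Zring D P.asIdeal Q.asIdeal P.2) L]

variable (P Q) in
/-- The canonical map from `D` to the residue field of `D_Q`. -/
def toResidue : D →+* L := (algebraMap (Zring D P.asIdeal Q.asIdeal P.2) L).comp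
  ((Ideal.Quotient.mk _).comp (algebraMap D (locRing D P.asIdeal P.2)))

variable {L} in
include hQP in
theorem toResidue_eq_zero_iff (a : D) : toResidue P Q L a = 0 ↔ a ∈ Q.asIdeal := by
  have h1 : toResidue P Q L a = 0 ↔ algebraMap D (locRing D P.asIdeal P.2) a ∈
      Ideal.map (algebraMap D (locRing D P.asIdeal P.2)) Q.asIdeal := by
    rw [← Ideal.Quotient.eq_zero_iff_mem]
    exact map_eq_zero_iff _ (IsFractionRing.injective _ L)
  rw [h1, mem_map_iff_locHom_mem_maxSub (K := FractionRing D) hQP.le, locHom_algebraMap,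
    algebraMap_mem_maxSub]

/-- The map from `D_Q` to its residue field. -/
def residueHom : locRing D Q.asIdeal Q.2 →+* L :=
  IsLocalization.lift (M := Q.asIdeal.primeCompl) (g := toResidue P Q L)
    fun s => isUnit_iff_ne_zero.2 fun h => s.2 ((toResidue_eq_zero_iff hQP _).1 h)

variable {L}

theorem residueHom_algebraMap (a : D) :
    residueHom hQP L (algebraMap D _ a) = toResidue P Q L a := IsLocalization.lift_eq _ a

variable {K : Type*} [Field K] [Algebra D K] [IsFractionRing D K]

theorem mul_locHom_eq_iff (b : locRing D Q.asIdeal Q.2) (s a : D) :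
    algebraMap D K s * locHom K Q b = algebraMap D K a ↔ algebraMap D _ s * b = algebraMap D _ a := by
  rw [← (locHom_injective (K := K) Q).eq_iff, map_mul, locHom_algebraMap, locHom_algebraMap]

theorem residueHom_eq_zero_iff (b : locRing D Q.asIdeal Q.2) :
    residueHom hQP L b = 0 ↔ locHom K Q b ∈ maxSub K Q := by
  obtain ⟨⟨a, s⟩, hb⟩ := IsLocalization.surj Q.asIdeal.primeCompl b
  have hs : toResidue P Q L s ≠ 0 := fun h => s.2 ((toResidue_eq_zero_iff hQP _).1 h)
  have h1 := congrArg (residueHom hQP L) hb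
  have h2 := congrArg (locHom K Q) hb
  simp only [map_mul, residueHom_algebraMap, locHom_algebraMap] at h1 h2
  rw [← mul_eq_zero_iff_right hs, h1, toResidue_eq_zero_iff hQP, ← algebraMap_mem_maxSub (K := K),
    ← h2]
  refine ⟨fun h => maxSub_saturated s.2 (by rwa [mul_comm]), fun h => ?_⟩
  rw [mul_comm]
  exact mul_mem_of_mem _ h

theorem residueHom_of_locHom_eq {b : locRing D Q.asIdeal Q.2} {r : locRing D P.asIdeal P.2}
    (h : locHom K Q b = locHom K P r) :
    residueHom hQP L b = algebraMap (Zring D P.asIdeal Q.asIdeal P.2) L (Ideal.Quotient.mk _ r) := by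
  obtain ⟨⟨a, s⟩, hr⟩ := IsLocalization.surj P.asIdeal.primeCompl r
  have hs : toResidue P Q L s ≠ 0 := fun h => s.2 (hQP.le ((toResidue_eq_zero_iff hQP _).1 h))
  have h1 := congrArg (locHom K P) hr
  rw [map_mul, locHom_algebraMap, locHom_algebraMap, ← h, mul_comm, mul_locHom_eq_iff] at h1
  have h2 := congrArg (residueHom hQP L) h1
  rw [map_mul, residueHom_algebraMap, residueHom_algebraMap] at h2
  apply mul_left_cancel₀ hs
  rw [h2, mul_comm]
  have h3 := congrArg (fun x => algebraMap (Zring D P.asIdeal Q.asIdeal P.2) L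
    (Ideal.Quotient.mk _ x)) hr
  simp only [map_mul] at h3
  exact h3.symm

variable (K) in
theorem residueHom_mem_range_iff (hp : IsPrufer D K) (b : locRing D Q.asIdeal Q.2) :
    (∃ z, algebraMap (Zring D P.asIdeal Q.asIdeal P.2) L z = residueHom hQP L b) ↔
      locHom K Q b ∈ locSub K P := by
  constructor
  · rintro ⟨z, hz⟩
    obtain ⟨r, rfl⟩ := Ideal.Quotient.mk_surjective z
    have hr : locHom K P r ∈ locSub K P := mem_locSub_iff_exists_locHom.2 ⟨r, rfl⟩
    obtain ⟨b', hb'⟩ := mem_locSub_iff_exists_locHom.1 (locSub_anti hQP.le hr)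
    rw [← residueHom_of_locHom_eq hQP hb', eq_comm, ← sub_eq_zero, ← map_sub,
      residueHom_eq_zero_iff (K := K), map_sub, hb'] at hz
    have := add_mem (maxSub_le_locSub P (hp.maxSub_mono hQP.le hz)) hr
    rwa [sub_add_cancel] at this
  · intro h
    obtain ⟨r, hr⟩ := mem_locSub_iff_exists_locHom.1 h
    exact ⟨_, (residueHom_of_locHom_eq hQP hr.symm).symm⟩

theorem residueHom_surjective : Function.Surjective (residueHom hQP L) := by
  have := isDomain_Zring hQP
  have aux : ∀ z, ∃ b, residueHom hQP L b = algebraMap (Zring D P.asIdeal Q.asIdeal P.2) L z := by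
    intro z
    obtain ⟨r, rfl⟩ := Ideal.Quotient.mk_surjective z
    have hr : locHom (FractionRing D) P r ∈ locSub (FractionRing D) P :=
      mem_locSub_iff_exists_locHom.2 ⟨r, rfl⟩
    obtain ⟨b, hb⟩ := mem_locSub_iff_exists_locHom.1 (locSub_anti hQP.le hr)
    exact ⟨b, residueHom_of_locHom_eq hQP hb⟩
  intro l
  obtain ⟨x, y, hy, rfl⟩ := IsFractionRing.div_surjective
    (A := Zring D P.asIdeal Q.asIdeal P.2) l
  obtain ⟨b, hb⟩ := aux x
  obtain ⟨c, hc⟩ := aux y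
  have hc0 : residueHom hQP L c ≠ 0 := by
    rw [hc]
    exact IsFractionRing.to_map_ne_zero_of_mem_nonZeroDivisors hy
  have hc1 : locHom (FractionRing D) Q c ∉ maxSub (FractionRing D) Q := fun h =>
    hc0 ((residueHom_eq_zero_iff hQP c).2 h)
  obtain ⟨d, hd⟩ := mem_locSub_iff_exists_locHom.1
    (inv_mem_locSub (mem_locSub_iff_exists_locHom.2 ⟨c, rfl⟩) hc1)
  have hcd : c * d = 1 := by
    apply locHom_injective (K := FractionRing D) Q
    rw [map_mul, hd, map_one, mul_inv_cancel₀ (ne_zero_of_notMem_maxSub hc1)]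
  refine ⟨b * d, ?_⟩
  rw [map_mul, hb, ← hc, eq_div_iff hc0, mul_assoc, mul_comm _ (residueHom hQP L c), ← map_mul, hcd,
    map_one, mul_one]

variable (K) in
/-- The `D`-submodule of `D_Q` corresponding to a submodule of the residue field. -/
def residueImage (J : Submodule (Zring D P.asIdeal Q.asIdeal P.2) L) : Submodule D K where
  carrier := {x | ∃ b, locHom K Q b = x ∧ residueHom hQP L b ∈ J}
  zero_mem' := ⟨0, by simp, by simp⟩
  add_mem' := by
    rintro x y ⟨b, rfl, hb⟩ ⟨c, rfl, hc⟩
    exact ⟨b + c, map_add _ _ _, by simpa using add_mem hb hc⟩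
  smul_mem' := by
    rintro a x ⟨b, rfl, hb⟩
    refine ⟨algebraMap D _ a * b, by rw [map_mul, locHom_algebraMap, Algebra.smul_def], ?_⟩
    rw [map_mul, residueHom_algebraMap]
    simpa [toResidue, Algebra.smul_def] using J.smul_mem (Ideal.Quotient.mk _ (algebraMap D _ a)) hb

theorem locHom_mem_residueImage {J : Submodule (Zring D P.asIdeal Q.asIdeal P.2) L}
    {b : locRing D Q.asIdeal Q.2} :
    locHom K Q b ∈ residueImage hQP K J ↔ residueHom hQP L b ∈ J :=
  ⟨fun ⟨_, h, h'⟩ => locHom_injective Q h ▸ h', fun h => ⟨b, rfl, h⟩⟩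

theorem isMod_residueImage {J : Submodule (Zring D P.asIdeal Q.asIdeal P.2) L} (hJ : J ≠ ⊥) :
    IsMod Q (P.asIdeal : Set D)ᶜ (residueImage hQP K J) where
  lt := by
    refine lt_of_le_of_ne (fun x hx => ?_) fun h => hJ ?_
    · obtain ⟨b, rfl⟩ := mem_locSub_iff_exists_locHom.1 (maxSub_le_locSub _ hx)
      exact ⟨b, rfl, by simp [(residueHom_eq_zero_iff hQP b).2 hx]⟩
    · rw [Submodule.eq_bot_iff]
      intro l hl
      obtain ⟨b, rfl⟩ := residueHom_surjective hQP l
      rw [residueHom_eq_zero_iff (K := K), h]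
      exact ⟨b, rfl, hl⟩
  le := by
    rintro x ⟨b, rfl, -⟩
    exact mem_locSub_iff_exists_locHom.2 ⟨b, rfl⟩
  sat s hs hsQ x hx := by
    obtain ⟨c, hc, hc'⟩ := hx
    have hx : x ∈ locSub K Q :=
      locSub_saturated hsQ (hc ▸ mem_locSub_iff_exists_locHom.2 ⟨c, rfl⟩)
    obtain ⟨b, rfl⟩ := mem_locSub_iff_exists_locHom.1 hx
    refine ⟨b, rfl, ?_⟩
    rw [eq_comm, ← locHom_algebraMap Q, ← map_mul, (locHom_injective Q).eq_iff] at hc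
    rw [← hc, map_mul, residueHom_algebraMap] at hc'
    have hs' : s ∈ P.asIdeal.primeCompl := hs
    have h1 := IsLocalization.mk'_spec' (locRing D P.asIdeal P.2) 1 (⟨s, hs'⟩ : P.asIdeal.primeCompl)
    have h2 := J.smul_mem (Ideal.Quotient.mk _ (IsLocalization.mk' (locRing D P.asIdeal P.2) 1
      (⟨s, hs'⟩ : P.asIdeal.primeCompl))) hc'
    rw [Algebra.smul_def, ← mul_assoc] at h2
    have h3 := congrArg (fun x => algebraMap (Zring D P.asIdeal Q.asIdeal P.2) L
      (Ideal.Quotient.mk _ x)) h1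
    simp only [map_mul, map_one] at h3
    rwa [toResidue, RingHom.comp_apply, RingHom.comp_apply, mul_comm (algebraMap _ L _), h3,
      one_mul] at h2

variable (L) in
/-- The submodule of the residue field corresponding to a module below `D_Q`. -/
def residuePreimage (I : Mod K Q (P.asIdeal : Set D)ᶜ) :
    Submodule (Zring D P.asIdeal Q.asIdeal P.2) L where
  carrier := {l | ∃ b, residueHom hQP L b = l ∧ locHom K Q b ∈ I.1}
  zero_mem' := ⟨0, by simp, by simp⟩
  add_mem' := by
    rintro x y ⟨b, rfl, hb⟩ ⟨c, rfl, hc⟩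
    exact ⟨b + c, map_add _ _ _, by simpa using add_mem hb hc⟩
  smul_mem' := by
    rintro a x ⟨b, rfl, hb⟩
    obtain ⟨r, rfl⟩ := Ideal.Quotient.mk_surjective a
    have hr : locHom K P r ∈ locSub K P := mem_locSub_iff_exists_locHom.2 ⟨r, rfl⟩
    obtain ⟨c, hc⟩ := mem_locSub_iff_exists_locHom.1 (locSub_anti hQP.le hr)
    refine ⟨c * b, by rw [map_mul, residueHom_of_locHom_eq hQP hc, Algebra.smul_def], ?_⟩
    rw [map_mul]
    exact locSub_mul_mem (fun s hs => I.2.sat s hs fun h => hs (hQP.le h)) (hc ▸ hr) hb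

theorem residueHom_mem_residuePreimage {I : Mod K Q (P.asIdeal : Set D)ᶜ}
    {b : locRing D Q.asIdeal Q.2} :
    residueHom hQP L b ∈ residuePreimage hQP L I ↔ locHom K Q b ∈ I.1 := by
  refine ⟨?_, fun h => ⟨b, rfl, h⟩⟩
  rintro ⟨c, h, hc⟩
  rw [← sub_eq_zero, ← map_sub, residueHom_eq_zero_iff (K := K), map_sub] at h
  simpa using sub_mem hc (I.2.lt.le h)

theorem residuePreimage_ne_bot (I : Mod K Q (P.asIdeal : Set D)ᶜ) :
    residuePreimage hQP L I ≠ ⊥ := by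
  obtain ⟨y, hy, hy', hy''⟩ := I.2.exists_mem
  obtain ⟨b, rfl⟩ := mem_locSub_iff_exists_locHom.1 hy'
  intro h
  have h1 := (residueHom_mem_residuePreimage hQP (L := L)).2 hy
  rw [h, Submodule.mem_bot, residueHom_eq_zero_iff (K := K)] at h1
  exact hy'' h1

/-- Modules different from `D_Q` lie in a translate of `D_P`. -/
theorem Mod.exists_le_act_loc (hp : IsPrufer D K) {I : Mod K Q (P.asIdeal : Set D)ᶜ} (hI : I ≠ ⊤) :
    ∃ g, I ≤ act K Q _ g (Mod.loc hp hQP) := by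
  obtain ⟨y, hyQ, hyI⟩ := SetLike.exists_of_lt
    (lt_of_le_of_ne I.2.le fun h => hI (Subtype.ext h))
  refine ⟨⟨y, hyQ, fun h => hyI (I.2.lt.le h)⟩, fun x hx => ?_⟩
  have hy0 : y ≠ 0 := fun h => hyI (h ▸ zero_mem _)
  rw [coe_act, mem_scale]
  change y⁻¹ * x ∈ locSub K P
  by_contra h
  have h1 := maxSub_le_locSub _ (hp.inv_mem_maxSub h)
  have hx0 : x ≠ 0 := by
    rintro rfl
    simp at h
  have h2 := locSub_mul_mem (fun s hs => I.2.sat s hs fun h => hs (hQP.le h)) h1 hx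
  rw [mul_inv, inv_inv, mul_assoc, inv_mul_cancel₀ hx0, mul_one] at h2
  exact hyI h2

theorem Mod.exists_act_loc_le (hp : IsPrufer D K) (I : Mod K Q (P.asIdeal : Set D)ᶜ) :
    ∃ g, act K Q _ g (Mod.loc hp hQP) ≤ I := by
  obtain ⟨y, hy, hy', hy''⟩ := I.2.exists_mem
  refine ⟨⟨y, hy', hy''⟩, fun x hx => ?_⟩
  have h2 := locSub_mul_mem (fun s hs => I.2.sat s hs fun h => hs (hQP.le h)) (mem_scale.1 hx) hy
  change y⁻¹ * x * y ∈ I.1 at h2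
  rwa [mul_right_comm, inv_mul_cancel₀ (ne_zero_of_notMem_maxSub hy''), one_mul] at h2

include hQP in
theorem Mod.exists_le_act (hp : IsPrufer D K) (I J : Mod K Q (P.asIdeal : Set D)ᶜ) (hI : I ≠ ⊤) :
    ∃ g, I ≤ act K Q _ g J := by
  obtain ⟨g, hg⟩ := Mod.exists_le_act_loc hQP hp hI
  obtain ⟨h, hh⟩ := Mod.exists_act_loc_le hQP hp J
  refine ⟨g.mul h.inv, hg.trans fun x hx => ?_⟩
  rw [coe_act, mem_scale] at hx ⊢
  apply hh
  rw [coe_act, mem_scale]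
  change h.1⁻¹ * ((g.1 * h.1⁻¹)⁻¹ * x) ∈ _
  rwa [mul_inv, inv_inv, ← mul_assoc, mul_left_comm, inv_mul_cancel₀ h.ne_zero, mul_one]

theorem Mod.loc_ne_top (hp : IsPrufer D K) : Mod.loc hp hQP ≠ ⊤ := by
  intro h
  obtain ⟨p, hp1, hp2⟩ := SetLike.exists_of_lt (show Q.asIdeal < P.asIdeal from hQP)
  have hp0 := algebraMap_ne_zero_of_notMem (K := K) hp2
  have h1 : (algebraMap D K p)⁻¹ ∈ locSub K Q := ⟨1, p, hp2, by simp [hp0]⟩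
  rw [← show locSub K P = locSub K Q from congrArg Subtype.val h] at h1
  exact inv_notMem_locSub (algebraMap_mem_maxSub.2 hp1) hp0 h1

theorem residueImage_ne_locSub (hp : IsPrufer D K)
    (J : FractionalIdeal (nonZeroDivisors (Zring D P.asIdeal Q.asIdeal P.2)) L) :
    residueImage hQP K (J : Submodule (Zring D P.asIdeal Q.asIdeal P.2) L) ≠ locSub K Q := by
  intro h
  have htop : ∀ l : L, l ∈ J := by
    intro l
    obtain ⟨b, rfl⟩ := residueHom_surjective hQP l
    rw [← FractionalIdeal.mem_coe, ← locHom_mem_residueImage (K := K), h]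
    exact mem_locSub_iff_exists_locHom.2 ⟨b, rfl⟩
  have := isDomain_Zring hQP
  obtain ⟨a, ha, haJ⟩ := J.2
  have ha0 : algebraMap (Zring D P.asIdeal Q.asIdeal P.2) L a ≠ 0 :=
    IsFractionRing.to_map_ne_zero_of_mem_nonZeroDivisors ha
  apply Mod.loc_ne_top hQP hp
  refine top_le_iff.1 fun x hx => ?_
  obtain ⟨b, rfl⟩ := mem_locSub_iff_exists_locHom.1 (show x ∈ locSub K Q from hx)
  have hb := haJ ((algebraMap _ L a)⁻¹ * residueHom hQP L b) (htop _)
  rw [Algebra.smul_def, mul_inv_cancel_left₀ ha0] at hb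
  exact (residueHom_mem_range_iff hQP K hp b).1 hb

theorem isFractional_residuePreimage (hp : IsPrufer D K) {I : Mod K Q (P.asIdeal : Set D)ᶜ}
    (hI : I ≠ ⊤) : IsFractional (nonZeroDivisors (Zring D P.asIdeal Q.asIdeal P.2))
      (residuePreimage hQP L I) := by
  have := isDomain_Zring hQP
  obtain ⟨g, hg⟩ := Mod.exists_le_act_loc hQP hp hI
  obtain ⟨b, hb⟩ := mem_locSub_iff_exists_locHom.1 g.2.1
  obtain ⟨c, hc⟩ := mem_locSub_iff_exists_locHom.1 g.inv.2.1
  refine FractionalIdeal.isFractional_of_le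
    (J := FractionalIdeal.spanSingleton _ (residueHom hQP L b)) ?_
  rintro _ ⟨d, rfl, hd⟩
  rw [FractionalIdeal.mem_coe, FractionalIdeal.mem_spanSingleton]
  obtain ⟨z, hz⟩ := (residueHom_mem_range_iff (L := L) hQP K hp (c * d)).2 (by
    rw [map_mul, hc]
    exact hg hd)
  refine ⟨z, ?_⟩
  rw [Algebra.smul_def, hz, ← map_mul]
  congr 1
  apply locHom_injective (K := K)
  rw [map_mul, map_mul, hc, hb, mul_right_comm, show g.inv.1 = g.1⁻¹ from rfl,
    inv_mul_cancel₀ g.ne_zero, one_mul]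

variable (L) in
/-- Nonzero fractional ideals of `Z(P)` correspond to the proper modules below `D_Q`. -/
def fractionalIdealIso (hp : IsPrufer D K) :
    {J : FractionalIdeal (nonZeroDivisors (Zring D P.asIdeal Q.asIdeal P.2)) L // J ≠ ⊥} ≃o
      {I : Mod K Q (P.asIdeal : Set D)ᶜ // I ≠ ⊤} where
  toFun J := ⟨⟨residueImage hQP K (J.1 : Submodule (Zring D P.asIdeal Q.asIdeal P.2) L),
    isMod_residueImage hQP fun h => J.2 (FractionalIdeal.coeToSubmodule_eq_bot.1 h)⟩,
    fun h => residueImage_ne_locSub hQP hp J.1 (congrArg Subtype.val h)⟩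
  invFun I := ⟨⟨residuePreimage hQP L I.1, isFractional_residuePreimage hQP hp I.2⟩,
    fun h => residuePreimage_ne_bot hQP I.1
    (FractionalIdeal.coeToSubmodule_eq_bot.2 h)⟩
  left_inv J := by
    apply Subtype.ext
    ext l
    obtain ⟨b, rfl⟩ := residueHom_surjective hQP l
    exact (residueHom_mem_residuePreimage hQP).trans (locHom_mem_residueImage hQP)
  right_inv I := by
    apply Subtype.ext
    apply Subtype.ext
    ext x
    constructor
    · rintro ⟨b, rfl, hb⟩
      exact (residueHom_mem_residuePreimage hQP).1 hb
    · intro hx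
      obtain ⟨b, rfl⟩ := mem_locSub_iff_exists_locHom.1 (I.1.2.le hx)
      exact ⟨b, rfl, (residueHom_mem_residuePreimage hQP).2 hx⟩
  map_rel_iff' {J J'} := by
    constructor
    · intro h l hl
      obtain ⟨b, rfl⟩ := residueHom_surjective hQP l
      exact (locHom_mem_residueImage hQP).1 (h ((locHom_mem_residueImage hQP (K := K)).2 hl))
    · rintro h x ⟨b, rfl, hb⟩
      exact ⟨b, rfl, h hb⟩

end Residue

/-- Multiplication by a nonzero element on fractional ideals. -/
def fractionalAct (R L : Type*) [CommRing R] [Field L] [Algebra R L] [IsFractionRing R L]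
    (x : {x : L // x ≠ 0}) :
    FractionalIdeal (nonZeroDivisors R) L ≃o FractionalIdeal (nonZeroDivisors R) L where
  toFun J := FractionalIdeal.spanSingleton _ x.1 * J
  invFun J := FractionalIdeal.spanSingleton _ x.1⁻¹ * J
  left_inv J := by
    dsimp only
    rw [← mul_assoc, FractionalIdeal.spanSingleton_mul_spanSingleton, inv_mul_cancel₀ x.2,
      FractionalIdeal.spanSingleton_one, one_mul]
  right_inv J := by
    dsimp only
    rw [← mul_assoc, FractionalIdeal.spanSingleton_mul_spanSingleton, mul_inv_cancel₀ x.2,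
      FractionalIdeal.spanSingleton_one, one_mul]
  map_rel_iff' {J J'} := by
    refine ⟨fun h y hy => ?_, fun h => mul_le_mul_right h _⟩
    obtain ⟨z, hz, h'⟩ := FractionalIdeal.mem_singleton_mul.1
      (h (FractionalIdeal.mem_singleton_mul.2 ⟨y, hy, rfl⟩))
    rwa [mul_left_cancel₀ x.2 h']

theorem mem_fractionalAct {R L : Type*} [CommRing R] [Field L] [Algebra R L] [IsFractionRing R L]
    (x : {x : L // x ≠ 0}) (J : FractionalIdeal (nonZeroDivisors R) L) (y : L) :
    y ∈ fractionalAct R L x J ↔ x.1⁻¹ * y ∈ J := by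
  refine FractionalIdeal.mem_singleton_mul.trans ⟨?_, fun h => ⟨_, h, ?_⟩⟩
  · rintro ⟨z, hz, rfl⟩
    rwa [inv_mul_cancel_left₀ x.2]
  · rw [mul_inv_cancel_left₀ x.2]

theorem residueImage_fractionalAct {D : Type*} [CommRing D] [IsDomain D] {P Q : PrimeSpectrum D}
    (hQP : Q < P) {L : Type*} [Field L] [Algebra (Zring D P.asIdeal Q.asIdeal P.2) L]
    [IsFractionRing (Zring D P.asIdeal Q.asIdeal P.2) L]
    {K : Type*} [Field K] [Algebra D K] [IsFractionRing D K] (x : {x : L // x ≠ 0})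
    (g : LocUnit K Q) {b : locRing D Q.asIdeal Q.2} (hx : residueHom hQP L b = x)
    (hg : locHom K Q b = g)
    (J : FractionalIdeal (nonZeroDivisors (Zring D P.asIdeal Q.asIdeal P.2)) L) :
    residueImage hQP K (fractionalAct _ L x J : Submodule (Zring D P.asIdeal Q.asIdeal P.2) L) =
      scale g.1 (residueImage hQP K (J : Submodule (Zring D P.asIdeal Q.asIdeal P.2) L)) := by
  obtain ⟨c, hc⟩ := mem_locSub_iff_exists_locHom.1 g.inv.2.1
  change locHom K Q c = g.1⁻¹ at hc
  have hbc : b * c = 1 := by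
    apply locHom_injective (K := K)
    rw [map_mul, hg, hc, mul_inv_cancel₀ g.ne_zero, map_one]
  have hcx : residueHom hQP L c = x.1⁻¹ := by
    rw [← mul_left_inj' x.2, inv_mul_cancel₀ x.2, ← hx, ← map_mul, mul_comm, hbc, map_one]
  have key : ∀ d, locHom K Q d ∈ residueImage hQP K
      (fractionalAct _ L x J : Submodule (Zring D P.asIdeal Q.asIdeal P.2) L) ↔
      locHom K Q d ∈ scale g.1
        (residueImage hQP K (J : Submodule (Zring D P.asIdeal Q.asIdeal P.2) L)) := by
    intro d
    rw [locHom_mem_residueImage, FractionalIdeal.mem_coe, mem_fractionalAct, mem_scale, ← hc,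
      ← map_mul, locHom_mem_residueImage, FractionalIdeal.mem_coe, map_mul, hcx]
  ext y
  constructor
  · rintro ⟨d, rfl, hd⟩
    exact (key d).1 ⟨d, rfl, hd⟩
  · intro hy
    obtain ⟨d, hd, -⟩ := mem_scale.1 hy
    have hy' : y = locHom K Q (b * d) := by
      rw [map_mul, hd, hg, mul_inv_cancel_left₀ g.ne_zero]
    rw [hy'] at hy ⊢
    exact (key _).2 hy

/-- Restrict an order automorphism to the complement of an invariant element. -/
def neRestrict {Y : Type*} [PartialOrder Y] {a : Y} (f : Y ≃o Y) (h : f a = a) :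
    {y : Y // y ≠ a} ≃o {y : Y // y ≠ a} :=
  subtypeOrderIso f fun _ => not_congr ⟨fun hy => hy ▸ h, fun hy => f.injective (hy.trans h.symm)⟩

/-- Abstract fractional star operations as equivariant closures. -/
def aFracStarIso (R : Type*) [CommRing R] [IsDomain R] :
    AFracStar R ≃o EquivClosure (fractionalAct R (FractionRing R)) where
  toFun f := ⟨f.toFun, f.le_star', f.mono', f.idem', fun x => f.smul' x.1 x.2⟩
  invFun c := ⟨c, c.le_closure, fun _ _ => c.mono, c.idem, fun x hx => c.comm ⟨x, hx⟩⟩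
  left_inv _ := rfl
  right_inv _ := rfl
  map_rel_iff' := Iff.rfl

section Bridge

variable {D : Type*} [CommRing D] [IsDomain D] {P Q : PrimeSpectrum D} (hQP : Q < P)
variable {K : Type*} [Field K] [Algebra D K] [IsFractionRing D K] (hp : IsPrufer D K)

include hQP hp in
theorem fractional_closure_bot (L : Type*) [Field L] [Algebra (Zring D P.asIdeal Q.asIdeal P.2) L]
    [IsFractionRing (Zring D P.asIdeal Q.asIdeal P.2) L]
    (c : EquivClosure (fractionalAct (Zring D P.asIdeal Q.asIdeal P.2) L)) : c ⊥ = ⊥ := by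
  by_contra h
  apply residueImage_ne_locSub hQP hp (c ⊥)
  refine le_antisymm (isMod_residueImage hQP fun h' => h
    (FractionalIdeal.coeToSubmodule_eq_bot.1 h')).le fun x hx => ?_
  obtain ⟨b, rfl⟩ := mem_locSub_iff_exists_locHom.1 hx
  rw [locHom_mem_residueImage, FractionalIdeal.mem_coe]
  obtain ⟨l, hl, hl0⟩ := Submodule.exists_mem_ne_zero_of_ne_bot
    (fun h' => h (FractionalIdeal.coeToSubmodule_eq_bot.1 h') :
      (c ⊥ : Submodule (Zring D P.asIdeal Q.asIdeal P.2) L) ≠ ⊥)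
  by_cases hb : residueHom hQP L b = 0
  · rw [hb]
    exact zero_mem (c ⊥ : Submodule (Zring D P.asIdeal Q.asIdeal P.2) L)
  · have h1 := c.comm ⟨_, mul_ne_zero hb (inv_ne_zero hl0)⟩ ⊥
    rw [map_bot] at h1
    rw [h1, mem_fractionalAct, mul_inv, inv_inv, mul_right_comm, inv_mul_cancel₀ hb, one_mul]
    exact hl

/-- Fractional star operations on `Z(P)` as closures on the modules below `D_Q`. -/
def zBridge : AFracStar (Zring D P.asIdeal Q.asIdeal P.2) ≃o
    {b : EquivClosure (act K Q (P.asIdeal : Set D)ᶜ) // b ≠ ⊤} :=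
  have := isDomain_Zring hQP
  (aFracStarIso _).trans <|
  (EquivClosure.neBotIso (fractional_closure_bot hQP hp _) (fun x => neRestrict (fractionalAct _ _ x)
    (map_bot _)) fun _ _ => rfl).trans <|
  (EquivClosure.congr (fractionalIdealIso hQP _ hp) (fun x => by
      obtain ⟨b, hb⟩ := residueHom_surjective hQP x.1
      have hb' : locHom K Q b ∉ maxSub K Q := fun h => x.2 (by
        rw [← hb, (residueHom_eq_zero_iff hQP b).2 h])
      exact ⟨⟨locHom K Q b, mem_locSub_iff_exists_locHom.2 ⟨b, rfl⟩, hb'⟩, fun J =>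
        Subtype.ext <| Subtype.ext <| residueImage_fractionalAct hQP x _ hb rfl J.1⟩) (fun g => by
      obtain ⟨b, hb⟩ := mem_locSub_iff_exists_locHom.1 g.2.1
      exact ⟨⟨residueHom hQP _ b, fun h =>
        g.2.2 (hb ▸ (residueHom_eq_zero_iff hQP b).1 h)⟩, fun J =>
        Subtype.ext <| Subtype.ext <| residueImage_fractionalAct hQP _ g rfl hb J.1⟩)).trans
  (EquivClosure.neTopIso (fun I J hI _ => Mod.exists_le_act hQP hp I J hI)
    ⟨_, Mod.loc_ne_top hQP hp⟩ (fun g => neRestrict (act K Q _ g) (map_top _)) fun _ _ => rfl).symm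

include hQP hp in
theorem nonempty_lowerIso {D' : Type*} [CommRing D'] [IsDomain D'] {P' Q' : PrimeSpectrum D'}
    (hQP' : Q' < P') {K' : Type*} [Field K'] [Algebra D' K'] [IsFractionRing D' K']
    (hp' : IsPrufer D' K') (h : Nonempty (AFracStar (Zring D P.asIdeal Q.asIdeal P.2) ≃o
      AFracStar (Zring D' P'.asIdeal Q'.asIdeal P'.2))) :
    Nonempty (EquivClosure (act K Q (P.asIdeal : Set D)ᶜ) ≃o
      EquivClosure (act K' Q' (P'.asIdeal : Set D')ᶜ)) :=
  h.map fun e => orderIsoOfNeTop ((zBridge hQP hp).symm.trans (e.trans (zBridge hQP' hp')))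

end Bridge

end Paper

namespace Paper

section Tree

variable {D : Type*} [CommRing D] [IsDomain D]

/-- The primes `p i` are pairwise independent over `P`, and every maximal ideal strictly
above `P` lies over one of them. -/
structure IsFan {ι : Type*} (P : PrimeSpectrum D) (p : ι → PrimeSpectrum D) : Prop where
  lt : ∀ i, P < p i
  exists_le : ∀ M : PrimeSpectrum D, M.asIdeal.IsMaximal → P < M → ∃ i, p i ≤ M
  le_of_le : ∀ i j, i ≠ j → ∀ N : PrimeSpectrum D, N ≤ p i → N ≤ p j → N ≤ P

variable {K : Type*} [Field K] [Algebra D K] [IsFractionRing D K]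
variable (hp : IsPrufer D K)

include hp in
theorem IsBranchPoint.le_of_forall_maximal {P : Ideal D} (hB : IsBranchPoint D P)
    {R : PrimeSpectrum D}
    (h : ∀ M : Ideal D, M.IsMaximal → P ≤ M → R.asIdeal ≤ M) : R.asIdeal ≤ P := by
  obtain ⟨S, hS, hinc, hPS, hle, hinf⟩ := hB
  have hcomp : ∀ Q ∈ S, R.asIdeal ≤ Q ∨ Q ≤ R.asIdeal := by
    intro Q hQ
    obtain ⟨M, hM, hQM⟩ := Ideal.exists_le_maximal Q (hS Q hQ).ne_top
    exact hp.le_total (N₁ := R) (N₂ := ⟨Q, hS Q hQ⟩) (M := ⟨M, hM.isPrime⟩)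
      (h M hM ((hle Q hQ).trans hQM)) hQM
  by_cases hR : ∀ Q ∈ S, R.asIdeal ≤ Q
  · exact hinf _ R.2 hR
  · push Not at hR
    obtain ⟨Q, hQ, hRQ⟩ := hR
    have hQR := (hcomp Q hQ).resolve_left hRQ
    exfalso
    have hQP : Q ≤ P := by
      refine hinf Q (hS Q hQ) fun Q' hQ' => ?_
      by_cases hQQ' : Q = Q'
      · exact hQQ'.le
      · have hne := hinc hQ hQ' hQQ'
        rcases hcomp Q' hQ' with h1 | h1
        · exact hQR.trans h1
        · obtain ⟨M, hM, hRM⟩ := Ideal.exists_le_maximal _ R.2.ne_top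
          exact absurd (hp.le_total (N₁ := ⟨Q, hS Q hQ⟩) (N₂ := ⟨Q', hS Q' hQ'⟩)
            (M := ⟨M, hM.isPrime⟩) (hQR.trans hRM) (h1.trans hRM)) (not_or.2 hne)
    exact hPS (le_antisymm hQP (hle Q hQ) ▸ hQ)

include hp in
theorem IsPrufer.finite_hiSpec (hsl : IsSemilocal D) : (hiSpec D).Finite := by
  have hfin : {P : Ideal D | P.IsPrime ∧ IsBranchPoint D P}.Finite := by
    refine Set.Finite.of_finite_image
      (f := fun P : Ideal D => {M : Ideal D | M.IsMaximal ∧ P ≤ M}) ?_ ?_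
    · refine (hsl.finite_subsets).subset ?_
      rintro _ ⟨P, -, rfl⟩ M hM
      exact hM.1
    · rintro P ⟨hP, hPB⟩ R ⟨hR, hRB⟩ h
      have h' : ∀ M : Ideal D, M.IsMaximal → (P ≤ M ↔ R ≤ M) := fun M hM =>
        ⟨fun h1 => ((Set.ext_iff.1 h M).1 ⟨hM, h1⟩).2, fun h1 => ((Set.ext_iff.1 h M).2 ⟨hM, h1⟩).2⟩
      obtain ⟨M, hM, hPM⟩ := Ideal.exists_le_maximal P hP.ne_top
      rcases hp.le_total (N₁ := ⟨P, hP⟩) (N₂ := ⟨R, hR⟩) (M := ⟨M, hM.isPrime⟩) hPM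
        ((h' M hM).1 hPM) with h1 | h1
      · exact le_antisymm h1 (hPB.le_of_forall_maximal (R := ⟨R, hR⟩) hp
          fun M hM => (h' M hM).1)
      · exact le_antisymm (hRB.le_of_forall_maximal (R := ⟨P, hP⟩) hp
          fun M hM => (h' M hM).2) h1
  refine ((Set.finite_singleton ⊥).union (hsl.union hfin)).subset ?_
  rintro P ⟨hP, rfl | hM | hB⟩
  · exact Or.inl rfl
  · exact Or.inr (Or.inl hM)
  · exact Or.inr (Or.inr ⟨hP, hB⟩)

include hp in
/-- Among the primes contained in two given primes there is a largest one. -/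
theorem IsPrufer.exists_isGreatest (P₁ P₂ : PrimeSpectrum D) :
    ∃ R : PrimeSpectrum D, R ≤ P₁ ∧ R ≤ P₂ ∧ ∀ N, N ≤ P₁ → N ≤ P₂ → N ≤ R := by
  let C : Set (Ideal D) := {N | N.IsPrime ∧ N ≤ P₁.asIdeal ∧ N ≤ P₂.asIdeal}
  have hne : C.Nonempty := ⟨⊥, Ideal.isPrime_bot, bot_le, bot_le⟩
  have hdir : DirectedOn (· ≤ ·) C := by
    intro N hN N' hN'
    rcases hp.le_total (N₁ := ⟨N, hN.1⟩) (N₂ := ⟨N', hN'.1⟩) (M := P₁) hN.2.1 hN'.2.1 with h | h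
    · exact ⟨N', hN', h, le_rfl⟩
    · exact ⟨N, hN, le_rfl, h⟩
  have hmem : ∀ x, x ∈ sSup C ↔ ∃ N ∈ C, x ∈ N := fun x => Submodule.mem_sSup_of_directed hne hdir
  have hprime : (sSup C).IsPrime := by
    refine ⟨fun h => ?_, fun {x y} h => ?_⟩
    · obtain ⟨N, hN, h1⟩ := (hmem 1).1 (h ▸ Submodule.mem_top)
      exact hN.1.one_notMem h1
    · obtain ⟨N, hN, h1⟩ := (hmem _).1 h
      exact (hN.1.mem_or_mem h1).imp (fun h2 => (hmem x).2 ⟨N, hN, h2⟩)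
        fun h2 => (hmem y).2 ⟨N, hN, h2⟩
  exact ⟨⟨sSup C, hprime⟩, show sSup C ≤ P₁.asIdeal from sSup_le fun N hN => hN.2.1,
    show sSup C ≤ P₂.asIdeal from sSup_le fun N hN => hN.2.2,
    fun N h₁ h₂ => le_sSup (show N.asIdeal ∈ C from ⟨N.2, h₁, h₂⟩)⟩

theorem isBranchPoint_of_isGreatest {P₁ P₂ R : PrimeSpectrum D} (h₁₂ : ¬ P₁ ≤ P₂) (h₂₁ : ¬ P₂ ≤ P₁)
    (h₁ : R ≤ P₁) (h₂ : R ≤ P₂) (h : ∀ N, N ≤ P₁ → N ≤ P₂ → N ≤ R) :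
    IsBranchPoint D R.asIdeal := by
  refine ⟨{P₁.asIdeal, P₂.asIdeal}, ?_, ?_, ?_, ?_, ?_⟩
  · rintro _ (rfl | rfl)
    exacts [P₁.2, P₂.2]
  · rintro _ (rfl | rfl) _ (rfl | rfl) hne
    exacts [absurd rfl hne, ⟨h₁₂, h₂₁⟩, ⟨h₂₁, h₁₂⟩, absurd rfl hne]
  · rintro (hR | hR)
    · exact h₁₂ (hR ▸ h₂ : P₁.asIdeal ≤ P₂.asIdeal)
    · exact h₂₁ ((show R.asIdeal = P₂.asIdeal from hR) ▸ h₁ : P₂.asIdeal ≤ P₁.asIdeal)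
  · rintro _ (rfl | rfl)
    exacts [h₁, h₂]
  · intro N hN hle
    exact h ⟨N, hN⟩ (hle _ (Or.inl rfl)) (hle _ (Or.inr rfl))

/-- An element of `hiSpec` as a point of the prime spectrum. -/
def hiPrime (P : hiSpec D) : PrimeSpectrum D := ⟨P.1, P.2.1⟩

theorem hiPrime_lt {P Q : hiSpec D} : hiPrime P < hiPrime Q ↔ P < Q := Iff.rfl

theorem isMin_hiSpec_iff {P : hiSpec D} : IsMin P ↔ P.1 = ⊥ := by
  refine ⟨fun h => ?_, fun h Q _ => show P.1 ≤ Q.1 from h ▸ bot_le⟩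
  exact le_bot_iff.1 (h (b := ⟨⊥, Ideal.isPrime_bot, Or.inl rfl⟩) (show ⊥ ≤ P.1 from bot_le))

theorem isMax_hiSpec_iff {P : hiSpec D} : IsMax P ↔ P.1.IsMaximal := by
  constructor
  · intro h
    obtain ⟨M, hM, hPM⟩ := Ideal.exists_le_maximal _ P.2.1.ne_top
    rw [le_antisymm hPM (h (b := ⟨M, maximal_mem_hiSpec hM⟩) hPM)]
    exact hM
  · exact fun h Q hPQ => (h.eq_of_le Q.2.1.ne_top hPQ).ge

theorem directlyBelow_iff_covBy {P Q : hiSpec D} : DirectlyBelow D Q.1 P.1 ↔ Q ⋖ P :=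
  ⟨fun h => ⟨h.2.2.1, fun R h₁ h₂ => h.2.2.2 R.1 R.2 h₁ h₂⟩,
    fun h => ⟨Q.2, P.2, h.1, fun R hR h₁ h₂ => h.2 (c := ⟨R, hR⟩) h₁ h₂⟩⟩

theorem not_le_of_covBy {P R R' : hiSpec D} (h : P ⋖ R) (h' : P ⋖ R') (hne : R ≠ R') : ¬ R ≤ R' :=
  fun hle => h'.2 h.1 (lt_of_le_of_ne hle hne)

include hp in
theorem IsPrufer.isFan (hsl : IsSemilocal D) (P : hiSpec D) :
    IsFan (hiPrime P) fun R : {R : hiSpec D // P ⋖ R} => hiPrime R.1 where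
  lt R := R.2.1
  exists_le M hM hPM := by
    have := (hp.finite_hiSpec hsl).to_subtype
    obtain ⟨R, hPR, hRM⟩ := exists_covBy_le_of_lt
      (show P < ⟨M.asIdeal, maximal_mem_hiSpec hM⟩ from hPM)
    exact ⟨⟨R, hPR⟩, hRM⟩
  le_of_le i j hij N hi hj := by
    have hne : i.1 ≠ j.1 := fun h => hij (Subtype.ext h)
    have h₁₂ := not_le_of_covBy i.2 j.2 hne
    have h₂₁ := not_le_of_covBy j.2 i.2 hne.symm
    obtain ⟨R, hRi, hRj, hR⟩ := hp.exists_isGreatest (hiPrime i.1) (hiPrime j.1)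
    have hRh : R.asIdeal ∈ hiSpec D :=
      ⟨R.2, Or.inr (Or.inr (isBranchPoint_of_isGreatest h₁₂ h₂₁ hRi hRj hR))⟩
    by_contra hNP
    have hPR : hiPrime P ≤ R := hR _ i.2.1.le j.2.1.le
    refine i.2.2 (c := ⟨R.asIdeal, hRh⟩)
      (lt_of_le_of_ne hPR fun h => hNP ((hR N hi hj).trans (congrArg Subtype.val h).ge))
      (lt_of_le_of_ne hRi fun h => h₁₂ ?_)
    rw [← h]
    exact hRj

theorem IsFan.comp_equiv {ι ι' : Type*} {P : PrimeSpectrum D} {p : ι → PrimeSpectrum D}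
    (h : IsFan P p) (e : ι' ≃ ι) : IsFan P (p ∘ e) where
  lt i := h.lt (e i)
  exists_le M hM hPM := by
    obtain ⟨i, hi⟩ := h.exists_le M hM hPM
    exact ⟨e.symm i, by simpa using hi⟩
  le_of_le i j hij := h.le_of_le _ _ (e.injective.ne hij)

end Tree

end Paper

namespace Paper

section Split

variable {D : Type*} [CommRing D] [IsDomain D]
variable {K : Type*} [Field K] [Algebra D K] [IsFractionRing D K]

/-- `away R` as a submonoid. -/
def awayMonoid (R : PrimeSpectrum D) : Submonoid D where
  carrier := away R
  one_mem' := one_mem_away R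
  mul_mem' := away_mul

/-- The localization of a module with respect to `away R`. -/
def locAway (R : PrimeSpectrum D) (I : Submodule D K) : Submodule D K where
  carrier := {x | ∃ s ∈ away R, algebraMap D K s * x ∈ I}
  zero_mem' := ⟨1, one_mem_away R, by simp⟩
  add_mem' := by
    rintro x y ⟨s, hs, hx⟩ ⟨t, ht, hy⟩
    refine ⟨s * t, away_mul hs ht, ?_⟩
    have := add_mem (mul_mem_of_mem t hx) (mul_mem_of_mem s hy)
    rwa [← mul_assoc, ← mul_assoc, ← map_mul, ← map_mul, mul_comm t, ← mul_add] at this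
  smul_mem' := by
    rintro c x ⟨s, hs, hx⟩
    refine ⟨s, hs, ?_⟩
    rw [Algebra.smul_def, mul_left_comm]
    exact mul_mem_of_mem c hx

theorem mem_locAway {R : PrimeSpectrum D} {I : Submodule D K} {x : K} :
    x ∈ locAway R I ↔ ∃ s ∈ away R, algebraMap D K s * x ∈ I := Iff.rfl

theorem le_locAway (R : PrimeSpectrum D) (I : Submodule D K) : I ≤ locAway R I :=
  fun x hx => ⟨1, one_mem_away R, by simpa using hx⟩

theorem locAway_mono (R : PrimeSpectrum D) {I J : Submodule D K} (h : I ≤ J) :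
    locAway R I ≤ locAway R J := fun _ ⟨s, hs, hx⟩ => ⟨s, hs, h hx⟩

theorem locAway_scale (R : PrimeSpectrum D) (g : K) (I : Submodule D K) :
    locAway R (scale g I) = scale g (locAway R I) := by
  ext x
  simp only [mem_locAway, mem_scale, mul_left_comm]

theorem locAway_semi {P R : PrimeSpectrum D} (h : P ≤ R) :
    locAway R (semi K P) = semi K R := by
  ext x
  constructor
  · rintro ⟨s, hs, t, ht, a, ha⟩
    exact ⟨t * s, away_mul (away_mono h ht) hs, a, by rw [map_mul, mul_assoc, ha]⟩
  · rintro ⟨s, hs, a, ha⟩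
    exact ⟨s, hs, ha ▸ algebraMap_mem_semi P a⟩

theorem isMod_locAway {P R : PrimeSpectrum D} (h : P ≤ R) {S : Set D} {I : Submodule D K}
    (hI : IsMod P S I) : IsMod P (away R) (locAway R I) where
  lt := hI.lt.trans_le (le_locAway R I)
  le := fun _ ⟨_, hs, hx⟩ => locSub_saturated (fun h' => notMem_of_mem_away hs (h h')) (hI.le hx)
  sat := fun s hs _ _ ⟨t, ht, hx⟩ => ⟨t * s, away_mul ht hs, by rwa [map_mul, mul_assoc]⟩

theorem IsMod.sat_of_le {P R : PrimeSpectrum D} (h : P ≤ R) {I : Submodule D K}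
    (hI : IsMod P (away R) I) : ∀ s ∈ away R, ∀ x, algebraMap D K s * x ∈ I → x ∈ I :=
  fun s hs => hI.sat s hs fun h' => notMem_of_mem_away hs (h h')

theorem semi_mul_mem {R : PrimeSpectrum D} {I : Submodule D K}
    (hI : ∀ s ∈ away R, ∀ x, algebraMap D K s * x ∈ I → x ∈ I) {x y : K} (hx : x ∈ semi K R)
    (hy : y ∈ I) : x * y ∈ I := by
  obtain ⟨s, hs, a, ha⟩ := hx
  apply hI s hs
  rw [← mul_assoc, ha]
  exact mul_mem_of_mem a hy

variable (hp : IsPrufer D K) (hsl : IsSemilocal D)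
variable {ι : Type*} {P : PrimeSpectrum D} {p : ι → PrimeSpectrum D} (hfan : IsFan P p)
include hp hsl hfan

theorem IsFan.exists_mul_mem {i j : ι} (hij : i ≠ j) {J : Ideal D} (hJ : ¬ J ≤ P.asIdeal) :
    ∃ s ∈ away (p i), ∃ t ∈ away (p j), s * t ∈ J := by
  by_contra! H
  have hdisj : Disjoint (J : Set D) ↑(awayMonoid (p i) ⊔ awayMonoid (p j)) := by
    refine Set.disjoint_left.2 fun x hx hx' => ?_
    obtain ⟨s, hs, t, ht, rfl⟩ := Submonoid.mem_sup.1 hx'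
    exact H s hs t ht hx
  obtain ⟨N, hN, hJN, hdis⟩ := Ideal.exists_le_prime_disjoint _ _ hdisj
  have key : ∀ k, k = i ∨ k = j → N ≤ (p k).asIdeal ∨ (p k).asIdeal ≤ N := by
    intro k hk
    by_contra h
    obtain ⟨s, hs, hs'⟩ := hsl.exists_mem_away (P := p k) (J := N) fun M hM hpM hNM =>
      h (hp.le_total (N₁ := ⟨N, hN⟩) (N₂ := p k) (M := ⟨M, hM.isPrime⟩) hNM hpM)
    refine Set.disjoint_left.1 hdis hs ?_
    rcases hk with rfl | rfl
    · exact Submonoid.mem_sup_left hs'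
    · exact Submonoid.mem_sup_right hs'
  have hnle : ∀ {k l : ι}, k ≠ l → ¬ p k ≤ p l := fun {k l} hkl hle =>
    absurd (hfan.lt k) (not_lt_of_ge (hfan.le_of_le k l hkl _ le_rfl hle))
  rcases key i (Or.inl rfl) with h1 | h1 <;> rcases key j (Or.inr rfl) with h2 | h2
  · exact hJ (hJN.trans (hfan.le_of_le i j hij ⟨N, hN⟩ h1 h2))
  · exact hnle hij.symm (h2.trans h1)
  · exact hnle hij (h1.trans h2)
  · rcases hp.le_total (N₁ := p i) (N₂ := p j) (M := ⟨N, hN⟩) h1 h2 with h3 | h3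
    · exact hnle hij h3
    · exact hnle hij.symm h3

theorem IsFan.exists_mul_mem_semi {i j : ι} (hij : i ≠ j) {z : K} (hz : z ∈ locSub K P) :
    ∃ s ∈ away (p i), algebraMap D K s * z ∈ semi K (p j) := by
  obtain ⟨a, b, hb, hab⟩ := hz
  obtain ⟨s, hs, t, ht, hst⟩ := hfan.exists_mul_mem hp hsl hij
    (J := colonIdeal (semi K P) z) fun h =>
      hb (h (mem_colonIdeal.2 (hab ▸ algebraMap_mem_semi P a)))
  refine ⟨s, hs, semi_saturated ht ?_⟩
  rw [← locAway_semi (hfan.lt j).le, ← mul_assoc, ← map_mul, mul_comm t]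
  exact le_locAway _ _ (mem_colonIdeal.1 hst)

variable [Finite ι]

theorem IsFan.exists_forall_mul_mem_semi (i : ι) (z : ι → K) (hz : ∀ j, z j ∈ locSub K P) :
    ∃ s ∈ away (p i), ∀ j, j ≠ i → algebraMap D K s * z j ∈ semi K (p j) := by
  classical
  have := Fintype.ofFinite ι
  have hex : ∀ j, ∃ s ∈ away (p i), j ≠ i → algebraMap D K s * z j ∈ semi K (p j) := by
    intro j
    by_cases hij : j = i
    · exact ⟨1, one_mem_away _, fun h => absurd hij h⟩
    · obtain ⟨s, hs, h⟩ := hfan.exists_mul_mem_semi hp hsl (Ne.symm hij) (hz j)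
      exact ⟨s, hs, fun _ => h⟩
  choose s hs h using hex
  refine ⟨∏ j, s j, (awayMonoid (p i)).prod_mem fun j _ => hs j, fun j hj => ?_⟩
  rw [← Finset.prod_erase_mul _ _ (Finset.mem_univ j), map_mul, mul_assoc]
  exact mul_mem_of_mem _ (h j hj)

theorem IsFan.exists_forall_mul_mem (J : ∀ j, Mod K P (away (p j))) (i : ι) {x : K}
    (hx : x ∈ (J i).1) : ∃ s ∈ away (p i), ∀ j, algebraMap D K s * x ∈ (J j).1 := by
  choose y hy hy' hy'' using fun j => (J j).2.exists_mem
  obtain ⟨s, hs, h⟩ := hfan.exists_forall_mul_mem_semi hp hsl i (fun j => x * (y j)⁻¹) fun j =>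
    mul_mem_locSub ((J i).2.le hx) (inv_mem_locSub (hy' j) (hy'' j))
  refine ⟨s, hs, fun j => ?_⟩
  by_cases hj : j = i
  · subst hj
    exact mul_mem_of_mem s hx
  · have := semi_mul_mem ((J j).2.sat_of_le (hfan.lt j).le) (h j hj) (hy j)
    rwa [mul_assoc, inv_mul_cancel_right₀ (ne_zero_of_notMem_maxSub (hy'' j))] at this

theorem IsFan.isMod_inf (J : ∀ j, Mod K P (away (p j))) :
    IsMod P ∅ (locSub K P ⊓ ⨅ j, (J j).1) where
  lt := by
    refine lt_of_le_of_ne (le_inf (maxSub_le_locSub P) (le_iInf fun j => (J j).2.lt.le)) fun h => ?_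
    rcases isEmpty_or_nonempty ι with hι | ⟨⟨i⟩⟩
    · rw [iInf_of_empty, inf_top_eq] at h
      exact (maxSub_lt_locSub P).ne h
    · obtain ⟨y, hy, hy', hy''⟩ := (J i).2.exists_mem
      obtain ⟨s, hs, hsy⟩ := hfan.exists_forall_mul_mem hp hsl J i hy
      have hsP : s ∉ P.asIdeal := fun h' => notMem_of_mem_away hs ((hfan.lt i).le h')
      refine hy'' (maxSub_saturated hsP (h.ge ?_))
      exact ⟨mul_mem_of_mem s hy', Submodule.mem_iInf _ |>.2 hsy⟩
  le := inf_le_left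
  sat := by simp

omit [Finite ι] in
theorem IsFan.le_of_locAway_le {I J : Mod K P ∅}
    (h : ∀ i, locAway (p i) I.1 ≤ locAway (p i) J.1) : I ≤ J := by
  intro x hx
  obtain ⟨s, hs, hs'⟩ := hsl.exists_mem_away (P := P) (J := colonIdeal J.1 x) (by
    intro M hM hPM hJM
    rcases hPM.eq_or_lt with hPM | hPM
    · have hJ := Mod.eq_top_of_isMaximal hp hsl (hPM ▸ hM) J
      refine hM.isPrime.one_notMem (hJM (mem_colonIdeal.2 ?_))
      rw [map_one, one_mul, hJ]
      exact I.2.le hx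
    · obtain ⟨i, hi⟩ := hfan.exists_le ⟨M, hM.isPrime⟩ hM hPM
      obtain ⟨s, hs, hsx⟩ := h i (le_locAway _ _ hx)
      exact hs M hM hi (hJM (mem_colonIdeal.2 hsx)))
  exact J.2.sat_away hp hsl s hs' x (mem_colonIdeal.1 hs)

theorem IsFan.locAway_inf (J : ∀ j, Mod K P (away (p j))) (i : ι) :
    locAway (p i) (locSub K P ⊓ ⨅ j, (J j).1) = (J i).1 := by
  ext x
  constructor
  · rintro ⟨s, hs, hx⟩
    exact (J i).2.sat_of_le (hfan.lt i).le s hs x ((Submodule.mem_iInf _).1 hx.2 i)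
  · intro hx
    obtain ⟨s, hs, hsx⟩ := hfan.exists_forall_mul_mem hp hsl J i hx
    exact ⟨s, hs, mul_mem_of_mem s ((J i).2.le hx), (Submodule.mem_iInf _).2 hsx⟩

/-- A module over the semilocalization at `P` is determined by its localizations at the
members of a fan over `P`. -/
def IsFan.splitIso : Mod K P ∅ ≃o ∀ i, Mod K P (away (p i)) where
  toFun I i := ⟨locAway (p i) I.1, isMod_locAway (hfan.lt i).le I.2⟩
  invFun J := ⟨_, hfan.isMod_inf hp hsl J⟩
  left_inv I := le_antisymm
    (hfan.le_of_locAway_le hp hsl fun i => (hfan.locAway_inf hp hsl _ i).le)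
    (hfan.le_of_locAway_le hp hsl fun i => (hfan.locAway_inf hp hsl
      (fun i => ⟨locAway (p i) I.1, isMod_locAway (hfan.lt i).le I.2⟩) i).ge)
  right_inv J := funext fun i => Subtype.ext (hfan.locAway_inf hp hsl J i)
  map_rel_iff' := ⟨hfan.le_of_locAway_le hp hsl, fun h _ => locAway_mono _ h⟩

omit [Finite ι] in
theorem IsFan.exists_le_act (i : ι) (y z : Mod K P (away (p i))) (hy : y ≠ ⊤) :
    ∃ g, y ≤ act K P (away (p i)) g z := by
  obtain ⟨w, hw, hwy⟩ := SetLike.exists_of_lt (show y.1 < locSub K P from lt_top_iff_ne_top.2 hy)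
  obtain ⟨v, hv, hv', hv''⟩ := z.2.exists_mem
  obtain ⟨a, ha, ha'⟩ := SetLike.exists_of_lt (show P.asIdeal < (p i).asIdeal from hfan.lt i)
  let w' : LocUnit K P := ⟨w, hw, fun h => hwy (y.2.lt.le h)⟩
  let g := w'.mul (LocUnit.mul (.of ha') ⟨v, hv', hv''⟩).inv
  refine ⟨g, fun x hx => ?_⟩
  rw [coe_act, mem_scale]
  have hxw : w⁻¹ * x ∈ locSub K (p i) := by
    by_contra h
    have h1 := hp.maxSub_mul_mem hsl (y.2.sat_of_le (hfan.lt i).le) (hp.inv_mem_maxSub h) hx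
    have hx0 : x ≠ 0 := by
      rintro rfl
      exact h (by simp)
    rw [mul_inv, inv_inv, inv_mul_cancel_right₀ hx0] at h1
    exact hwy h1
  have h2 := hp.maxSub_mul_mem hsl (z.2.sat_of_le (hfan.lt i).le)
    (mul_mem_maxSub hxw (algebraMap_mem_maxSub.2 ha)) hv
  have h3 : g.1⁻¹ * x = w⁻¹ * x * algebraMap D K a * v := by
    simp only [g, w', LocUnit.mul, LocUnit.inv, LocUnit.of, mul_inv, inv_inv]
    ring
  rwa [h3]

theorem IsFan.exists_act_independent (i : ι) (u v : ∀ j, Mod K P (away (p j))) :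
    ∃ g, (∀ y, act K P (away (p i)) g y = y) ∧
      ∀ j, j ≠ i → u j ≠ ⊤ → u j ≤ act K P (away (p j)) g (v j) := by
  have hex : ∀ j, ∃ g, u j ≠ ⊤ → u j ≤ act K P (away (p j)) g (v j) := by
    intro j
    by_cases hu : u j = ⊤
    · exact ⟨⟨1, one_mem_locSub P, one_notMem_maxSub P⟩, fun h => absurd hu h⟩
    · obtain ⟨g, hg⟩ := hfan.exists_le_act hp hsl j (u j) (v j) hu
      exact ⟨g, fun _ => hg⟩
  choose g hg using hex
  obtain ⟨s, hs, h⟩ := hfan.exists_forall_mul_mem_semi hp hsl i (fun j => (g j).1) fun j => (g j).2.1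
  have hsP : s ∉ P.asIdeal := fun h' => notMem_of_mem_away hs ((hfan.lt i).le h')
  have hs0 := algebraMap_ne_zero_of_notMem (K := K) hsP
  refine ⟨(LocUnit.of hsP).inv, fun y => Subtype.ext ?_, fun j hj hu x hx => ?_⟩
  · have h1 := scale_eq_self hs0 (y.2.sat_of_le (hfan.lt i).le s hs)
    change scale (algebraMap D K s)⁻¹ y.1 = y.1
    conv_lhs => rw [← h1]
    rw [scale_scale, inv_mul_cancel₀ hs0, scale_one]
  · have h1 := hg j hu hx
    rw [coe_act, mem_scale] at h1 ⊢
    have h2 := semi_mul_mem ((v j).2.sat_of_le (hfan.lt j).le) (h j hj) h1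
    rw [mul_assoc, mul_inv_cancel_left₀ (g j).ne_zero] at h2
    simpa [LocUnit.inv, LocUnit.of] using h2

/-- The mark of the `i`-th factor: the semilocalization at `p i`. -/
abbrev IsFan.mark (i : ι) : Mod K P (away (p i)) :=
  Mod.ofUpper hp hsl (hfan.lt i) (Mod.semi hp hsl (p i))

omit [Finite ι] in
theorem IsFan.mark_ne_top (i : ι) : hfan.mark (K := K) hp hsl i ≠ ⊤ := by
  intro h
  refine Mod.loc_ne_top (hfan.lt i) hp (top_le_iff.1 ?_)
  exact (congrArg Subtype.val h).ge.trans (semi_le_locSub (p i))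

/-- Posets equivariantly identified with a part of `Mod K P ∅` described by supports decompose
as a product along a fan. -/
def IsFan.productData (𝒮 : Set (Set ι)) {X : Type*} [PartialOrder X] (σ : LocUnit K P → X ≃o X)
    (f : X ≃o {I : Mod K P ∅ // {i | hfan.splitIso hp hsl I i ≠ ⊤} ∈ 𝒮})
    (hf : ∀ g x, (f (σ g x)).1 = act K P ∅ g (f x).1) :
    ProductData 𝒮 σ fun i => act K P (away (p i)) where
  iso := f.trans (subtypeOrderIso (hfan.splitIso hp hsl) fun _ => Iff.rfl)
  map_smul g x i := by
    refine Subtype.ext ?_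
    change locAway (p i) (f (σ g x)).1.1 = scale g.1 (locAway (p i) (f x).1.1)
    rw [hf, coe_act, locAway_scale]
  mark := hfan.mark hp hsl
  mark_ne_top := hfan.mark_ne_top hp hsl
  transitive i y z hy _ := hfan.exists_le_act hp hsl i y z hy
  independent i u v := by
    obtain ⟨g, hg, h⟩ := hfan.exists_act_independent hp hsl i u v
    exact ⟨g, hg, fun j hj hu _ => h j hj hu⟩

theorem IsFan.splitIso_semi :
    hfan.splitIso hp hsl (Mod.semi (K := K) hp hsl P) = hfan.mark hp hsl :=
  funext fun i => Subtype.ext (locAway_semi (hfan.lt i).le)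

end Split

end Paper

namespace Paper

/-- The product decomposition of the whole poset `Mod K P ∅`. -/
def IsFan.productDataUniv {D : Type*} [CommRing D] [IsDomain D]
    {K : Type*} [Field K] [Algebra D K] [IsFractionRing D K] (hp : IsPrufer D K)
    (hsl : IsSemilocal D) {ι : Type*} [Finite ι] {P : PrimeSpectrum D} {p : ι → PrimeSpectrum D}
    (hfan : IsFan P p) :
    ProductData Set.univ (act K P ∅) fun i => act K P (away (p i)) :=
  hfan.productData hp hsl Set.univ (act K P ∅)
    { toEquiv := (Equiv.subtypeUnivEquiv fun _ => trivial).symm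
      map_rel_iff' := Iff.rfl } fun _ _ => rfl

section Transfer

variable {D₁ : Type*} [CommRing D₁] [IsDomain D₁]
variable {K₁ : Type*} [Field K₁] [Algebra D₁ K₁] [IsFractionRing D₁ K₁]
variable {D₂ : Type*} [CommRing D₂] [IsDomain D₂]
variable {K₂ : Type*} [Field K₂] [Algebra D₂ K₂] [IsFractionRing D₂ K₂]
variable (hp₁ : IsPrufer D₁ K₁) (hsl₁ : IsSemilocal D₁)
  (hp₂ : IsPrufer D₂ K₂) (hsl₂ : IsSemilocal D₂) (ν : ↥(hiSpec D₁) ≃o ↥(hiSpec D₂))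
  (hZ : ∀ P Q : ↥(hiSpec D₁), DirectlyBelow D₁ Q.1 P.1 →
    (∃ R ∈ hiSpec D₁, R ≠ ⊥ ∧ R < P.1) →
    Nonempty (AFracStar (Zring D₁ P.1 Q.1 (mem_hiSpec_prime P.2)) ≃o
      AFracStar (Zring D₂ (ν P).1 (ν Q).1 (mem_hiSpec_prime (ν P).2))))
  (hprinc : ∀ (M : Ideal D₁) (hM : M.IsMaximal),
    (Ideal.map (algebraMap D₁ (locRing D₁ M hM.isPrime)) M).IsPrincipal ↔
      (Ideal.map (algebraMap D₂ (locRing D₂ (ν ⟨M, maximal_mem_hiSpec hM⟩).1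
          (mem_hiSpec_prime (ν ⟨M, maximal_mem_hiSpec hM⟩).2)))
        (ν ⟨M, maximal_mem_hiSpec hM⟩).1).IsPrincipal)

theorem isMaximal_apply_iff (P : hiSpec D₁) :
    (hiPrime P).asIdeal.IsMaximal ↔ (hiPrime (ν P)).asIdeal.IsMaximal :=
  isMax_hiSpec_iff.symm.trans (ν.isMax_apply.symm.trans isMax_hiSpec_iff)

theorem apply_eq_bot_iff (P : hiSpec D₁) : (ν P).1 = ⊥ ↔ P.1 = ⊥ :=
  isMin_hiSpec_iff.symm.trans (ν.isMin_apply.trans isMin_hiSpec_iff)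

/-- The elements covering `P` correspond to those covering `ν P`. -/
def coverEquiv (P : hiSpec D₁) : {R : hiSpec D₁ // P ⋖ R} ≃ {R : hiSpec D₂ // ν P ⋖ R} :=
  ν.toEquiv.subtypeEquiv fun _ => (apply_covBy_apply_iff ν).symm

include hp₂ hsl₂ in
theorem IsPrufer.isFan_apply (P : hiSpec D₁) :
    IsFan (hiPrime (ν P)) fun R : {R : hiSpec D₁ // P ⋖ R} => hiPrime (ν R.1) :=
  (hp₂.isFan hsl₂ (ν P)).comp_equiv (coverEquiv ν P)

include hprinc in
theorem exists_maxSub_eq_scale_iff {P : hiSpec D₁} (hP : P.1 ≠ ⊥)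
    (hM : (hiPrime P).asIdeal.IsMaximal) :
    (∃ x, maxSub K₁ (hiPrime P) = scale x (locSub K₁ (hiPrime P))) ↔
      ∃ x, maxSub K₂ (hiPrime (ν P)) = scale x (locSub K₂ (hiPrime (ν P))) :=
  (isPrincipal_map_iff (P := hiPrime P) hP).symm.trans <| (hprinc _ hM).trans <|
    isPrincipal_map_iff (P := hiPrime (ν P)) fun h => hP ((apply_eq_bot_iff ν P).1 h)

include hZ hprinc in
theorem exists_congr_preserving_semi_hiSpec (P : hiSpec D₁) (hP : P.1 ≠ ⊥) :
    ∃ φ : EquivClosure (act K₁ (hiPrime P) ∅) ≃o EquivClosure (act K₂ (hiPrime (ν P)) ∅),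
      ∀ c, c (Mod.semi hp₁ hsl₁ (hiPrime P)) = Mod.semi hp₁ hsl₁ (hiPrime P) ↔
        φ c (Mod.semi hp₂ hsl₂ (hiPrime (ν P))) = Mod.semi hp₂ hsl₂ (hiPrime (ν P)) := by
  have := (hp₁.finite_hiSpec hsl₁).to_subtype
  induction P using WellFoundedGT.induction with
  | ind P ih =>
  let d₁ := (hp₁.isFan hsl₁ P).productDataUniv hp₁ hsl₁
  let d₂ := (hp₂.isFan_apply hsl₂ ν P).productDataUniv hp₂ hsl₂
  refine d₁.exists_congr d₂ ((hp₁.isFan hsl₁ P).splitIso_semi hp₁ hsl₁)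
    ((hp₂.isFan_apply hsl₂ ν P).splitIso_semi hp₂ hsl₂) fun R => ?_
  have hR : R.1.1 ≠ ⊥ := fun h => not_lt_bot (h ▸ R.2.1 : P.1 < ⊥)
  obtain ⟨φ, hφ⟩ := ih R.1 R.2.1 hR
  obtain ⟨ψ⟩ := nonempty_lowerIso (hiPrime_lt.2 R.2.1) hp₁ (hiPrime_lt.2 (ν.lt_iff_lt.2 R.2.1)) hp₂
    (hZ R.1 P (directlyBelow_iff_covBy.2 R.2) ⟨P.1, P.2, hP, R.2.1⟩)
  exact exists_congr_preserving_semi hp₁ hsl₁ (hiPrime_lt.2 R.2.1) hp₂ hsl₂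
    (hiPrime_lt.2 (ν.lt_iff_lt.2 R.2.1)) (isMaximal_apply_iff ν R.1)
    (exists_maxSub_eq_scale_iff ν hprinc hR) φ hφ ψ

end Transfer

end Paper

namespace Paper

section Root

variable {D : Type*} [CommRing D] [IsDomain D]
variable {K : Type*} [Field K] [Algebra D K] [IsFractionRing D K]

theorem scale_eq_span_mul {x : K} (hx : x ≠ 0) (I : Submodule D K) :
    scale x I = Submodule.span D {x} * I := by
  ext y
  rw [mem_scale, Submodule.mem_span_singleton_mul]
  exact ⟨fun h => ⟨_, h, mul_inv_cancel_left₀ hx y⟩, by rintro ⟨z, hz, rfl⟩; simpa [hx] using hz⟩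

theorem isFracOf_bot_iff {I : Submodule D K} :
    IsFracOf D K ⊥ I ↔ ∃ d : K, d ≠ 0 ∧ ∀ x ∈ I, ∃ a, algebraMap D K a = d * x := by
  refine ⟨fun h => h.2, fun h => ⟨fun a ha x hx => ?_, h⟩⟩
  obtain ⟨a, rfl⟩ := Algebra.mem_bot.1 ha
  exact mul_mem_of_mem a hx

theorem IsFracOf.scale {x : K} (hx : x ≠ 0) {I : Submodule D K} (h : IsFracOf D K ⊥ I) :
    IsFracOf D K ⊥ (scale x I) := by
  obtain ⟨d, hd, h⟩ := isFracOf_bot_iff.1 h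
  exact isFracOf_bot_iff.2 ⟨d * x⁻¹, mul_ne_zero hd (inv_ne_zero hx), fun y hy => by
    rw [mul_assoc]; exact h _ hy⟩

variable (D K) in
/-- The fractional ideals of `D` inside `K`. -/
abbrev Frac : Type _ := {I : Submodule D K // IsFracOf D K ⊥ I}

instance : OrderBot (Frac D K) where
  bot := ⟨⊥, isFracOf_bot_iff.2 ⟨1, one_ne_zero, fun x hx => ⟨0, by simp_all⟩⟩⟩
  bot_le I := bot_le (a := I.1)

variable (D K) in
/-- `D` as a fractional ideal. -/
def Frac.one : Frac D K := ⟨Subalgebra.toSubmodule ⊥, isFracOf_bot_iff.2 ⟨1, one_ne_zero,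
  fun x hx => (Algebra.mem_bot.1 hx).imp fun a h => by rw [h, one_mul]⟩⟩

theorem Frac.mem_one {x : K} : x ∈ (Frac.one D K).1 ↔ ∃ a, algebraMap D K a = x := Algebra.mem_bot

theorem Frac.one_ne_bot : Frac.one D K ≠ ⊥ := fun h =>
  one_ne_zero ((Submodule.mem_bot D).1 ((congrArg Subtype.val h).le
    (Frac.mem_one.2 ⟨1, map_one _⟩) : (1 : K) ∈ (⊥ : Submodule D K)))

/-- The units of a localization act on the fractional ideals. -/
def fracAct (P : PrimeSpectrum D) (g : LocUnit K P) : Frac D K ≃o Frac D K where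
  toFun I := ⟨scale g.1 I.1, I.2.scale g.ne_zero⟩
  invFun I := ⟨scale g.1⁻¹ I.1, I.2.scale (inv_ne_zero g.ne_zero)⟩
  left_inv I := Subtype.ext (by simp [scale_scale, g.ne_zero, scale_one])
  right_inv I := Subtype.ext (by simp [scale_scale, g.ne_zero, scale_one])
  map_rel_iff' {I J} := by
    refine ⟨fun h x hx => ?_, fun h => scale_mono h⟩
    exact (mul_mem_scale g.ne_zero).1 (h ((mul_mem_scale g.ne_zero).2 hx))

theorem coe_fracAct (P : PrimeSpectrum D) (g : LocUnit K P) (I : Frac D K) :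
    (fracAct P g I).1 = scale g.1 I.1 := rfl

variable {P : PrimeSpectrum D} (hP : P.asIdeal = ⊥)

theorem locSub_eq_top (hP : P.asIdeal = ⊥) : locSub K P = ⊤ := by
  refine eq_top_iff.2 fun x _ => ?_
  obtain ⟨a, s, hs, rfl⟩ := IsFractionRing.div_surjective (A := D) x
  exact ⟨a, s, by simpa [hP] using nonZeroDivisors.ne_zero hs,
    mul_div_cancel₀ _ (by simpa using nonZeroDivisors.ne_zero hs)⟩

theorem maxSub_eq_bot (hP : P.asIdeal = ⊥) : maxSub K P = ⊥ := by
  refine eq_bot_iff.2 fun x hx => by_contra fun hx0 => ?_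
  exact inv_notMem_locSub hx hx0 (locSub_eq_top (K := K) hP ▸ Submodule.mem_top)

/-- Nonzero elements of `K` are units of the localization at `0`. -/
def LocUnit.ofNeZero {x : K} (hx : x ≠ 0) : LocUnit K P :=
  ⟨x, locSub_eq_top (K := K) hP ▸ Submodule.mem_top, fun h => hx (by
    rwa [maxSub_eq_bot hP, Submodule.mem_bot] at h)⟩

theorem semi_eq_one (hP : P.asIdeal = ⊥) : semi K P = (Frac.one D K).1 := by
  ext x
  rw [Frac.mem_one]
  constructor
  · rintro ⟨s, hs, a, ha⟩
    have hu : IsUnit s := by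
      by_contra h
      obtain ⟨M, hM, hsM⟩ := exists_max_ideal_of_mem_nonunits h
      exact hs M hM (hP ▸ bot_le) hsM
    obtain ⟨u, rfl⟩ := hu
    refine ⟨↑u⁻¹ * a, ?_⟩
    rw [map_mul, ← ha, ← mul_assoc, ← map_mul, Units.inv_mul, map_one, one_mul]
  · rintro ⟨a, rfl⟩
    exact algebraMap_mem_semi P a

theorem isMod_iff_ne_bot (hP : P.asIdeal = ⊥) {I : Submodule D K} : IsMod P ∅ I ↔ I ≠ ⊥ :=
  ⟨fun h => bot_lt_iff_ne_bot.1 (maxSub_eq_bot (K := K) hP ▸ h.lt), fun h =>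
    ⟨maxSub_eq_bot (K := K) hP ▸ bot_lt_iff_ne_bot.2 h, locSub_eq_top (K := K) hP ▸ le_top, by simp⟩⟩

/-- Fractional star operations as equivariant closures. -/
def fracStarIso : FracStar D K ⊥ ≃o EquivClosure (fracAct (K := K) P) where
  toFun f := ⟨f.toFun, f.le_star', f.mono', f.idem', fun g I => Subtype.ext (by
    rw [coe_fracAct, scale_eq_span_mul g.ne_zero]
    exact f.smul' g.1 g.ne_zero I _ (scale_eq_span_mul g.ne_zero I.1))⟩
  invFun c := ⟨c, c.le_closure, fun _ _ h => c.mono h, c.idem, fun x hx I J hJ => by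
    have h1 : J = fracAct P (.ofNeZero hP hx) I :=
      Subtype.ext (hJ.trans (scale_eq_span_mul hx I.1).symm)
    rw [h1, c.comm, coe_fracAct]
    exact scale_eq_span_mul hx _⟩
  left_inv _ := rfl
  right_inv _ := rfl
  map_rel_iff' := Iff.rfl

/-- Star operations as equivariant closures fixing `D`. -/
def starIso : {f : FracStar D K ⊥ // FracStar.IsStarOp D K f} ≃o
    {c : EquivClosure (fracAct (K := K) P) // c (.one D K) = .one D K} :=
  subtypeOrderIso (fracStarIso hP) fun _ =>
    ⟨fun h => Subtype.ext (h (Frac.one D K).2), fun h _ => congrArg Subtype.val h⟩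

theorem eq_top_of_isFracOf_top (hP : P.asIdeal = ⊥) (h : IsFracOf D K ⊥ (⊤ : Submodule D K)) :
    P.asIdeal.IsMaximal := by
  obtain ⟨d, hd, h⟩ := isFracOf_bot_iff.1 h
  refine (semi_eq_locSub_iff (K := K)).1 ?_
  rw [semi_eq_one hP, locSub_eq_top hP]
  refine eq_top_iff.2 fun x _ => Frac.mem_one.2 ?_
  obtain ⟨a, ha⟩ := h (d⁻¹ * x) trivial
  exact ⟨a, by rw [ha, mul_inv_cancel_left₀ hd]⟩

include hP in
theorem fracClosure_bot (hmax : ¬ P.asIdeal.IsMaximal) (c : EquivClosure (fracAct (K := K) P)) :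
    c ⊥ = ⊥ := by
  by_contra h
  obtain ⟨z, hz, hz0⟩ := Submodule.exists_mem_ne_zero_of_ne_bot
    (fun h' => h (Subtype.ext h') : (c ⊥).1 ≠ ⊥)
  have htop : (c ⊥).1 = ⊤ := by
    refine eq_top_iff.2 fun x _ => ?_
    by_cases hx : x = 0
    · exact hx ▸ zero_mem _
    · have h1 := c.comm (.ofNeZero hP (mul_ne_zero hx (inv_ne_zero hz0))) ⊥
      rw [map_bot] at h1
      rw [h1, coe_fracAct, mem_scale]
      simpa [LocUnit.ofNeZero, hx] using hz
  exact hmax (eq_top_of_isFracOf_top hP (htop ▸ (c ⊥).2))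

variable (hp : IsPrufer D K) (hsl : IsSemilocal D)
variable {ι : Type*} [Finite ι] {p : ι → PrimeSpectrum D} (hfan : IsFan P p)
include hp hsl hfan

omit [Finite ι] in
include hP in
theorem IsFan.le_one_iff (I : Mod K P ∅) :
    I.1 ≤ (Frac.one D K).1 ↔ ∀ i, locAway (p i) I.1 ≤ semi K (p i) := by
  simp_rw [← locAway_semi (K := K) (hfan.lt _).le, ← semi_eq_one (K := K) hP]
  exact ⟨fun h i => locAway_mono _ h, fun h =>
    hfan.le_of_locAway_le hp hsl (J := Mod.semi hp hsl P) h⟩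

include hP in
theorem IsFan.isFracOf_iff (I : Mod K P ∅) :
    IsFracOf D K ⊥ I.1 ↔ ∀ i, hfan.splitIso hp hsl I i ≠ ⊤ := by
  classical
  have := Fintype.ofFinite ι
  rw [isFracOf_bot_iff]
  constructor
  · rintro ⟨d, hd, h⟩ i htop
    let g : LocUnit K P := (LocUnit.ofNeZero hP hd)
    have h1 : (act K P ∅ g I).1 ≤ (Frac.one D K).1 := fun x hx => Frac.mem_one.2 (by
      simpa [g, LocUnit.ofNeZero, hd] using h _ (mem_scale.1 hx))
    have h2 := (hfan.le_one_iff hP hp hsl _).1 h1 i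
    rw [coe_act, locAway_scale] at h2
    apply hfan.mark_ne_top (K := K) hp hsl i
    rw [← top_le_iff, ← map_top (act K P (away (p i)) g), ← htop]
    exact h2
  · intro h
    choose g hg using fun i => hfan.exists_le_act hp hsl i _ (hfan.mark hp hsl i) (h i)
    choose a b hb hab using fun i => (g i).2.1
    have hb0 : ∀ i, algebraMap D K (b i) ≠ 0 := fun i => algebraMap_ne_zero_of_notMem (hb i)
    have hd : algebraMap D K (∏ i, b i) ≠ 0 := by
      rw [map_prod]
      exact Finset.prod_ne_zero_iff.2 fun i _ => hb0 i
    refine ⟨_, hd, fun x hx => Frac.mem_one.1 (?_ : _ ∈ (Frac.one D K).1)⟩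
    refine (hfan.le_one_iff hP hp hsl (act K P ∅ (.ofNeZero hP hd) I)).2 (fun i y hy => ?_)
      ((mul_mem_scale hd).2 hx)
    rw [coe_act, locAway_scale, mem_scale] at hy
    have h1 := mem_scale.1 (hg i hy)
    change (g i).1⁻¹ * ((algebraMap D K (∏ i, b i))⁻¹ * y) ∈ semi K (p i) at h1
    have h2 := mul_mem_of_mem ((∏ j ∈ Finset.univ.erase i, b j) * a i) h1
    convert h2 using 1
    rw [map_mul, ← hab, ← Finset.prod_erase_mul _ _ (Finset.mem_univ i), map_mul] at *
    have := (g i).ne_zero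
    have := mul_ne_zero_iff.1 hd
    field_simp
    rw [mul_assoc, mul_div_cancel_right₀ _ hd]

/-- Nonzero fractional ideals are the modules none of whose localizations is `K`. -/
def IsFan.fracIso : {I : Frac D K // I ≠ ⊥} ≃o
    {I : Mod K P ∅ // {i | hfan.splitIso hp hsl I i ≠ ⊤} ∈ ({Set.univ} : Set (Set ι))} where
  toFun I := ⟨⟨I.1.1, (isMod_iff_ne_bot hP).2 fun h => I.2 (Subtype.ext h)⟩,
    Set.eq_univ_of_forall ((hfan.isFracOf_iff hP hp hsl _).1 I.1.2)⟩
  invFun I := ⟨⟨I.1.1, (hfan.isFracOf_iff hP hp hsl _).2 (Set.eq_univ_iff_forall.1 I.2)⟩,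
    fun h => (isMod_iff_ne_bot hP).1 I.1.2 (congrArg Subtype.val h)⟩
  left_inv _ := rfl
  right_inv _ := rfl
  map_rel_iff' := Iff.rfl

/-- The product decomposition of the poset of nonzero fractional ideals. -/
def IsFan.productDataFrac : ProductData {(Set.univ : Set ι)}
    (fun g => neRestrict (fracAct (K := K) P g) (map_bot _)) fun i => act K P (away (p i)) :=
  hfan.productData hp hsl _ _ (hfan.fracIso hP hp hsl) fun _ _ => rfl

/-- Star operations on a domain that is not a field decompose along a fan over `0`. -/
def IsFan.starPiIso (hmax : ¬ P.asIdeal.IsMaximal) :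
    {f : FracStar D K ⊥ // FracStar.IsStarOp D K f} ≃o
      ∀ i, {c : EquivClosure (act K P (away (p i))) //
        c (hfan.mark hp hsl i) = hfan.mark hp hsl i} :=
  ((starIso hP).trans (subtypeOrderIso (q := fun c => c ⟨.one D K, Frac.one_ne_bot⟩ =
      ⟨.one D K, Frac.one_ne_bot⟩)
    (EquivClosure.neBotIso (fracClosure_bot hP hmax)
      (fun g => neRestrict (fracAct P g) (map_bot _)) fun _ _ => rfl)
    fun _ => ⟨fun h => Subtype.ext h, fun h => congrArg Subtype.val h⟩)).trans
  ((hfan.productDataFrac hP hp hsl).markedIso (t := ⟨.one D K, Frac.one_ne_bot⟩)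
    ((congrArg (hfan.splitIso hp hsl) (Subtype.ext (semi_eq_one hP).symm)).trans
      (hfan.splitIso_semi hp hsl)))

end Root

end Paper

namespace Paper

section FieldCase

variable {D : Type*} [CommRing D] [IsDomain D]
variable {K : Type*} [Field K] [Algebra D K] [IsFractionRing D K]

theorem Frac.one_eq_top {P : PrimeSpectrum D} (hP : P.asIdeal = ⊥) (hmax : P.asIdeal.IsMaximal) :
    (Frac.one D K).1 = ⊤ := by
  rw [← semi_eq_one hP, semi_eq_locSub_iff.2 hmax, locSub_eq_top hP]

theorem Frac.eq_bot_or_eq_one {P : PrimeSpectrum D} (hP : P.asIdeal = ⊥)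
    (hmax : P.asIdeal.IsMaximal) (I : Frac D K) : I = ⊥ ∨ I = .one D K := by
  refine or_iff_not_imp_left.2 fun h => Subtype.ext ?_
  obtain ⟨z, hz, hz0⟩ := Submodule.exists_mem_ne_zero_of_ne_bot
    (fun h' => h (Subtype.ext h') : I.1 ≠ ⊥)
  rw [one_eq_top hP hmax]
  refine eq_top_iff.2 fun x _ => ?_
  obtain ⟨a, ha⟩ := Frac.mem_one.1 (one_eq_top (K := K) hP hmax ▸ Submodule.mem_top : x / z ∈ _)
  have h1 := mul_mem_of_mem a hz
  rwa [ha, div_mul_cancel₀ _ hz0] at h1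

theorem exists_two_star {P : PrimeSpectrum D} (hP : P.asIdeal = ⊥) (hmax : P.asIdeal.IsMaximal) :
    ∃ a₀ a₁ : {f : FracStar D K ⊥ // FracStar.IsStarOp D K f},
      a₀ < a₁ ∧ ∀ a, a = a₀ ∨ a = a₁ := by
  let _ : OrderTop (Frac D K) :=
    { top := .one D K, le_top := fun I => (le_top : I.1 ≤ ⊤).trans_eq (Frac.one_eq_top hP hmax).symm }
  have h2 := Frac.eq_bot_or_eq_one (K := K) hP hmax
  have h3 (c : EquivClosure (fracAct (K := K) P)) : c = ⊥ ∨ c = ⊤ := by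
    rw [EquivClosure.eq_bot_iff', EquivClosure.eq_top_iff']
    refine (h2 (c ⊥)).imp (fun h y => ?_) fun h y => ?_
    · obtain rfl | rfl := h2 y
      exacts [h, c.apply_top]
    · obtain rfl | rfl := h2 y
      exacts [h, c.apply_top]
  have h4 : (⊥ : EquivClosure (fracAct (K := K) P)) < ⊤ :=
    bot_lt_iff_ne_bot.2 fun h => Frac.one_ne_bot (EquivClosure.eq_bot_iff'.1 h ⊥)
  let e := (starIso (K := K) hP).symm
  refine ⟨e ⟨⊥, rfl⟩, e ⟨⊤, rfl⟩, e.lt_iff_lt.2 (Subtype.mk_lt_mk.2 h4), fun a => ?_⟩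
  rw [← e.symm_apply_eq, ← e.symm_apply_eq]
  exact (h3 (e.symm a).1).imp Subtype.ext Subtype.ext

end FieldCase

theorem nonempty_piOrderIso {ι : Type*} {A B : ι → Type*} [∀ i, PartialOrder (A i)]
    [∀ i, PartialOrder (B i)] (h : ∀ i, Nonempty (A i ≃o B i)) :
    Nonempty ((∀ i, A i) ≃o ∀ i, B i) :=
  ⟨⟨Equiv.piCongrRight fun i => (h i).some.toEquiv,
    forall_congr' fun i => (h i).some.le_iff_le⟩⟩

end Paper

namespace Paper

/-- If `ν : hiSpec(D₁) → hiSpec(D₂)` is an order isomorphism such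
that `FStar(Z(P)) ≅ FStar(Z(ν(P)))` for every `P` that is not minimal in
`hiSpec(D₁) \ {(0)}`, and maximal ideals correspond preserving principality of
`M(D₁)_M`, then `Star(D₁)` and `Star(D₂)` are order isomorphic. -/
theorem statement12
    (D₁ : Type*) [CommRing D₁] [IsDomain D₁]
    (K₁ : Type*) [Field K₁] [Algebra D₁ K₁] [IsFractionRing D₁ K₁]
    (D₂ : Type*) [CommRing D₂] [IsDomain D₂]
    (K₂ : Type*) [Field K₂] [Algebra D₂ K₂] [IsFractionRing D₂ K₂]
    (hp₁ : IsPrufer D₁ K₁) (hsl₁ : IsSemilocal D₁)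
    (hp₂ : IsPrufer D₂ K₂) (hsl₂ : IsSemilocal D₂)
    (ν : ↥(hiSpec D₁) ≃o ↥(hiSpec D₂))
    (hZ : ∀ P Q : ↥(hiSpec D₁), DirectlyBelow D₁ Q.1 P.1 →
      (∃ R ∈ hiSpec D₁, R ≠ ⊥ ∧ R < P.1) →
      Nonempty (AFracStar (Zring D₁ P.1 Q.1 (mem_hiSpec_prime P.2)) ≃o
        AFracStar (Zring D₂ (ν P).1 (ν Q).1 (mem_hiSpec_prime (ν P).2))))
    (hprinc : ∀ (M : Ideal D₁) (hM : M.IsMaximal),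
      (Ideal.map (algebraMap D₁ (locRing D₁ M hM.isPrime)) M).IsPrincipal ↔
        (Ideal.map (algebraMap D₂ (locRing D₂ (ν ⟨M, maximal_mem_hiSpec hM⟩).1
            (mem_hiSpec_prime (ν ⟨M, maximal_mem_hiSpec hM⟩).2)))
          (ν ⟨M, maximal_mem_hiSpec hM⟩).1).IsPrincipal) :
    Nonempty ({f : FracStar D₁ K₁ ⊥ // FracStar.IsStarOp D₁ K₁ f} ≃o
      {f : FracStar D₂ K₂ ⊥ // FracStar.IsStarOp D₂ K₂ f}) := by
  let P₀ : hiSpec D₁ := ⟨⊥, Ideal.isPrime_bot, Or.inl rfl⟩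
  have h0 : (hiPrime (ν P₀)).asIdeal = ⊥ := (apply_eq_bot_iff ν P₀).2 rfl
  by_cases hmax : (hiPrime P₀).asIdeal.IsMaximal
  · obtain ⟨a₀, a₁, ha, hA⟩ := exists_two_star (K := K₁) (P := hiPrime P₀) rfl hmax
    obtain ⟨b₀, b₁, hb, hB⟩ := exists_two_star (K := K₂) h0 ((isMaximal_apply_iff ν P₀).1 hmax)
    exact nonempty_orderIso_of_two ha hA hb hB
  · have := (hp₁.finite_hiSpec hsl₁).to_subtype
    let e₁ := (hp₁.isFan hsl₁ P₀).starPiIso (K := K₁) rfl hp₁ hsl₁ hmax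
    let e₂ := (hp₂.isFan_apply hsl₂ ν P₀).starPiIso (K := K₂) h0 hp₂ hsl₂
      fun h => hmax ((isMaximal_apply_iff ν P₀).2 h)
    obtain ⟨e⟩ := nonempty_piOrderIso fun R : {R // P₀ ⋖ R} => by
      have hR : R.1.1 ≠ ⊥ := fun h => not_lt_bot (h ▸ R.2.1 : P₀.1 < ⊥)
      have h1 := exists_congr_preserving_semi_hiSpec hp₁ hsl₁ hp₂ hsl₂ ν hZ hprinc R.1 hR
      exact nonempty_fixing_semi_orderIso hp₁ hsl₁ (hiPrime_lt.2 R.2.1) hp₂ hsl₂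
        (hiPrime_lt.2 (ν.lt_iff_lt.2 R.2.1)) (isMaximal_apply_iff ν R.1)
        (exists_maxSub_eq_scale_iff ν hprinc hR) h1.choose h1.choose_spec
    exact ⟨(e₁.trans e).trans e₂.symm⟩

end Paper
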